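/- Let F|K be an algebraic function field and P an Abhyankar place of F|K whose value group v_PF has finite rank r > 1 (the rank is the number of proper convex subgroups of v_PF). Let ζ₁,…,ζ_m ∈ 𝓞_F. Then there exist a finite purely inseparable extension 𝓚 of K and a finite extension 𝓕 of the compositum F.𝓚, equipped with an extension of P, such that (𝓕|𝓚,P) is uniformizable with respect to ζ₁,…,ζ_m and 𝓕 is obtained from F.𝓚 by a tower of at most r−1 successive Galois extensions if P is zero-dimensional (FP|K algebraic), and by a tower of at most r successive Galois extensions otherwise. -/

import Mathlib

/-! Common valuation-theoretic notions, following F.-V. Kuhlmann,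
"On local uniformization in arbitrary characteristic I".

A valued field `(F, P)` is modelled by a field `F` together with a
`ValuationSubring F` (the valuation ring `𝓞` of the place `P`). -/

namespace LocalUnif

variable {F : Type*} [Field F]

/-- `x` lies in the maximal ideal of the valuation subring `O`,
i.e. the residue `xP` is `0` (equivalently `v_P x > 0`, or `x = 0`). -/
def InMax (O : ValuationSubring F) (x : F) : Prop := x = 0 ∨ x⁻¹ ∉ O

/-- `x` is a unit of the valuation subring `O`, i.e. `v_P x = 0`. -/
def IsVUnit (O : ValuationSubring F) (x : F) : Prop := x ≠ 0 ∧ x ∈ O ∧ x⁻¹ ∈ O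

/-- The valuation with valuation ring `O` is trivial on the subfield `K`;
equivalently, every nonzero element of `K` is a unit of `O`. -/
def TrivialOn (O : ValuationSubring F) (K : Subfield F) : Prop :=
  ∀ x ∈ K, x ∈ O ∧ x⁻¹ ∈ O

/-- The residue field of `O` equals (the isomorphic image of) the subfield `K`:
every element of `O` is congruent to an element of `K` modulo the maximal ideal.
(For a place `P` of `F|K` this says that `P` is a rational place, `FP = K`.) -/
def ResidueEq (O : ValuationSubring F) (K : Subfield F) : Prop :=
  ∀ x ∈ O, ∃ c ∈ K, InMax O (x - c)

/-- The residue field of `O` is algebraic over (the image of) `K`; for a place of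
`F|K` this says that `P` is zero-dimensional. -/
def ResidueAlgebraic (O : ValuationSubring F) (K : Subfield F) : Prop :=
  ∀ x ∈ O, ∃ p : Polynomial F, p ≠ 0 ∧ (∀ i, p.coeff i ∈ K) ∧ InMax O (Polynomial.eval x p)

/-- The values `v_P (x i)` are rationally independent modulo `v_P K`:
no nontrivial ℤ-linear combination of the values lies in `ℚ ⊗ v_P K`
(equivalently, in `v_P K`, by clearing denominators). -/
def ValIndepMod (O : ValuationSubring F) (K : Subfield F) {ρ : ℕ} (x : Fin ρ → F) : Prop :=
  (∀ i, x i ≠ 0) ∧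
  ∀ e : Fin ρ → ℤ, (∃ c ∈ K, c ≠ 0 ∧ IsVUnit O ((∏ i, x i ^ e i) / c)) → e = 0

/-- The residues `(y i)P` are algebraically independent over the residue field `KP`:
for every polynomial with coefficients in `𝓞_K = K ∩ O`, at least one of which is
a unit, the value of the polynomial at `y` is a unit (so its residue is nonzero). -/
def ResIndep (O : ValuationSubring F) (K : Subfield F) {τ : ℕ} (y : Fin τ → F) : Prop :=
  (∀ i, y i ∈ O) ∧
  ∀ p : MvPolynomial (Fin τ) F, (∀ m, p.coeff m ∈ K ∧ p.coeff m ∈ O) →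
    (∃ m, IsVUnit O (p.coeff m)) → ¬ InMax O (MvPolynomial.eval y p)

/-- `dim_ℚ (ℚ ⊗ (v_P F / v_P K)) = ρ`: there is a maximal set of `ρ` elements of `F`
whose values are rationally independent modulo `v_P K`. -/
def RatRankEq (O : ValuationSubring F) (K : Subfield F) (ρ : ℕ) : Prop :=
  (∃ x : Fin ρ → F, ValIndepMod O K x) ∧ ∀ x : Fin (ρ + 1) → F, ¬ ValIndepMod O K x

/-- `trdeg (FP | KP) = τ`: there is a maximal set of `τ` elements of `O` whose
residues are algebraically independent over `KP`. -/
def ResTrdegEq (O : ValuationSubring F) (K : Subfield F) (τ : ℕ) : Prop :=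
  (∃ y : Fin τ → F, ResIndep O K y) ∧ ∀ y : Fin (τ + 1) → F, ¬ ResIndep O K y

/-- `trdeg (F | K) = d`. -/
def TrdegEq (K : Subfield F) (d : ℕ) : Prop :=
  ∃ t : Fin d → F, IsTranscendenceBasis ↥K t

/-- `P` is an Abhyankar place of `F|K`:
`trdeg F|K = trdeg FP|K + dim_ℚ (ℚ ⊗ v_P F)`. -/
def IsAbhyankar (O : ValuationSubring F) (K : Subfield F) : Prop :=
  ∃ d ρ τ : ℕ, d = ρ + τ ∧ TrdegEq K d ∧ RatRankEq O K ρ ∧ ResTrdegEq O K τ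

/-- The value group of `O` is archimedean ordered (rank at most 1):
for any two positive values `v_P a, v_P b` there is `n` with `n · v_P a ≥ v_P b`. -/
def RankOne (O : ValuationSubring F) : Prop :=
  ∀ a b : F, a ≠ 0 → InMax O a → b ≠ 0 → InMax O b → ∃ n : ℕ, a ^ n / b ∈ O

/-- The value group of `O` has (rank) at least `r`: there is a chain of `r` positive
values, each infinitely larger than the previous one. -/
def RankAtLeast (O : ValuationSubring F) (r : ℕ) : Prop :=
  ∃ a : Fin r → F, (∀ i, a i ≠ 0 ∧ InMax O (a i)) ∧
    ∀ i j : Fin r, i < j → ∀ n : ℕ, a i ^ n / a j ∉ O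

/-- The value group of `O` has rank exactly `r`. -/
def RankEq (O : ValuationSubring F) (r : ℕ) : Prop :=
  RankAtLeast O r ∧ ¬ RankAtLeast O (r + 1)

/-- The valuation is discrete: its value group is order isomorphic to `ℤ`,
i.e. there is a uniformizer `π` with every value an integer multiple of `v_P π`. -/
def IsDiscrete (O : ValuationSubring F) : Prop :=
  ∃ π : F, π ≠ 0 ∧ InMax O π ∧ ∀ x : F, x ≠ 0 → ∃ n : ℤ, IsVUnit O (x / π ^ n)

/-- `F|K` is an algebraic function field: a finitely generated field extension of
transcendence degree at least 1. -/
def IsFunctionField (K : Subfield F) : Prop :=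
  (∃ S : Finset F, IntermediateField.adjoin ↥K (S : Set F) = ⊤) ∧
  ∃ x : F, Transcendental ↥K x

/-- The data of a weak uniformization of `(𝓛|𝓚, P)` (both subfields of an ambient
valued field `F`, `𝓚 ⊆ 𝓛`) with uniformizing transcendence basis `t` and generators
`η`: there are polynomials `f i` in `n` variables `X₁, …, Xₙ` with coefficients in
`𝓞_𝓚[t₁,…,tₛ]` such that (U1) `X j` does not occur in `f i` for `i < j`,
(U2) `f i (η) = 0`, and (U3) the residue of `det J_f (η)` is nonzero; moreover `t`
is a transcendence basis of `𝓛|𝓚` inside `𝓞_𝓛` and `𝓛 = 𝓚(t, η)`. -/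
def UnifData (𝓛 𝓚 : Subfield F) (O : ValuationSubring F) {s n : ℕ}
    (t : Fin s → F) (η : Fin n → F) : Prop :=
  (∀ i, t i ∈ 𝓛 ∧ t i ∈ O) ∧ (∀ i, η i ∈ 𝓛 ∧ η i ∈ O) ∧
  AlgebraicIndependent ↥𝓚 t ∧
  (∀ z ∈ 𝓛, IsAlgebraic ↥(IntermediateField.adjoin ↥𝓚 (Set.range t)) z) ∧
  Subfield.closure ((𝓚 : Set F) ∪ Set.range t ∪ Set.range η) = 𝓛 ∧
  ∃ f : Fin n → MvPolynomial (Fin n) F,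
    (∀ i m, (f i).coeff m ∈
      Subring.closure ((↑(𝓚.toSubring ⊓ O.toSubring) : Set F) ∪ Set.range t)) ∧
    (∀ i j : Fin n, (i : ℕ) < (j : ℕ) → MvPolynomial.degreeOf j (f i) = 0) ∧
    (∀ i, MvPolynomial.eval η (f i) = 0) ∧
    IsVUnit O (Matrix.det (Matrix.of fun i j : Fin n =>
      MvPolynomial.eval η (MvPolynomial.pderiv j (f i))))

/-- `(𝓛|𝓚, P)` is uniformizable with respect to `ζ₁, …, ζ_m`:
there is a weak uniformization whose generators `η` include all the `ζ k`. -/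
def UnifWrt (𝓛 𝓚 : Subfield F) (O : ValuationSubring F) {m : ℕ} (ζ : Fin m → F) : Prop :=
  ∃ (s n : ℕ) (t : Fin s → F) (η : Fin n → F),
    UnifData 𝓛 𝓚 O t η ∧ ∃ σ : Fin m → Fin n, ∀ k, η (σ k) = ζ k

/-- `(𝓛|𝓚, P)` is uniformizable: uniformizable with respect to every finite
list of elements of `𝓞_𝓛`. -/
def UnifIn (𝓛 𝓚 : Subfield F) (O : ValuationSubring F) : Prop :=
  ∀ (m : ℕ) (ζ : Fin m → F), (∀ k, ζ k ∈ 𝓛 ∧ ζ k ∈ O) → UnifWrt 𝓛 𝓚 O ζ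

section Defectless

variable {K L : Type*} [Field K] [Field L]

/-- The values of the `a i` lie in pairwise distinct cosets modulo the value group of
the ground field along `φ`; thus there are at least `e` distinct cosets. -/
def ValClassIndep (φ : K →+* L) (OL : ValuationSubring L) {e : ℕ} (a : Fin e → L) : Prop :=
  (∀ i, a i ≠ 0) ∧ ∀ i j : Fin e, i ≠ j →
    ¬ ∃ c : K, c ≠ 0 ∧ IsVUnit OL (a i / (a j * φ c))

/-- The ramification index `e = (v_P L : v_P K)` of `OL` over the ground field along `φ`. -/
def RamIdxEq (φ : K →+* L) (OL : ValuationSubring L) (e : ℕ) : Prop :=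
  (∃ a : Fin e → L, ValClassIndep φ OL a) ∧ ∀ a : Fin (e + 1) → L, ¬ ValClassIndep φ OL a

/-- The residues of the `b i` are linearly independent over the residue field of the
ground field along `φ`. -/
def ResLinIndep (φ : K →+* L) (OK : ValuationSubring K) (OL : ValuationSubring L)
    {f : ℕ} (b : Fin f → L) : Prop :=
  (∀ i, b i ∈ OL) ∧ ∀ c : Fin f → K, (∀ i, c i ∈ OK) → (∃ i, ¬ InMax OK (c i)) →
    ¬ InMax OL (∑ i, φ (c i) * b i)

/-- The inertia degree `f = [LP : KP]` of `OL` over `(K, OK)` along `φ`. -/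
def InertiaDegEq (φ : K →+* L) (OK : ValuationSubring K) (OL : ValuationSubring L)
    (f : ℕ) : Prop :=
  (∃ b : Fin f → L, ResLinIndep φ OK OL b) ∧ ∀ b : Fin (f + 1) → L, ¬ ResLinIndep φ OK OL b

end Defectless

/-- `(K, OK)` is a defectless (stable) valued field: for every finite extension `L|K`
(inside a fixed algebraic closure) the fundamental equality
`[L : K] = ∑ᵢ eᵢ fᵢ` holds, the sum running over all extensions of the valuation. -/
def IsDefectless (K : Type*) [Field K] (OK : ValuationSubring K) : Prop :=
  ∀ L : IntermediateField K (AlgebraicClosure K), FiniteDimensional K ↥L →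
    ∃ (g : ℕ) (Os : Fin g → ValuationSubring ↥L) (e f : Fin g → ℕ),
      Function.Injective Os ∧
      (∀ O' : ValuationSubring ↥L, O'.comap (algebraMap K ↥L) = OK ↔ ∃ i, O' = Os i) ∧
      (∀ i, RamIdxEq (algebraMap K ↥L) (Os i) (e i)) ∧
      (∀ i, InertiaDegEq (algebraMap K ↥L) OK (Os i) (f i)) ∧
      Module.finrank K ↥L = ∑ i, e i * f i

/-- The extension `𝓛|𝓚` of subfields of `F` is separable (in the general sense of
MacLane): every finitely generated subextension is separably generated, i.e. admits
a separating transcendence basis. -/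
def IsSeparableExt (𝓚 𝓛 : Subfield F) : Prop :=
  ∀ S : Finset F, ↑S ⊆ (𝓛 : Set F) →
    ∃ (d : ℕ) (u : Fin d → F), (∀ i, u i ∈ 𝓛) ∧ AlgebraicIndependent ↥𝓚 u ∧
      ∀ x ∈ Subfield.closure ((𝓚 : Set F) ∪ ↑S),
        IsSeparable ↥(IntermediateField.adjoin ↥𝓚 (Set.range u)) x

/-- The embedding of a subfield `K`, on which the valuation is trivial, into
the residue field of `O`. -/
noncomputable def resEmb (O : ValuationSubring F) (K : Subfield F) (h : ∀ x ∈ K, x ∈ O) :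
    ↥K →+* IsLocalRing.ResidueField ↥O :=
  (IsLocalRing.residue ↥O).comp
    { toFun := fun x => (⟨x.1, h x.1 x.2⟩ : ↥O)
      map_one' := rfl
      map_mul' := fun _ _ => rfl
      map_zero' := rfl
      map_add' := fun _ _ => rfl }

end LocalUnif

namespace LU

def mon {E : Type*} [Field E] {ρ : ℕ} (x : Fin ρ → E) (e : Fin ρ → ℤ) : E := ∏ i, x i ^ e i

section mon
variable {E : Type*} [Field E] {ρ : ℕ} {x : Fin ρ → E}

theorem mon_zero : mon x 0 = 1 := by simp [mon]

theorem mon_ne (hx : ∀ i, x i ≠ 0) (e : Fin ρ → ℤ) : mon x e ≠ 0 :=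
  Finset.prod_ne_zero_iff.2 fun i _ => zpow_ne_zero _ (hx i)

theorem mon_add (hx : ∀ i, x i ≠ 0) (e u : Fin ρ → ℤ) : mon x (e + u) = mon x e * mon x u := by
  simp only [mon, Pi.add_apply, ← Finset.prod_mul_distrib]
  exact Finset.prod_congr rfl fun i _ => zpow_add₀ (hx i) _ _

theorem mon_neg (e : Fin ρ → ℤ) : mon x (-e) = (mon x e)⁻¹ := by
  simp [mon]

theorem mon_sub (hx : ∀ i, x i ≠ 0) (e u : Fin ρ → ℤ) : mon x (e - u) = mon x e / mon x u := by
  rw [sub_eq_add_neg, mon_add hx, mon_neg, div_eq_mul_inv]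

theorem mon_nsmul (n : ℕ) (e : Fin ρ → ℤ) : mon x (n • e) = mon x e ^ n := by
  simp only [mon, Pi.smul_apply, ← Finset.prod_pow]
  refine Finset.prod_congr rfl fun i _ => ?_
  rw [nsmul_eq_mul, mul_comm, zpow_mul, zpow_natCast]

theorem mon_zsmul (n : ℤ) (e : Fin ρ → ℤ) : mon x (n • e) = mon x e ^ n := by
  simp only [mon, Pi.smul_apply, ← Finset.prod_zpow]
  refine Finset.prod_congr rfl fun i _ => ?_
  rw [smul_eq_mul, mul_comm, zpow_mul]

theorem mon_single (i : Fin ρ) : mon x (Pi.single i 1) = x i := by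
  classical
  rw [mon, Finset.prod_eq_single i]
  · simp
  · intro j _ hj; simp [hj]
  · simp

theorem map_mon {F : Type*} [Field F] (f : E →+* F) (e : Fin ρ → ℤ) :
    f (mon x e) = mon (fun i => f (x i)) e := by
  simp [mon, map_prod, map_zpow₀]

end mon

variable {Γ₀ : Type*} [LinearOrderedCommGroupWithZero Γ₀]

structure Frame (L : Type*) {E : Type*} [Field L] [Field E] [Algebra L E] (v : Valuation E Γ₀)
    {ρ : ℕ} (x : Fin ρ → E) : Prop where
  x_ne : ∀ i, x i ≠ 0
  triv : ∀ c : L, c ≠ 0 → v (algebraMap L E c) = 1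
  ind : ∀ e, v (mon x e) = 1 → e = 0
  gen : ∀ a : E, a ∈ IntermediateField.adjoin L (Set.range x)

section LT
variable {L E : Type*} [Field L] [Field E] [Algebra L E] {v : Valuation E Γ₀}
  {ρ : ℕ} {x : Fin ρ → E}

theorem Frame.inj (h : Frame L v x) {e u : Fin ρ → ℤ} (heu : v (mon x e) = v (mon x u)) :
    e = u := by
  have := h.ind (e - u) (by
    rw [mon_sub h.x_ne, map_div₀, heu, div_self]
    exact (v.ne_zero_iff).2 (mon_ne h.x_ne u))
  exact sub_eq_zero.1 this

theorem Frame.v_mon_ne (h : Frame L v x) (e : Fin ρ → ℤ) : v (mon x e) ≠ 0 :=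
  (v.ne_zero_iff).2 (mon_ne h.x_ne e)

def HasLT (L : Type*) {E : Type*} [Field L] [Field E] [Algebra L E] (v : Valuation E Γ₀)
    {ρ : ℕ} (x : Fin ρ → E) (a : E) : Prop :=
  a ≠ 0 → ∃ (e : Fin ρ → ℤ) (c : L), c ≠ 0 ∧ v (a - algebraMap L E c * mon x e) < v a ∧
    v a = v (mon x e)

theorem Frame.lt_val (h : Frame L v x) {c : L} (hc : c ≠ 0) (e) :
    v (algebraMap L E c * mon x e) = v (mon x e) := by
  rw [map_mul, h.triv c hc, one_mul]

theorem Frame.lead_sum (h : Frame L v x) (s : Finset (Fin ρ → ℤ)) (c : (Fin ρ → ℤ) → L)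
    (hex : ∃ e ∈ s, c e ≠ 0) :
    ∃ e ∈ s, c e ≠ 0 ∧ v ((∑ e ∈ s, algebraMap L E (c e) * mon x e) -
      algebraMap L E (c e) * mon x e) < v (∑ e ∈ s, algebraMap L E (c e) * mon x e) ∧
      v (∑ e ∈ s, algebraMap L E (c e) * mon x e) = v (mon x e) := by
  classical
  set s' := s.filter fun e => c e ≠ 0 with hs'
  have hsum : ∑ e ∈ s, algebraMap L E (c e) * mon x e
      = ∑ e ∈ s', algebraMap L E (c e) * mon x e := by
    rw [hs', Finset.sum_filter]
    refine Finset.sum_congr rfl fun e _ => ?_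
    by_cases hc : c e = 0 <;> simp [hc]
  rw [hsum]
  have hne : s'.Nonempty := by
    obtain ⟨e, he, hc⟩ := hex
    exact ⟨e, Finset.mem_filter.2 ⟨he, hc⟩⟩
  obtain ⟨e, he, hmax⟩ := s'.exists_max_image (fun e => v (mon x e)) hne
  have hce : c e ≠ 0 := (Finset.mem_filter.1 he).2
  have h1 : ∑ u ∈ s', algebraMap L E (c u) * mon x u - algebraMap L E (c e) * mon x e
      = ∑ u ∈ s'.erase e, algebraMap L E (c u) * mon x u := by
    rw [← Finset.add_sum_erase _ _ he]; ring
  have h2 : v (∑ u ∈ s'.erase e, algebraMap L E (c u) * mon x u) < v (mon x e) := by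
    apply v.map_sum_lt (h.v_mon_ne e)
    intro u hu
    have hu' := Finset.mem_erase.1 hu
    rw [h.lt_val (Finset.mem_filter.1 hu'.2).2]
    exact lt_of_le_of_ne (hmax u hu'.2) fun hh => hu'.1 (h.inj hh)
  have h3 : v (∑ u ∈ s', algebraMap L E (c u) * mon x u) = v (mon x e) := by
    rw [← Finset.add_sum_erase _ _ he, v.map_add_eq_of_lt_left, h.lt_val hce]
    rwa [h.lt_val hce]
  exact ⟨e, (Finset.mem_filter.1 he).1, hce, by rw [h1, h3]; exact h2, h3⟩

theorem Frame.hasLT_sum (h : Frame L v x) (s : Finset (Fin ρ → ℤ)) (c : (Fin ρ → ℤ) → L) :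
    HasLT L v x (∑ e ∈ s, algebraMap L E (c e) * mon x e) := by
  intro ha
  obtain ⟨e, -, hc, h1, h2⟩ := h.lead_sum s c (by
    by_contra hn
    push Not at hn
    exact ha (Finset.sum_eq_zero fun e he => by simp [hn e he]))
  exact ⟨e, c e, hc, h1, h2⟩

theorem Frame.linInd (h : Frame L v x) : LinearIndependent L (mon x) := by
  rw [linearIndependent_iff']
  intro s c hs e he
  by_contra hc
  obtain ⟨u, -, -, -, h2⟩ := h.lead_sum s c ⟨e, he, hc⟩
  simp only [Algebra.smul_def] at hs
  rw [hs, map_zero] at h2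
  exact h.v_mon_ne u h2.symm

theorem Frame.hasLT_span (h : Frame L v x) {a : E}
    (ha : a ∈ Submodule.span L (Set.range (mon x))) : HasLT L v x a := by
  obtain ⟨c, rfl⟩ := Finsupp.mem_span_range_iff_exists_finsupp.1 ha
  have := h.hasLT_sum c.support c
  simpa [Finsupp.sum, Algebra.smul_def] using this

theorem span_mon_mul (hx : ∀ i, x i ≠ 0) :
    (Submodule.span L (Set.range (mon x))) * (Submodule.span L (Set.range (mon x))) ≤
      Submodule.span L (Set.range (mon x)) := by
  rw [Submodule.span_mul_span]
  refine Submodule.span_mono ?_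
  rintro _ ⟨_, ⟨e, rfl⟩, _, ⟨u, rfl⟩, rfl⟩
  exact ⟨e + u, mon_add hx e u⟩

theorem adjoin_le_span (hx : ∀ i, x i ≠ 0) {a : E} (ha : a ∈ Algebra.adjoin L (Set.range x)) :
    a ∈ Submodule.span L (Set.range (mon x)) := by
  induction ha using Algebra.adjoin_induction with
  | mem y hy =>
    obtain ⟨i, rfl⟩ := hy
    exact Submodule.subset_span ⟨Pi.single i 1, mon_single i⟩
  | algebraMap c =>
    rw [Algebra.algebraMap_eq_smul_one]
    exact Submodule.smul_mem _ _ (Submodule.subset_span ⟨0, mon_zero⟩)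
  | add y z _ _ hy hz => exact Submodule.add_mem _ hy hz
  | mul y z _ _ hy hz => exact span_mon_mul hx (Submodule.mul_mem_mul hy hz)

theorem Frame.hasLT (h : Frame L v x) (a : E) : HasLT L v x a := by
  intro ha
  obtain ⟨r, hr, s, hs, rfl⟩ := IntermediateField.mem_adjoin_iff_div.1 (h.gen a)
  have hr0 : r ≠ 0 := fun h => ha (by simp [h])
  have hs0 : s ≠ 0 := fun h => ha (by simp [h])
  obtain ⟨e, c, hc, h1, h2⟩ := h.hasLT_span (adjoin_le_span h.x_ne hr) hr0
  obtain ⟨u, d, hd, h3, h4⟩ := h.hasLT_span (adjoin_le_span h.x_ne hs) hs0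
  have hd' : algebraMap L E d ≠ 0 := by simpa using hd
  have hmu := mon_ne h.x_ne u
  refine ⟨e - u, c / d, div_ne_zero hc hd, ?_, ?_⟩
  · have key : r / s - algebraMap L E (c / d) * mon x (e - u)
        = ((r - algebraMap L E c * mon x e) * (algebraMap L E d * mon x u)
          - (s - algebraMap L E d * mon x u) * (algebraMap L E c * mon x e)) /
          (s * (algebraMap L E d * mon x u)) := by
      rw [mon_sub h.x_ne, map_div₀]
      field_simp
      ring
    have hvs : 0 < v s := zero_lt_iff.2 ((v.ne_zero_iff).2 hs0)
    have hvr : 0 < v r := zero_lt_iff.2 ((v.ne_zero_iff).2 hr0)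
    rw [key, map_div₀, map_div₀, map_mul, h.lt_val hd, ← h4,
      div_lt_div_iff₀ (mul_pos hvs hvs) hvs]
    have : v ((r - algebraMap L E c * mon x e) * (algebraMap L E d * mon x u)
          - (s - algebraMap L E d * mon x u) * (algebraMap L E c * mon x e)) < v r * v s := by
      refine lt_of_le_of_lt (v.map_sub _ _) (max_lt ?_ ?_)
      · rw [map_mul, h.lt_val hd, ← h4]
        exact mul_lt_mul_of_pos_right h1 hvs
      · rw [map_mul, h.lt_val hc, ← h2, mul_comm (v r)]
        exact mul_lt_mul_of_pos_right h3 hvr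
    rw [← mul_assoc (v r)]
    exact mul_lt_mul_of_pos_right this hvs
  · rw [map_div₀, mon_sub h.x_ne, map_div₀, h2, h4]

end LT

end LU

namespace LU

section charpoly

variable {E F : Type*} [Field E] [Field F] [Algebra E F] [FiniteDimensional E F]

theorem charmatrix_blockDiagonal {R m o : Type*} [CommRing R] [Fintype m] [DecidableEq m]
    [Fintype o] [DecidableEq o] (M : o → Matrix m m R) :
    (Matrix.blockDiagonal M).charmatrix = Matrix.blockDiagonal fun k => (M k).charmatrix := by
  ext ⟨i, k⟩ ⟨j, l⟩ 
  by_cases hkl : k = l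
  · subst hkl
    by_cases hij : i = j
    · subst hij
      simp [Matrix.charmatrix_apply_eq, Matrix.blockDiagonal_apply]
    · rw [Matrix.charmatrix_apply_ne _ _ _ (by simpa using hij)]
      simp [Matrix.blockDiagonal_apply, Matrix.charmatrix_apply_ne _ _ _ hij]
  · rw [Matrix.charmatrix_apply_ne _ _ _ (by simp [hkl])]
    simp [Matrix.blockDiagonal_apply, hkl]

theorem charpoly_eq_pow (z : F) :
    (Algebra.lmul E F z).charpoly = minpoly E z ^ Module.finrank (IntermediateField.adjoin E {z}) F := by
  classical
  have hz : IsIntegral E z := Algebra.IsIntegral.isIntegral z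
  let pb := IntermediateField.adjoin.powerBasis hz
  let c := Module.finBasis (IntermediateField.adjoin E {z}) F
  let b := pb.basis.smulTower c
  have h1 : (Algebra.lmul E F z).charpoly = (Algebra.leftMulMatrix b z).charpoly := by
    rw [Algebra.leftMulMatrix_apply, LinearMap.charpoly_toMatrix]
  have h2 : z = algebraMap (IntermediateField.adjoin E {z}) F pb.gen := by
    simp [pb]
  have h3 : Algebra.leftMulMatrix b z = Matrix.blockDiagonal fun _ => Algebra.leftMulMatrix pb.basis pb.gen := by
    exact (congrArg (Algebra.leftMulMatrix b) h2).trans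
      (Algebra.smulTower_leftMulMatrix_algebraMap pb.basis c pb.gen)
  rw [h1, h3, Matrix.charpoly, charmatrix_blockDiagonal, Matrix.det_blockDiagonal]
  have h4 : (Algebra.leftMulMatrix pb.basis pb.gen).charmatrix.det = minpoly E z := by
    rw [← Matrix.charpoly, charpoly_leftMulMatrix]
    simp only [pb, IntermediateField.adjoin.powerBasis_gen]
    exact IntermediateField.minpoly_gen E z
  simp [h4]

end charpoly

variable {Γ₀ : Type*} [LinearOrderedCommGroupWithZero Γ₀]

section roots

theorem coeff_prod_le {Ω : Type*} [Field Ω] (v : Valuation Ω Γ₀) (γ : Γ₀) (m : Multiset Ω)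
    (hm : ∀ r ∈ m, v r ≤ γ) (i : ℕ) (hi : i ≤ m.card) :
    v ((m.map fun r => Polynomial.X - Polynomial.C r).prod.coeff i) ≤ γ ^ (m.card - i) := by
  induction m using Multiset.induction_on generalizing i with
  | empty =>
    simp only [Multiset.card_zero, nonpos_iff_eq_zero] at hi
    subst hi
    simp
  | cons a s ih =>
    rw [Multiset.map_cons, Multiset.prod_cons, sub_mul, Polynomial.coeff_sub,
      Polynomial.coeff_C_mul]
    have hdeg : (s.map fun r => Polynomial.X - Polynomial.C r).prod.natDegree = s.card :=
      Polynomial.natDegree_multiset_prod_X_sub_C_eq_card s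
    rw [Multiset.card_cons] at hi ⊢
    have hs : ∀ r ∈ s, v r ≤ γ := fun r hr => hm r (Multiset.mem_cons_of_mem hr)
    have ha : v a ≤ γ := hm a (Multiset.mem_cons_self a s)
    refine (v.map_sub _ _).trans (max_le ?_ ?_)
    · cases i with
      | zero => simp
      | succ j =>
        rw [Polynomial.coeff_X_mul]
        refine (ih hs j (by omega)).trans (le_of_eq ?_)
        congr 1; omega
    · rw [map_mul]
      rcases Nat.lt_or_ge s.card i with h | h
      · rw [Polynomial.coeff_eq_zero_of_natDegree_lt (by omega)]; simp
      · rw [show s.card + 1 - i = (s.card - i) + 1 by omega, pow_succ, mul_comm]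
        exact mul_le_mul' (ih hs i h) ha

theorem exists_coeff_eq {E Ω : Type*} [Field E] [Field Ω] [IsAlgClosed Ω] [Algebra E Ω]
    (v : Valuation Ω Γ₀) (p : Polynomial E) (hp : p.Monic) (γ : Γ₀) (hγ : γ ≠ 0)
    (hle : ∀ r : Ω, Polynomial.aeval r p = 0 → v r ≤ γ)
    (r : Ω) (hr : Polynomial.aeval r p = 0) (hrγ : v r = γ) :
    ∃ j, 1 ≤ j ∧ j ≤ p.natDegree ∧ v (algebraMap E Ω (p.coeff (p.natDegree - j))) = γ ^ j := by
  by_contra hcon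
  push Not at hcon
  have hlt : ∀ i < p.natDegree, v (algebraMap E Ω (p.coeff i)) < γ ^ (p.natDegree - i) := by
    intro i hi
    have h1 := hcon (p.natDegree - i) (by omega) (by omega)
    rw [show p.natDegree - (p.natDegree - i) = i by omega] at h1
    refine lt_of_le_of_ne ?_ h1
    have hs := (IsAlgClosed.splits (p.map (algebraMap E Ω))).eq_prod_roots_of_monic (hp.map _)
    have hcard : (p.map (algebraMap E Ω)).roots.card = p.natDegree := by
      rw [← (IsAlgClosed.splits (p.map (algebraMap E Ω))).natDegree_eq_card_roots,
        Polynomial.natDegree_map]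
    rw [← Polynomial.coeff_map, ← hcard, hs]
    have := coeff_prod_le v γ (p.map (algebraMap E Ω)).roots (fun r hr => hle r (by
      rw [Polynomial.mem_roots (hp.map _).ne_zero] at hr
      rwa [Polynomial.aeval_def, ← Polynomial.eval_map])) i (by omega)
    rwa [← hs] at this ⊢
  have h0 : v (∑ i ∈ Finset.range p.natDegree, algebraMap E Ω (p.coeff i) * r ^ i)
      < γ ^ p.natDegree := by
    apply v.map_sum_lt (pow_ne_zero _ hγ)
    intro i hi
    rw [Finset.mem_range] at hi
    rw [map_mul, map_pow, hrγ, ← Nat.sub_add_cancel hi.le, pow_add]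
    exact mul_lt_mul_of_pos_right (hlt i hi) (zero_lt_iff.2 (pow_ne_zero _ hγ))
  have h1 : r ^ p.natDegree = -∑ i ∈ Finset.range p.natDegree, algebraMap E Ω (p.coeff i) * r ^ i := by
    rw [Polynomial.aeval_eq_sum_range, Finset.sum_range_succ, hp.coeff_natDegree, one_smul] at hr
    simp only [Algebra.smul_def] at hr
    rw [eq_neg_iff_add_eq_zero, add_comm]; exact hr
  have h2 : v (r ^ p.natDegree) = γ ^ p.natDegree := by rw [map_pow, hrγ]
  rw [h1, Valuation.map_neg] at h2
  exact absurd h2 h0.ne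

end roots

section norm

variable {E F Ω : Type*} [Field E] [Field F] [Field Ω] [Algebra E F] [Algebra E Ω] [Algebra F Ω]
  [IsScalarTower E F Ω] [FiniteDimensional E F]

instance homNonempty : Nonempty (F →ₐ[E] Ω) := ⟨IsScalarTower.toAlgHom E F Ω⟩

noncomputable def nrm (E : Type*) {F Ω : Type*} [Field E] [Field F] [Field Ω] [Algebra E F]
    [Algebra E Ω] [Algebra F Ω]
    [IsScalarTower E F Ω] [FiniteDimensional E F] (v : Valuation Ω Γ₀) (z : F) : Γ₀ :=
  (Finset.univ : Finset (F →ₐ[E] Ω)).sup' Finset.univ_nonempty fun σ => v (σ z)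

variable (v : Valuation Ω Γ₀)

theorem le_nrm (σ : F →ₐ[E] Ω) (z : F) : v (σ z) ≤ nrm E v z :=
  Finset.le_sup' (fun σ : F →ₐ[E] Ω => v (σ z)) (Finset.mem_univ σ)

theorem v_le_nrm (z : F) : v (algebraMap F Ω z) ≤ nrm E v z :=
  le_nrm v (IsScalarTower.toAlgHom E F Ω) z

theorem exists_nrm (z : F) : ∃ σ : F →ₐ[E] Ω, nrm E v z = v (σ z) := by
  obtain ⟨σ, _, h⟩ := Finset.exists_mem_eq_sup' (Finset.univ_nonempty (α := F →ₐ[E] Ω))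
    fun σ => v (σ z)
  exact ⟨σ, h⟩

theorem nrm_le {z : F} {γ : Γ₀} (h : ∀ σ : F →ₐ[E] Ω, v (σ z) ≤ γ) : nrm E v z ≤ γ := by
  obtain ⟨σ, hσ⟩ := exists_nrm (E := E) v z
  rw [hσ]; exact h σ

theorem nrm_lt {z : F} {γ : Γ₀} (h : ∀ σ : F →ₐ[E] Ω, v (σ z) < γ) : nrm E v z < γ := by
  obtain ⟨σ, hσ⟩ := exists_nrm (E := E) v z
  rw [hσ]; exact h σ

theorem nrm_add (z w : F) : nrm E v (z + w) ≤ max (nrm E v z) (nrm E v w) :=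
  nrm_le v fun σ => by
    rw [map_add]
    exact (v.map_add _ _).trans (max_le_max (le_nrm v σ z) (le_nrm v σ w))

theorem nrm_mul (z w : F) : nrm E v (z * w) ≤ nrm E v z * nrm E v w :=
  nrm_le v fun σ => by
    rw [map_mul, map_mul]
    exact mul_le_mul' (le_nrm v σ z) (le_nrm v σ w)

theorem nrm_smul (a : E) (z : F) : nrm E v (a • z) = v (algebraMap E Ω a) * nrm E v z := by
  apply le_antisymm
  · refine nrm_le v fun σ => ?_
    rw [map_smul, Algebra.smul_def, map_mul]
    exact mul_le_mul' le_rfl (le_nrm v σ z)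
  · obtain ⟨σ, hσ⟩ := exists_nrm (E := E) v z
    rw [hσ, ← map_mul, ← Algebra.smul_def, ← map_smul]
    exact le_nrm v σ _

theorem nrm_neg (z : F) : nrm E v (-z) = nrm E v z := by
  have := nrm_smul (E := E) v (-1) z
  simpa [Valuation.map_neg] using this

theorem nrm_sub (z w : F) : nrm E v (z - w) ≤ max (nrm E v z) (nrm E v w) := by
  rw [sub_eq_add_neg, ← nrm_neg v w]; exact nrm_add v _ _

@[simp] theorem nrm_zero : nrm E v (0 : F) = 0 := by
  have := nrm_smul (E := E) v 0 (0 : F)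
  simpa using this

theorem nrm_eq_zero {z : F} : nrm E v z = 0 ↔ z = 0 := by
  constructor
  · intro h
    have := v_le_nrm (E := E) v z
    rw [h, le_zero_iff, v.zero_iff] at this
    simpa using this
  · rintro rfl; simp

theorem nrm_pos {z : F} (hz : z ≠ 0) : 0 < nrm E v z :=
  zero_lt_iff.2 fun h => hz ((nrm_eq_zero v).1 h)

theorem nrm_sum_le {ι : Type*} (s : Finset ι) (f : ι → F) (γ : Γ₀) (h : ∀ i ∈ s, nrm E v (f i) ≤ γ) :
    nrm E v (∑ i ∈ s, f i) ≤ γ := by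
  classical
  induction s using Finset.induction_on with
  | empty => simp
  | insert a s ha ih =>
    rw [Finset.sum_insert ha]
    exact (nrm_add v _ _).trans (max_le (h a (Finset.mem_insert_self _ _))
      (ih fun i hi => h i (Finset.mem_insert_of_mem hi)))

theorem nrm_sum_lt {ι : Type*} (s : Finset ι) (f : ι → F) (γ : Γ₀) (hγ : 0 < γ)
    (h : ∀ i ∈ s, nrm E v (f i) < γ) :
    nrm E v (∑ i ∈ s, f i) < γ := by
  classical
  induction s using Finset.induction_on with
  | empty => simpa
  | insert a s ha ih =>
    rw [Finset.sum_insert ha]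
    exact (nrm_add v _ _).trans_lt (max_lt (h a (Finset.mem_insert_self _ _))
      (ih fun i hi => h i (Finset.mem_insert_of_mem hi)))

theorem nrm_add_eq_of_lt {z w : F} (h : nrm E v w < nrm E v z) : nrm E v (z + w) = nrm E v z := by
  apply le_antisymm
  · exact (nrm_add v _ _).trans (max_le le_rfl h.le)
  · by_contra hlt
    push Not at hlt
    have := nrm_sub (E := E) v (z + w) w
    rw [add_sub_cancel_right] at this
    exact absurd this (not_le.2 (max_lt hlt h))

theorem nrm_eq_of_sub_lt {z w : F} (h : nrm E v (z - w) < nrm E v z) : nrm E v w = nrm E v z := by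
  have : w = z + -(z - w) := by ring
  rw [this, nrm_add_eq_of_lt]
  rwa [nrm_neg]

theorem exists_coeff_nrm [IsAlgClosed Ω] {z : F} (hz : z ≠ 0) :
    ∃ j, 1 ≤ j ∧ j ≤ Module.finrank E F ∧
      v (algebraMap E Ω ((Algebra.lmul E F z).charpoly.coeff (Module.finrank E F - j)))
        = nrm E v z ^ j := by
  have hd : (Algebra.lmul E F z).charpoly.natDegree = Module.finrank E F :=
    LinearMap.charpoly_natDegree _
  have hroot : ∀ r : Ω, Polynomial.aeval r (Algebra.lmul E F z).charpoly = 0 ↔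
      Polynomial.aeval r (minpoly E z) = 0 := by
    intro r
    rw [charpoly_eq_pow, map_pow, pow_eq_zero_iff]
    exact Module.finrank_pos.ne'
  have hrange := Algebra.IsAlgebraic.range_eval_eq_rootSet_minpoly (F := E) (K := F) Ω z
  have hint : IsIntegral E z := Algebra.IsIntegral.isIntegral z
  have hmem : ∀ r : Ω, Polynomial.aeval r (minpoly E z) = 0 ↔ ∃ σ : F →ₐ[E] Ω, σ z = r := by
    intro r
    have : r ∈ (minpoly E z).rootSet Ω ↔ r ∈ Set.range fun ψ : F →ₐ[E] Ω => ψ z := by rw [hrange]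
    rw [Polynomial.mem_rootSet_of_ne (minpoly.ne_zero hint)] at this
    exact this
  obtain ⟨σ, hσ⟩ := exists_nrm (E := E) v z
  have := exists_coeff_eq v (Algebra.lmul E F z).charpoly (LinearMap.charpoly_monic _) (nrm E v z)
    (nrm_pos v hz).ne' (fun r hr => by
      obtain ⟨τ, rfl⟩ := (hmem r).1 ((hroot r).1 hr)
      exact le_nrm v τ z) (σ z) ((hroot _).2 ((hmem _).2 ⟨σ, rfl⟩)) hσ.symm
  rwa [hd] at this

end norm

end LU

namespace LU

variable {Γ₀ : Type*} [LinearOrderedCommGroupWithZero Γ₀]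

section box
variable {L E : Type*} [Field L] [Field E] [Algebra L E] {v : Valuation E Γ₀}
  {ρ : ℕ} {x : Fin ρ → E}

def bx (L : Type*) {E : Type*} [Field L] [Field E] [Algebra L E] {ρ : ℕ} (x : Fin ρ → E) (m : ℕ) :
    Submodule L E := Submodule.span L (mon x '' {e | ∀ k, 0 ≤ e k ∧ e k ≤ m})

theorem bx_mono {m m' : ℕ} (h : m ≤ m') : bx L x m ≤ bx L x m' := by
  refine Submodule.span_mono (Set.image_mono fun e he k => ⟨(he k).1, (he k).2.trans ?_⟩)
  exact_mod_cast h

theorem bx_mul (hx : ∀ i, x i ≠ 0) {m m' : ℕ} {a b : E} (ha : a ∈ bx L x m) (hb : b ∈ bx L x m') :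
    a * b ∈ bx L x (m + m') := by
  have : bx L x m * bx L x m' ≤ bx L x (m + m') := by
    rw [bx, bx, Submodule.span_mul_span]
    refine Submodule.span_mono ?_
    rintro _ ⟨_, ⟨e, he, rfl⟩, _, ⟨u, hu, rfl⟩, rfl⟩
    refine ⟨e + u, fun k => ?_, mon_add hx e u⟩
    have := he k; have := hu k
    simp only [Pi.add_apply]; push_cast
    constructor <;> linarith
  exact this (Submodule.mul_mem_mul ha hb)

theorem bx_one {m : ℕ} : (1 : E) ∈ bx L x m :=
  Submodule.subset_span ⟨0, fun k => by simp, mon_zero⟩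

theorem mem_bx_of_adjoin (hx : ∀ i, x i ≠ 0) {a : E} (ha : a ∈ Algebra.adjoin L (Set.range x)) :
    ∃ m, a ∈ bx L x m := by
  classical
  induction ha using Algebra.adjoin_induction with
  | mem y hy =>
    obtain ⟨i, rfl⟩ := hy
    refine ⟨1, Submodule.subset_span ⟨Pi.single i 1, fun k => ?_, mon_single i⟩⟩
    by_cases hk : k = i
    · subst hk; simp
    · simp [hk]
  | algebraMap c =>
    rw [Algebra.algebraMap_eq_smul_one]
    exact ⟨0, Submodule.smul_mem _ _ bx_one⟩
  | add y z _ _ hy hz =>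
    obtain ⟨m, hm⟩ := hy; obtain ⟨m', hm'⟩ := hz
    exact ⟨max m m', Submodule.add_mem _ (bx_mono (le_max_left _ _) hm)
      (bx_mono (le_max_right _ _) hm')⟩
  | mul y z _ _ hy hz =>
    obtain ⟨m, hm⟩ := hy; obtain ⟨m', hm'⟩ := hz
    exact ⟨m + m', bx_mul hx hm hm'⟩

theorem Frame.val_bx (h : Frame L v x) {m : ℕ} {a : E} (ha : a ∈ bx L x m) (ha0 : a ≠ 0) :
    ∃ e : Fin ρ → ℤ, (∀ k, 0 ≤ e k ∧ e k ≤ m) ∧ v a = v (mon x e) := by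
  obtain ⟨c, hc, rfl⟩ := (Finsupp.mem_span_image_iff_linearCombination L).1 ha
  have hsum : Finsupp.linearCombination L (mon x) c
      = ∑ e ∈ c.support, algebraMap L E (c e) * mon x e := by
    simp [Finsupp.linearCombination_apply, Finsupp.sum, Algebra.smul_def]
  rw [hsum] at ha0 ⊢
  obtain ⟨e, he, -, -, h2⟩ := h.lead_sum c.support c (by
    by_contra hn
    push Not at hn
    exact ha0 (Finset.sum_eq_zero fun e he => by simp [hn e he]))
  exact ⟨e, (Finsupp.mem_supported L c).1 hc he, h2⟩

theorem Frame.common_den (h : Frame L v x) {ι : Type*} [Fintype ι] (a : ι → E) :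
    ∃ (D : E) (m : ℕ), D ≠ 0 ∧ D ∈ bx L x m ∧ ∀ i, D * a i ∈ bx L x m := by
  classical
  have key : ∀ i, ∃ (r s : E) (m : ℕ), s ≠ 0 ∧ r ∈ bx L x m ∧ s ∈ bx L x m ∧ a i * s = r := by
    intro i
    obtain ⟨r, hr, s, hs, hrs⟩ := IntermediateField.mem_adjoin_iff_div.1 (h.gen (a i))
    by_cases hs0 : s = 0
    · refine ⟨0, 1, 0, one_ne_zero, Submodule.zero_mem _, bx_one, ?_⟩
      rw [hrs, hs0]; simp
    · obtain ⟨m, hm⟩ := mem_bx_of_adjoin h.x_ne hr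
      obtain ⟨m', hm'⟩ := mem_bx_of_adjoin h.x_ne hs
      exact ⟨r, s, max m m', hs0, bx_mono (le_max_left _ _) hm, bx_mono (le_max_right _ _) hm',
        by rw [hrs]; field_simp⟩
  choose r s m hs hr hsm hrs using key
  have hprod : ∀ t : Finset ι, ∏ i ∈ t, s i ∈ bx L x (∑ i ∈ t, m i) := by
    intro t
    induction t using Finset.induction_on with
    | empty => simpa using bx_one
    | insert i t hi ih =>
      rw [Finset.prod_insert hi, Finset.sum_insert hi]
      exact bx_mul h.x_ne (hsm i) ih
  refine ⟨∏ i, s i, ∑ i, m i, Finset.prod_ne_zero_iff.2 fun i _ => hs i, hprod _, fun i => ?_⟩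
  rw [← Finset.mul_prod_erase _ _ (Finset.mem_univ i), ← Finset.add_sum_erase _ _ (Finset.mem_univ i),
    mul_right_comm, mul_comm (s i), hrs]
  exact bx_mul h.x_ne (hr i) (hprod _)

theorem coeff_prod_bx (hx : ∀ i, x i ≠ 0) (m : ℕ) {ι : Type*} (s : Finset ι) (p : ι → Polynomial E)
    (hd : ∀ i ∈ s, (p i).natDegree ≤ 1)
    (h0 : ∀ i ∈ s, (p i).coeff 0 ∈ bx L x m) (h1 : ∀ i ∈ s, (p i).coeff 1 ∈ bx L x 0) :
    ∀ j, j ≤ s.card → (∏ i ∈ s, p i).coeff (s.card - j) ∈ bx L x (j * m) := by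
  classical
  induction s using Finset.induction_on with
  | empty =>
    intro j hj
    simp only [Finset.card_empty, nonpos_iff_eq_zero] at hj
    subst hj
    simpa using bx_one
  | insert a t ha ih =>
    intro j hj
    have ih := ih (fun i hi => hd i (Finset.mem_insert_of_mem hi))
      (fun i hi => h0 i (Finset.mem_insert_of_mem hi)) (fun i hi => h1 i (Finset.mem_insert_of_mem hi))
    have hdt : (∏ i ∈ t, p i).natDegree ≤ t.card := by
      refine (Polynomial.natDegree_prod_le _ _).trans ?_
      refine (Finset.sum_le_card_nsmul _ _ 1 fun i hi => hd i (Finset.mem_insert_of_mem hi)).trans ?_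
      simp
    rw [Finset.card_insert_of_notMem ha] at hj ⊢
    have hpa := Polynomial.eq_X_add_C_of_natDegree_le_one (hd a (Finset.mem_insert_self _ _))
    have ha0 := h0 a (Finset.mem_insert_self _ _)
    have ha1 := h1 a (Finset.mem_insert_self _ _)
    rw [Finset.prod_insert ha, hpa, add_mul, Polynomial.coeff_add, mul_assoc,
      Polynomial.coeff_C_mul, Polynomial.coeff_C_mul]
    refine Submodule.add_mem _ ?_ ?_
    · rcases Nat.lt_or_ge j (t.card + 1) with h | h
      · rw [show t.card + 1 - j = (t.card - j) + 1 by omega, Polynomial.coeff_X_mul]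
        have := bx_mul hx ha1 (ih j (by omega))
        simpa using this
      · rw [show t.card + 1 - j = 0 by omega, Polynomial.coeff_X_mul_zero, mul_zero]
        exact Submodule.zero_mem _
    · cases j with
      | zero =>
        rw [Polynomial.coeff_eq_zero_of_natDegree_lt (p := ∏ i ∈ t, p i) (by omega), mul_zero]
        exact Submodule.zero_mem _
      | succ i =>
        rw [show t.card + 1 - (i + 1) = t.card - i by omega,
          show (i + 1) * m = m + i * m by ring]
        exact bx_mul hx ha0 (ih i (by omega))

theorem charpoly_coeff_bx (hx : ∀ i, x i ≠ 0) {n : ℕ} (A : Matrix (Fin n) (Fin n) E) (m : ℕ)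
    (hA : ∀ i j, A i j ∈ bx L x m) (j : ℕ) (hj : j ≤ n) :
    A.charpoly.coeff (n - j) ∈ bx L x (j * m) := by
  rw [Matrix.charpoly, Matrix.det_apply, Polynomial.finsetSum_coeff]
  refine Submodule.sum_mem _ fun σ _ => ?_
  have key : (∏ i, A.charmatrix (σ i) i).coeff (n - j) ∈ bx L x (j * m) := by
    have := coeff_prod_bx (L := L) hx m (Finset.univ : Finset (Fin n))
      (fun i => A.charmatrix (σ i) i) ?_ ?_ ?_ j (by simpa using hj)
    · simpa using this
    all_goals
      intro i _
      by_cases hi : σ i = i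
      · rw [hi, Matrix.charmatrix_apply_eq]
        simp [hA, bx_one]
      · rw [Matrix.charmatrix_apply_ne _ _ _ hi]
        simp [hA, Polynomial.coeff_C]
  rcases Int.units_eq_one_or (Equiv.Perm.sign σ) with h | h
  · rw [h, one_smul]; exact key
  · rw [h, Units.neg_smul, one_smul, Polynomial.coeff_neg]
    exact Submodule.neg_mem _ key

end box

section dim

variable {L F : Type*} [Field L] [AddCommGroup F] [Module L F]

theorem finrank_le_of_approx (nm : F → Γ₀) (B : Γ₀ → Submodule L F)
    (hB : ∀ γ z, z ∈ B γ ↔ z = 0 ∨ nm z < γ)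
    (heq : ∀ z s, z ≠ 0 → (z - s = 0 ∨ nm (z - s) < nm z) → s ≠ 0 ∧ nm s = nm z) 
    (S : Finset Γ₀) : ∀ (V U : Submodule L F) [FiniteDimensional L V] [FiniteDimensional L U]
    (_ : ∀ z ∈ V, z ≠ 0 → nm z ∈ S)
    (_ : ∀ z ∈ V, z ≠ 0 → ∃ s ∈ U, z - s = 0 ∨ nm (z - s) < nm z),
    Module.finrank L V ≤ Module.finrank L U := by
  classical
  induction S using Finset.induction_on_max with
  | empty =>
    intro V U _ _ hS _
    have : V = ⊥ := by
      rw [eq_bot_iff]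
      intro z hz
      by_contra hz0
      simpa using hS z hz hz0
    subst this
    simp
  | insert γ S hγ ih =>
    intro V U _ _ hS happ
    have split : ∀ (W : Submodule L F) [FiniteDimensional L W],
        Module.finrank L W = Module.finrank L (W.map (B γ).mkQ) +
          Module.finrank L (W ⊓ B γ : Submodule L F) := by
      intro W _
      have h := LinearMap.finrank_range_add_finrank_ker ((B γ).mkQ.comp W.subtype)
      rw [LinearMap.range_comp, Submodule.range_subtype, LinearMap.ker_comp, Submodule.ker_mkQ] at h
      rw [← h]
      congr 1
      have e := (Submodule.equivSubtypeMap W ((B γ).comap W.subtype)).finrank_eq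
      rw [e, Submodule.map_comap_subtype]
    have h1 : Module.finrank L (V ⊓ B γ : Submodule L F) ≤ Module.finrank L (U ⊓ B γ : Submodule L F) := by
      apply ih
      · intro z hz hz0
        have := hS z hz.1 hz0
        rw [Finset.mem_insert] at this
        rcases this with h | h
        · rcases (hB _ _).1 hz.2 with h' | h'
          · exact absurd h' hz0
          · exact absurd h h'.ne
        · exact h
      · intro z hz hz0
        obtain ⟨s, hs, hs'⟩ := happ z hz.1 hz0
        refine ⟨s, ⟨hs, (hB _ _).2 ?_⟩, hs'⟩
        obtain ⟨_, h2⟩ := heq z s hz0 hs'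
        rcases (hB _ _).1 hz.2 with h' | h'
        · exact absurd h' hz0
        · right; rw [h2]; exact h'
    have h2 : V.map (B γ).mkQ ≤ U.map (B γ).mkQ := by
      rintro _ ⟨z, hz, rfl⟩
      by_cases hz0 : z = 0
      · subst hz0; simp
      obtain ⟨s, hs, hs'⟩ := happ z hz hz0
      refine ⟨s, hs, ?_⟩
      rw [Submodule.mkQ_apply, Submodule.mkQ_apply, eq_comm, Submodule.Quotient.eq, hB]
      rcases hs' with h | h
      · exact Or.inl h
      · refine Or.inr (h.trans_le ?_)
        have := hS z hz hz0
        rw [Finset.mem_insert] at this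
        rcases this with h' | h'
        · exact h'.le
        · exact (hγ _ h').le
    rw [split V, split U]
    have h3 := Submodule.finrank_mono h2
    omega

end dim

end LU

namespace LU

variable {Γ₀ : Type*} [LinearOrderedCommGroupWithZero Γ₀]

theorem growth {n s C ρ : ℕ} (h : ∀ N : ℕ, n * (N + 1) ^ ρ ≤ s * (N + C) ^ ρ) : n ≤ s := by
  have h1 : Filter.Tendsto (fun N : ℕ => ((N : ℝ) + C) / ((N : ℝ) + 1)) Filter.atTop (nhds 1) := by
    have := tendsto_add_mul_div_add_mul_atTop_nhds (𝕜 := ℝ) (C : ℝ) 1 1 (d := 1) one_ne_zero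
    simpa [add_comm] using this
  have h2 : Filter.Tendsto (fun N : ℕ => (s : ℝ) * (((N : ℝ) + C) / ((N : ℝ) + 1)) ^ ρ)
      Filter.atTop (nhds s) := by
    have := (h1.pow ρ).const_mul (s : ℝ)
    simpa using this
  have h3 : (n : ℝ) ≤ s := by
    refine ge_of_tendsto' h2 fun N => ?_
    have hN : (0 : ℝ) < ((N : ℝ) + 1) ^ ρ := by positivity
    rw [div_pow, ← mul_div_assoc, le_div_iff₀ hN]
    exact_mod_cast h N
  exact_mod_cast h3

section

variable {L E F Ω : Type*} [Field L] [Field E] [Field F] [Field Ω] [Algebra L E] [Algebra E F]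
  [Algebra L F] [IsScalarTower L E F] [Algebra E Ω] [Algebra F Ω]
  [IsScalarTower E F Ω] [FiniteDimensional E F] {v : Valuation Ω Γ₀} {ρ : ℕ} {x : Fin ρ → E}

theorem Frame.scaled_basis (h : Frame L (v.comap (algebraMap E Ω)) x) :
    ∃ (b : Module.Basis (Fin (Module.finrank E F)) E F) (c : ℕ),
      ∀ i j k, Algebra.leftMulMatrix b (b i) j k ∈ bx L x c := by
  classical
  let b0 := Module.finBasis E F
  obtain ⟨D, m, hD, -, hm⟩ := h.common_den
    (fun t : Fin (Module.finrank E F) × Fin (Module.finrank E F) × Fin (Module.finrank E F) =>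
      Algebra.leftMulMatrix b0 (b0 t.1) t.2.1 t.2.2)
  refine ⟨b0.unitsSMul fun _ => Units.mk0 D hD, m, fun i j k => ?_⟩
  have := hm (i, j, k)
  rw [Algebra.leftMulMatrix_eq_repr_mul] at this ⊢
  rw [Module.Basis.unitsSMul_apply, Module.Basis.unitsSMul_apply, Module.Basis.repr_unitsSMul]
  have e : (Units.mk0 D hD)⁻¹ • (b0.repr ((Units.mk0 D hD) • b0 i * (Units.mk0 D hD) • b0 k)) j
      = D * (b0.repr (b0 i * b0 k)) j := by
    simp only [Units.smul_def, smul_mul_smul_comm, map_smul, Finsupp.smul_apply,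
      Units.val_mk0, Units.val_inv_eq_inv_val, smul_eq_mul]
    field_simp
  rw [e]
  exact this

theorem Frame.nrm_bx [IsAlgClosed Ω] (h : Frame L (v.comap (algebraMap E Ω)) x)
    (b : Module.Basis (Fin (Module.finrank E F)) E F) (m : ℕ) {z : F} (hz : z ≠ 0)
    (hb : ∀ j k, Algebra.leftMulMatrix b z j k ∈ bx L x m) :
    ∃ u : Fin ρ → ℤ, (∀ k, 0 ≤ u k ∧ u k ≤ ((Module.finrank E F).factorial * m : ℕ)) ∧
      nrm E v z ^ (Module.finrank E F).factorial = v (algebraMap E Ω (mon x u)) := by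
  obtain ⟨j, hj1, hj, hv⟩ := exists_coeff_nrm (E := E) v hz
  have hch : (Algebra.lmul E F z).charpoly = (Algebra.leftMulMatrix b z).charpoly := by
    rw [Algebra.leftMulMatrix_apply, LinearMap.charpoly_toMatrix]
  rw [hch] at hv
  have hco := charpoly_coeff_bx h.x_ne _ m hb j hj
  have hne : (Algebra.leftMulMatrix b z).charpoly.coeff (Module.finrank E F - j) ≠ 0 := by
    intro h0
    rw [h0, map_zero, map_zero] at hv
    exact (pow_ne_zero _ (nrm_pos v hz).ne') hv.symm
  obtain ⟨e, he, hve⟩ := h.val_bx hco hne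
  obtain ⟨q, hq⟩ := Nat.dvd_factorial hj1 hj
  refine ⟨q • e, fun k => ?_, ?_⟩
  · have := he k
    simp only [Pi.smul_apply, nsmul_eq_mul]
    rw [hq]
    refine ⟨mul_nonneg (by positivity) this.1, ?_⟩
    calc (q : ℤ) * e k ≤ q * ((j * m : ℕ) : ℤ) := mul_le_mul_of_nonneg_left this.2 (by positivity)
      _ = _ := by push_cast; ring
  · rw [hq, pow_mul, ← hv, mon_nsmul, map_pow, map_pow]
    congr 1

variable (E v) in
def Orth {ι : Type*} [Fintype ι] (w : ι → F) : Prop :=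
  (∀ j, w j ≠ 0) ∧
  ∀ (a : ι → E) (j : ι), v (algebraMap E Ω (a j)) * nrm E v (w j) ≤ nrm E v (∑ i, a i • w i)

theorem Orth.linInd {ι : Type*} [Fintype ι] {w : ι → F} (hw : Orth E v w) :
    LinearIndependent E w := by
  rw [Fintype.linearIndependent_iff]
  intro a ha j
  have := hw.2 a j
  rw [ha, nrm_zero, le_zero_iff, mul_eq_zero] at this
  rcases this with h | h
  · rw [v.zero_iff] at h; simpa using h
  · exact absurd h (nrm_pos v (hw.1 j)).ne'

variable (L E v) in
def ball (htr : ∀ c : L, v (algebraMap E Ω (algebraMap L E c)) ≤ 1) (γ : Γ₀) : Submodule L F where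
  carrier := {z | z = 0 ∨ nrm E v z < γ}
  zero_mem' := Or.inl rfl
  add_mem' := by
    rintro z w (rfl | hz) (rfl | hw)
    · left; simp
    · right; simpa using hw
    · right; simpa using hz
    · right; exact (nrm_add v z w).trans_lt (max_lt hz hw)
  smul_mem' := by
    rintro c z (rfl | hz)
    · left; simp
    · right
      rw [← algebraMap_smul E c z, nrm_smul]
      exact (mul_le_of_le_one_left' (htr c)).trans_lt hz

set_option maxHeartbeats 1000000 in
theorem Orth.card_ge [IsAlgClosed Ω] (h : Frame L (v.comap (algebraMap E Ω)) x)
    {ι : Type*} [Fintype ι] {w : ι → F} (hw : Orth E v w)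
    (happ : ∀ z : F, z ≠ 0 → ∃ a : ι → E, nrm E v (z - ∑ i, a i • w i) < nrm E v z) :
    Module.finrank E F ≤ Fintype.card ι := by
  classical
  set n := Module.finrank E F with hn
  obtain ⟨b, c, hb⟩ := h.scaled_basis (F := F)
  set M := n.factorial with hM
  have hM0 : 0 < M := Nat.factorial_pos _
  have hwn : ∀ j, ∃ A : Fin ρ → ℤ, nrm E v (w j) ^ M = v (algebraMap E Ω (mon x A)) := by
    intro j
    obtain ⟨D, m, hD, -, hm⟩ := h.common_den
      (fun t : Fin n × Fin n => Algebra.leftMulMatrix b (w j) t.1 t.2)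
    obtain ⟨u, -, hu⟩ := h.nrm_bx b m (z := D • w j) (smul_ne_zero hD (hw.1 j)) (by
      intro i k
      rw [map_smul, Matrix.smul_apply, smul_eq_mul]
      exact hm (i, k))
    obtain ⟨d, hd, hd1, -, hd2⟩ := h.hasLT D hD
    refine ⟨u - M • d, ?_⟩
    rw [nrm_smul, mul_pow] at hu
    have hd2' : v (algebraMap E Ω D) = v (algebraMap E Ω (mon x d)) := hd2
    have hd0 : v (algebraMap E Ω D) ≠ 0 := by rw [v.ne_zero_iff]; simpa using hD
    rw [mon_sub h.x_ne, mon_nsmul, map_div₀, map_div₀, ← hu, map_pow, map_pow, ← hd2']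
    exact (mul_div_cancel_left₀ _ (pow_ne_zero _ hd0)).symm
  choose A hA using hwn
  set a0 : ℕ := ∑ j, ∑ k, (A j k).natAbs with ha0
  have hAa : ∀ j k, |A j k| ≤ a0 := by
    intro j k
    rw [Int.abs_eq_natAbs]
    have h1 : (A j k).natAbs ≤ ∑ k, (A j k).natAbs :=
      Finset.single_le_sum (f := fun k => (A j k).natAbs) (fun _ _ => Nat.zero_le _) (Finset.mem_univ k)
    have h2 : ∑ k, (A j k).natAbs ≤ a0 :=
      Finset.single_le_sum (f := fun j => ∑ k, (A j k).natAbs) (fun _ _ => Nat.zero_le _)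
        (Finset.mem_univ j)
    exact_mod_cast h1.trans h2
  apply growth (C := c + 2 * a0 + 1) (ρ := ρ)
  intro N
  let gV : (Fin ρ → Fin (N + 1)) × Fin n → F := fun p => mon x (fun k => (p.1 k : ℤ)) • b p.2
  have hgV : LinearIndependent L gV := by
    have h1 : LinearIndependent L fun p : Fin ρ → Fin (N + 1) => mon x (fun k => (p k : ℤ)) := by
      refine h.linInd.comp (fun (p : Fin ρ → Fin (N + 1)) k => (p k : ℤ)) ?_
      intro p q hpq
      ext k
      have := congrFun hpq k
      simpa using this
    exact linearIndependent_smul (b := fun p : Fin ρ → Fin (N + 1) => mon x (fun k => (p k : ℤ))) (c := b) h1 b.linearIndependent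
  let V := Submodule.span L (Set.range gV)
  have hVf : FiniteDimensional L V := FiniteDimensional.span_of_finite L (Set.finite_range _)
  have hVd : Module.finrank L V = n * (N + 1) ^ ρ := by
    rw [finrank_span_eq_card hgV]
    simp [mul_comm]
  have hVm : ∀ z ∈ V, ∀ j k, Algebra.leftMulMatrix b z j k ∈ bx L x (N + c) := by
    intro z hz
    induction hz using Submodule.span_induction with
    | mem z hz =>
      obtain ⟨p, rfl⟩ := hz
      intro j k
      simp only [gV, map_smul, Matrix.smul_apply, smul_eq_mul]
      refine bx_mul h.x_ne (Submodule.subset_span ⟨_, fun k => ?_, rfl⟩) (hb _ _ _)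
      have := (p.1 k).2
      constructor <;> push_cast <;> omega
    | zero => intro j k; simp
    | add z w _ _ hz hw =>
      intro j k
      rw [map_add, Matrix.add_apply]; exact Submodule.add_mem _ (hz j k) (hw j k)
    | smul c z _ hz =>
      intro j k
      rw [← algebraMap_smul E c z, map_smul, Matrix.smul_apply, algebraMap_smul]
      exact Submodule.smul_mem _ _ (hz j k)
  let bd : (Fin ρ → Fin (N + (c + 2 * a0 + 1))) → Fin ρ → ℤ := fun q k => (q k : ℤ) - a0
  let gU : ι × (Fin ρ → Fin (N + (c + 2 * a0 + 1))) → F := fun p => mon x (bd p.2) • w p.1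
  let U := Submodule.span L (Set.range gU)
  have hUf : FiniteDimensional L U := FiniteDimensional.span_of_finite L (Set.finite_range _)
  have hUd : Module.finrank L U ≤ Fintype.card ι * (N + (c + 2 * a0 + 1)) ^ ρ := by
    refine (finrank_range_le_card gU).trans ?_
    simp
  rw [← hVd]
  refine le_trans ?_ hUd
  have htr : ∀ c : L, v (algebraMap E Ω (algebraMap L E c)) ≤ 1 := by
    intro c
    by_cases hc : c = 0
    · subst hc; simp
    · exact (h.triv c hc).le
  have hbd : ∀ z ∈ V, z ≠ 0 → ∀ j (e : Fin ρ → ℤ),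
      v (algebraMap E Ω (mon x e)) * nrm E v (w j) = nrm E v z → ∃ q, e = bd q := by
    intro z hz hz0 j e he
    obtain ⟨u, hu, huz⟩ := h.nrm_bx b (N + c) hz0 (hVm z hz)
    have h1 : v (algebraMap E Ω (mon x (M • e + A j))) = v (algebraMap E Ω (mon x u)) := by
      rw [← huz, ← he, mul_pow, mon_add h.x_ne, mon_nsmul]
      rw [map_mul, map_mul, map_pow, map_pow, ← hA]
    have h2 : M • e + A j = u := h.inj h1
    have h3 : ∀ k, 0 ≤ e k + a0 ∧ e k + a0 < N + (c + 2 * a0 + 1) := by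
      intro k
      have h4 := congrFun h2 k
      rw [Pi.add_apply, Pi.smul_apply, nsmul_eq_mul] at h4
      have h5 := abs_le.1 (hAa j k)
      have h6 := hu k
      have hMz : (1 : ℤ) ≤ M := by exact_mod_cast hM0
      push_cast at h6
      have h60 : (M : ℤ) * e k + A j k ≤ M * (N + c) := by rw [h4]; exact h6.2
      have h61 : 0 ≤ (M : ℤ) * e k + A j k := by rw [h4]; exact h6.1
      have ha0 : (0 : ℤ) ≤ a0 := by positivity
      constructor
      · by_contra hlt
        push Not at hlt
        have h7 : e k ≤ -a0 - 1 := by linarith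
        nlinarith
      · by_contra hlt
        push Not at hlt
        have h7 : (N : ℤ) + c + a0 + 1 ≤ e k := by linarith
        nlinarith
    refine ⟨fun k => ⟨(e k + a0).toNat, ?_⟩, ?_⟩
    · have := h3 k; omega
    · funext k
      have := h3 k
      simp only [bd]
      omega
  have hnz : ∀ z s : F, z ≠ 0 → nrm E v (z - s) < nrm E v z → s ≠ 0 ∧ nrm E v s = nrm E v z := by
    intro z s hz hs
    have := nrm_eq_of_sub_lt v hs
    refine ⟨?_, this⟩
    rintro rfl
    rw [nrm_zero] at this
    exact (nrm_pos v hz).ne this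
  have happ' : ∀ z ∈ V, z ≠ 0 → ∃ s ∈ U, nrm E v (z - s) < nrm E v z := by
    intro z hz hz0
    obtain ⟨a, ha⟩ := happ z hz0
    obtain ⟨hs0, hsn⟩ := hnz z _ hz0 ha
    have hle : ∀ j, v (algebraMap E Ω (a j)) * nrm E v (w j) ≤ nrm E v z := by
      intro j; rw [← hsn]; exact hw.2 a j
    have hpos := nrm_pos (E := E) v hz0
    have key : ∀ j, ∃ s ∈ U, nrm E v (a j • w j - s) < nrm E v z := by
      intro j
      rcases (hle j).lt_or_eq with hlt | heq
      · refine ⟨0, Submodule.zero_mem _, ?_⟩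
        rw [sub_zero, nrm_smul]; exact hlt
      · have haj : a j ≠ 0 := by
          intro h0
          rw [h0, map_zero, map_zero, zero_mul] at heq
          exact hpos.ne heq
        obtain ⟨e, c', -, h1, h2⟩ := h.hasLT (a j) haj
        have h1' : v (algebraMap E Ω (a j - algebraMap L E c' * mon x e)) <
          v (algebraMap E Ω (a j)) := h1
        have h2' : v (algebraMap E Ω (a j)) = v (algebraMap E Ω (mon x e)) := h2
        obtain ⟨q, rfl⟩ := hbd z hz hz0 j e (by rw [← h2', heq])
        refine ⟨c' • gU (j, q), Submodule.smul_mem _ _ (Submodule.subset_span ⟨_, rfl⟩), ?_⟩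
        have : a j • w j - c' • gU (j, q) = (a j - algebraMap L E c' * mon x (bd q)) • w j := by
          simp only [gU]
          rw [sub_smul, mul_smul, algebraMap_smul]
        rw [this, nrm_smul, ← heq]
        exact mul_lt_mul_of_pos_right h1' (nrm_pos v (hw.1 j))
    choose s hs hs' using key
    refine ⟨∑ j, s j, Submodule.sum_mem _ fun j _ => hs j, ?_⟩
    have : z - ∑ j, s j = (z - ∑ j, a j • w j) + ∑ j, (a j • w j - s j) := by
      rw [Finset.sum_sub_distrib]; ring
    rw [this]
    exact (nrm_add v _ _).trans_lt (max_lt ha (nrm_sum_lt v _ _ _ hpos fun j _ => hs' j))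
  refine finrank_le_of_approx (nrm E v) (ball L E v htr) (fun _ _ => Iff.rfl) ?_
    (Finset.univ.image fun p : ι × (Fin ρ → Fin (N + (c + 2 * a0 + 1))) =>
      v (algebraMap E Ω (mon x (bd p.2))) * nrm E v (w p.1)) V U ?_ ?_
  · rintro z s hz (hzs | hzs)
    · have : z = s := sub_eq_zero.1 hzs
      subst this; exact ⟨hz, rfl⟩
    · exact hnz z s hz hzs
  · intro z hz hz0
    obtain ⟨a, ha⟩ := happ z hz0
    obtain ⟨hs0, hsn⟩ := hnz z _ hz0 ha
    have : ∃ j, v (algebraMap E Ω (a j)) * nrm E v (w j) = nrm E v z := by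
      by_contra hcon
      push Not at hcon
      have hlt : nrm E v (∑ j, a j • w j) < nrm E v z := by
        refine nrm_sum_lt v _ _ _ (nrm_pos v hz0) fun j _ => ?_
        rw [nrm_smul]
        refine lt_of_le_of_ne ?_ (hcon j)
        rw [← hsn]; exact hw.2 a j
      exact hlt.ne hsn
    obtain ⟨j, hj⟩ := this
    have haj : a j ≠ 0 := by
      intro h0
      rw [h0, map_zero, map_zero, zero_mul] at hj
      exact (nrm_pos v hz0).ne hj
    obtain ⟨e, c', -, h1, h2⟩ := h.hasLT (a j) haj
    have h2' : v (algebraMap E Ω (a j)) = v (algebraMap E Ω (mon x e)) := h2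
    obtain ⟨q, rfl⟩ := hbd z hz hz0 j e (by rw [← h2', hj])
    rw [Finset.mem_image]
    exact ⟨(j, q), Finset.mem_univ _, by rw [← h2', hj]⟩
  · intro z hz hz0
    obtain ⟨s, hs, hs'⟩ := happ' z hz hz0
    exact ⟨s, hs, Or.inr hs'⟩

end

end LU

namespace LU

variable {Γ₀ : Type*} [LinearOrderedCommGroupWithZero Γ₀]

section geom
variable {Ω : Type*} [Field Ω] (v : Valuation Ω Γ₀)

theorem v_geom_le {z : Ω} (hz : v z ≤ 1) (s : ℕ) : v (∑ i ∈ Finset.range s, z ^ i) ≤ 1 :=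
  v.map_sum_le fun i _ => by rw [map_pow]; exact pow_le_one' hz i

theorem v_geom_of_lt {z : Ω} (hz : v z < 1) (s : ℕ) (hs : s ≠ 0) :
    v (∑ i ∈ Finset.range s, z ^ i) = 1 := by
  obtain ⟨t, rfl⟩ := Nat.exists_eq_succ_of_ne_zero hs
  rw [Finset.sum_range_succ', pow_zero]
  have : v (∑ i ∈ Finset.range t, z ^ (i + 1)) < v 1 := by
    rw [map_one]
    refine v.map_sum_lt one_ne_zero fun i _ => ?_
    rw [map_pow]; exact pow_lt_one₀ zero_le hz (by omega)
  rw [v.map_add_eq_of_lt_right this, map_one]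

theorem v_geom_of_gt {z : Ω} (hz : 1 < v z) (s : ℕ) :
    v (∑ i ∈ Finset.range (s + 1), z ^ i) = v z ^ s := by
  rw [Finset.sum_range_succ]
  have : v (∑ i ∈ Finset.range s, z ^ i) < v (z ^ s) := by
    have h0 : v (z ^ s) ≠ 0 := by
      rw [map_pow]; exact pow_ne_zero _ (zero_lt_one.trans hz).ne'
    refine v.map_sum_lt h0 fun i hi => ?_
    rw [map_pow, map_pow]
    exact pow_lt_pow_right₀ hz (Finset.mem_range.1 hi)
  rw [v.map_add_eq_of_lt_right this, map_pow]

theorem v_geom_gcd {z : Ω} (hz : v z = 1) : ∀ N a b : ℕ, a + b ≤ N →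
    v (∑ i ∈ Finset.range a, z ^ i) < 1 → v (∑ i ∈ Finset.range b, z ^ i) < 1 →
    v (∑ i ∈ Finset.range (Nat.gcd a b), z ^ i) < 1 := by
  have step : ∀ a b, a ≤ b → v (∑ i ∈ Finset.range a, z ^ i) < 1 →
      v (∑ i ∈ Finset.range b, z ^ i) < 1 → v (∑ i ∈ Finset.range (b - a), z ^ i) < 1 := by
    intro a b hab ha hb
    have h1 : z ^ a * ∑ i ∈ Finset.range (b - a), z ^ i =
        ∑ i ∈ Finset.range b, z ^ i - ∑ i ∈ Finset.range a, z ^ i := by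
      have := Finset.sum_range_add_sum_Ico (fun i => z ^ i) hab
      rw [← this, add_sub_cancel_left, Finset.sum_Ico_eq_sum_range, Finset.mul_sum]
      exact Finset.sum_congr rfl fun i _ => (pow_add _ _ _).symm
    have h2 : v (z ^ a * ∑ i ∈ Finset.range (b - a), z ^ i) < 1 := by
      rw [h1]; exact (v.map_sub _ _).trans_lt (max_lt hb ha)
    rwa [map_mul, map_pow, hz, one_pow, one_mul] at h2
  intro N
  induction N with
  | zero =>
    intro a b h ha hb
    obtain rfl : a = 0 := by omega
    obtain rfl : b = 0 := by omega
    simp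
  | succ N ih =>
    intro a b h ha hb
    rcases Nat.eq_zero_or_pos a with rfl | ha0
    · simpa using hb
    rcases Nat.eq_zero_or_pos b with rfl | hb0
    · simpa using ha
    rcases le_total a b with hab | hab
    · have := ih a (b - a) (by omega) ha (step a b hab ha hb)
      rwa [Nat.gcd_sub_self_right hab] at this
    · have := ih (a - b) b (by omega) (step b a hab hb ha) hb
      rwa [Nat.gcd_sub_self_left hab] at this

theorem geom_bad {z : Ω} (hz : v z ≤ 1) {s t : ℕ} (hs : s.Prime) (ht : t.Prime)
    (h1 : v (∑ i ∈ Finset.range s, z ^ i) ≠ 1) (h2 : v (∑ i ∈ Finset.range t, z ^ i) ≠ 1) : s = t := by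
  by_contra hst
  have hz1 : v z = 1 := by
    refine le_antisymm hz (not_lt.1 fun hlt => h1 (v_geom_of_lt v hlt s hs.ne_zero))
  have := v_geom_gcd v hz1 _ s t le_rfl (lt_of_le_of_ne (v_geom_le v hz s) h1)
    (lt_of_le_of_ne (v_geom_le v hz t) h2)
  rw [(Nat.coprime_primes hs ht).2 hst] at this
  simp at this

end geom

section

variable {E F Ω : Type*} [Field E] [Field F] [Field Ω] [Algebra E F] [Algebra E Ω] [Algebra F Ω]
  [IsScalarTower E F Ω] [FiniteDimensional E F] (v : Valuation Ω Γ₀)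

variable (E) in
theorem exists_den (z : F) : ∃ d : F, d ≠ 0 ∧ nrm E v d ≤ 1 ∧ nrm E v (z * d) ≤ 1 ∧
    ∀ τ : F →ₐ[E] Ω, (v (τ z) ≤ 1 → v (τ d) = 1) ∧ (1 < v (τ z) → v (τ d) < 1) := by
  classical
  let bad : (F →ₐ[E] Ω) → Set ℕ := fun τ =>
    {s | s.Prime ∧ v (τ z) ≤ 1 ∧ v (∑ i ∈ Finset.range s, (τ z) ^ i) ≠ 1}
  have hfin : (⋃ τ, bad τ).Finite := by
    refine Set.finite_iUnion fun τ => Set.Subsingleton.finite ?_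
    rintro s ⟨hs, hz, h1⟩ t ⟨ht, -, h2⟩
    exact geom_bad v hz hs ht h1 h2
  obtain ⟨s, hs, hsb⟩ := (Nat.infinite_setOfPred_prime.sdiff hfin).nonempty
  have hs2 : 2 ≤ s := Nat.Prime.two_le hs
  obtain ⟨t, rfl⟩ : ∃ t, s = t + 2 := ⟨s - 2, by omega⟩
  set q := ∑ i ∈ Finset.range (t + 2), z ^ i with hq
  have hτq : ∀ τ : F →ₐ[E] Ω, τ q = ∑ i ∈ Finset.range (t + 2), (τ z) ^ i := by
    intro τ; simp [hq, map_sum]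
  have h1 : ∀ τ : F →ₐ[E] Ω, v (τ z) ≤ 1 → v (τ q) = 1 := by
    intro τ hz
    by_contra hne
    rw [hτq] at hne
    exact hsb (Set.mem_iUnion.2 ⟨τ, hs, hz, hne⟩)
  have h2 : ∀ τ : F →ₐ[E] Ω, 1 < v (τ z) → v (τ q) = v (τ z) ^ (t + 1) := by
    intro τ hz
    rw [hτq, v_geom_of_gt v hz]
  have hq0 : q ≠ 0 := by
    intro h0
    let τ := IsScalarTower.toAlgHom E F Ω
    rcases le_or_gt (v (τ z)) 1 with h | h
    · have := h1 τ h; rw [h0] at this; simp at this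
    · have := h2 τ h
      rw [h0, map_zero, map_zero] at this
      exact pow_ne_zero _ (zero_lt_one.trans h).ne' this.symm
  have key : ∀ τ : F →ₐ[E] Ω, (v (τ z) ≤ 1 → v (τ q⁻¹) = 1) ∧ (1 < v (τ z) → v (τ q⁻¹) < 1) := by
    intro τ
    constructor
    · intro h; rw [map_inv₀, map_inv₀, h1 τ h, inv_one]
    · intro h
      rw [map_inv₀, map_inv₀, h2 τ h]
      exact inv_lt_one_of_one_lt₀ (one_lt_pow₀ h (by omega))
  refine ⟨q⁻¹, inv_ne_zero hq0, nrm_le v fun τ => ?_, nrm_le v fun τ => ?_, key⟩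
  · rcases le_or_gt (v (τ z)) 1 with h | h
    · exact ((key τ).1 h).le
    · exact ((key τ).2 h).le
  · rcases le_or_gt (v (τ z)) 1 with h | h
    · rw [map_mul, map_mul, (key τ).1 h, mul_one]; exact h
    · rw [map_mul, map_mul, map_inv₀, map_inv₀, h2 τ h, pow_succ', mul_inv, ← mul_assoc,
        mul_inv_cancel₀ (zero_lt_one.trans h).ne', one_mul]
      exact inv_le_one_of_one_le₀ (one_le_pow₀ h.le)

theorem charpoly_coeff_le [IsAlgClosed Ω] {z : F} (hz : nrm E v z ≤ 1) (i : ℕ) :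
    v (algebraMap E Ω ((Algebra.lmul E F z).charpoly.coeff i)) ≤ 1 := by
  set p := (Algebra.lmul E F z).charpoly with hp
  have hpm : p.Monic := LinearMap.charpoly_monic _
  have hs := (IsAlgClosed.splits (p.map (algebraMap E Ω))).eq_prod_roots_of_monic (hpm.map _)
  have hint : IsIntegral E z := Algebra.IsIntegral.isIntegral z
  have hrange := Algebra.IsAlgebraic.range_eval_eq_rootSet_minpoly (F := E) (K := F) Ω z
  have hle : ∀ r ∈ (p.map (algebraMap E Ω)).roots, v r ≤ 1 := by
    intro r hr
    rw [Polynomial.mem_roots (hpm.map _).ne_zero, Polynomial.IsRoot, Polynomial.eval_map,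
      ← Polynomial.aeval_def, hp, charpoly_eq_pow, map_pow] at hr
    have hr' := eq_zero_of_pow_eq_zero hr
    have : r ∈ (minpoly E z).rootSet Ω := by
      rw [Polynomial.mem_rootSet_of_ne (minpoly.ne_zero hint)]; exact hr'
    rw [← hrange] at this
    obtain ⟨σ, rfl⟩ := this
    exact (le_nrm v σ z).trans hz
  rw [← Polynomial.coeff_map]
  rcases Nat.lt_or_ge (p.map (algebraMap E Ω)).roots.card i with h | h
  · rw [Polynomial.coeff_eq_zero_of_natDegree_lt]
    · simp
    · rw [(IsAlgClosed.splits (p.map (algebraMap E Ω))).natDegree_eq_card_roots]; exact h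
  · rw [hs]
    have := coeff_prod_le v 1 _ hle i h
    rwa [one_pow] at this

theorem exists_inv_mod [IsAlgClosed Ω] {d : F} (hd : nrm E v d ≤ 1) (hd1 : v (algebraMap F Ω d) = 1) :
    ∃ u : F, nrm E v u ≤ 1 ∧ v (algebraMap F Ω (u * d - 1)) < 1 := by
  classical
  set p := (Algebra.lmul E F d).charpoly with hp
  have hpm : p.Monic := LinearMap.charpoly_monic _
  have hp0 : Polynomial.aeval d p = 0 := by
    rw [hp, charpoly_eq_pow, map_pow, minpoly.aeval, zero_pow Module.finrank_pos.ne']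
  have hle : ∀ i, v (algebraMap E Ω (p.coeff i)) ≤ 1 := charpoly_coeff_le v hd
  have hex : ∃ i, v (algebraMap E Ω (p.coeff i)) = 1 := ⟨p.natDegree, by simp [hpm.coeff_natDegree]⟩
  set i := Nat.find hex with hi
  have hi1 : v (algebraMap E Ω (p.coeff i)) = 1 := Nat.find_spec hex
  have hi2 : ∀ j < i, v (algebraMap E Ω (p.coeff j)) < 1 := fun j hj =>
    lt_of_le_of_ne (hle j) (Nat.find_min hex hj)
  have hc0 : p.coeff i ≠ 0 := by
    intro h0; rw [h0] at hi1; simp at hi1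
  have hidx : i ≤ p.natDegree := Polynomial.le_natDegree_of_ne_zero hc0
  obtain ⟨m, hm⟩ : ∃ m, p.natDegree = i + m := ⟨p.natDegree - i, by omega⟩
  set S := ∑ j ∈ Finset.range m, p.coeff (i + (j + 1)) • d ^ j with hS
  have hsum : ∑ j ∈ Finset.range i, p.coeff j • d ^ j + d ^ i * (p.coeff i • 1 + d * S) = 0 := by
    rw [Polynomial.aeval_eq_sum_range, hm, show i + m + 1 = i + (m + 1) by ring,
      Finset.sum_range_add, Finset.sum_range_succ'] at hp0
    rw [← hp0]
    congr 1
    rw [mul_add, hS, Finset.mul_sum, Finset.mul_sum, add_comm]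
    congr 1
    · refine Finset.sum_congr rfl fun j _ => ?_
      simp only [Algebra.smul_def]; ring
    · simp [Algebra.smul_def, mul_comm]
  have hvE : ∀ a : E, v (algebraMap F Ω (algebraMap E F a)) = v (algebraMap E Ω a) := by
    intro a; rw [← IsScalarTower.algebraMap_apply]
  have hlt : v (algebraMap F Ω (p.coeff i • 1 + d * S)) < 1 := by
    have h1 : d ^ i * (p.coeff i • 1 + d * S) = -∑ j ∈ Finset.range i, p.coeff j • d ^ j := by
      rw [eq_neg_iff_add_eq_zero, add_comm]; exact hsum
    have h2 : v (algebraMap F Ω (d ^ i * (p.coeff i • 1 + d * S))) < 1 := by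
      rw [h1, map_neg, Valuation.map_neg, map_sum]
      refine v.map_sum_lt one_ne_zero fun j hj => ?_
      rw [Algebra.smul_def, map_mul, map_mul, map_pow, map_pow, hd1, one_pow, mul_one, hvE]
      exact hi2 j (Finset.mem_range.1 hj)
    rwa [map_mul, map_mul, map_pow, map_pow, hd1, one_pow, one_mul] at h2
  have hnd : ∀ j, nrm E v (d ^ j) ≤ 1 := fun j => nrm_le v fun σ => by
    rw [map_pow, map_pow]; exact pow_le_one' ((le_nrm v σ d).trans hd) j
  refine ⟨(-(p.coeff i)⁻¹) • S, ?_, ?_⟩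
  · rw [nrm_smul, map_neg, Valuation.map_neg, map_inv₀, map_inv₀, hi1, inv_one, one_mul]
    refine nrm_sum_le v _ _ _ fun j _ => ?_
    rw [nrm_smul]
    exact mul_le_one' (hle _) (hnd _)
  · have h3 : (-(p.coeff i)⁻¹) • S * d - 1 =
        algebraMap E F (-(p.coeff i)⁻¹) * (p.coeff i • 1 + d * S) := by
      have : algebraMap E F (p.coeff i) ≠ 0 := by simpa using hc0
      simp only [Algebra.smul_def, map_neg, map_inv₀, mul_one]
      field_simp
      ring
    rw [h3, map_mul, map_mul, hvE, map_neg, Valuation.map_neg, map_inv₀, map_inv₀, hi1, inv_one,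
      one_mul]
    exact hlt

theorem exists_approx_int [IsAlgClosed Ω] {z : F} (hz : v (algebraMap F Ω z) ≤ 1) :
    ∃ u : F, nrm E v u ≤ 1 ∧ v (algebraMap F Ω (u - z)) < 1 := by
  obtain ⟨d, hd0, hd, hzd, hτ⟩ := exists_den E v z
  have hd1 : v (algebraMap F Ω d) = 1 := (hτ (IsScalarTower.toAlgHom E F Ω)).1 hz
  obtain ⟨u, hu, hud⟩ := exists_inv_mod v hd hd1
  refine ⟨z * d * u, (nrm_mul v _ _).trans (mul_le_one' hzd hu), ?_⟩
  have : z * d * u - z = z * (u * d - 1) := by ring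
  rw [this, map_mul, map_mul]
  exact (mul_le_of_le_one_left' hz).trans_lt hud

end

end LU

namespace LU

variable {Γ₀ : Type*} [LinearOrderedCommGroupWithZero Γ₀]

section

variable {E F Ω : Type*} [Field E] [Field F] [Field Ω] [Algebra E F] [Algebra E Ω] [Algebra F Ω]
  [IsScalarTower E F Ω] [FiniteDimensional E F] (v : Valuation Ω Γ₀)

structure ResGen (E : Type*) {F Ω : Type*} [Field E] [Field F] [Field Ω] [Algebra E F] [Algebra E Ω]
    [Algebra F Ω] (v : Valuation Ω Γ₀) (α : F) (g : Polynomial E) : Prop where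
  val : ∀ z : F, z ≠ 0 → ∃ a : E, v (algebraMap F Ω z) = v (algebraMap E Ω a)
  unit : v (algebraMap F Ω α) = 1
  monic : g.Monic
  coeff : ∀ i, v (algebraMap E Ω (g.coeff i)) ≤ 1
  root : v (algebraMap F Ω (Polynomial.aeval α g)) < 1
  der : v (algebraMap F Ω (Polynomial.aeval α (Polynomial.derivative g))) = 1
  gen : ∀ u : F, v (algebraMap F Ω u) ≤ 1 → ∃ a : Fin g.natDegree → E,
    (∀ i, v (algebraMap E Ω (a i)) ≤ 1) ∧ v (algebraMap F Ω (u - ∑ i, a i • α ^ (i : ℕ))) < 1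
  ind : ∀ a : Fin g.natDegree → E, (∀ i, v (algebraMap E Ω (a i)) ≤ 1) →
    v (algebraMap F Ω (∑ i, a i • α ^ (i : ℕ))) < 1 → ∀ i, v (algebraMap E Ω (a i)) < 1

theorem vE (a : E) : v (algebraMap F Ω (algebraMap E F a)) = v (algebraMap E Ω a) := by
  rw [← IsScalarTower.algebraMap_apply]

theorem pow_congr {α η : F} (hα : v (algebraMap F Ω α) ≤ 1) (h : v (algebraMap F Ω (η - α)) < 1) (i : ℕ) :
    v (algebraMap F Ω (η ^ i - α ^ i)) < 1 := by
  have hη : v (algebraMap F Ω η) ≤ 1 := by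
    have : η = (η - α) + α := by ring
    rw [this, map_add]
    exact (v.map_add _ _).trans (max_le h.le hα)
  induction i with
  | zero => simp
  | succ i ih =>
    have : η ^ (i + 1) - α ^ (i + 1) = (η ^ i - α ^ i) * η + α ^ i * (η - α) := by ring
    rw [this, map_add]
    refine (v.map_add _ _).trans_lt (max_lt ?_ ?_)
    · rw [map_mul, map_mul]; exact (mul_le_of_le_one_right' hη).trans_lt ih
    · rw [map_mul, map_mul, map_pow, map_pow]
      exact (mul_le_of_le_one_left' (pow_le_one' hα i)).trans_lt h

theorem sum_congr_lt {ι : Type*} (s : Finset ι) (a : ι → E) (p q : ι → F)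
    (ha : ∀ i ∈ s, v (algebraMap E Ω (a i)) ≤ 1) (h : ∀ i ∈ s, v (algebraMap F Ω (p i - q i)) < 1) :
    v (algebraMap F Ω (∑ i ∈ s, a i • p i - ∑ i ∈ s, a i • q i)) < 1 := by
  rw [← Finset.sum_sub_distrib, map_sum]
  refine v.map_sum_lt one_ne_zero fun i hi => ?_
  rw [← smul_sub, Algebra.smul_def, map_mul, map_mul, vE]
  exact (mul_le_of_le_one_left' (ha i hi)).trans_lt (h i hi)

theorem aeval_congr {α η : F} (hα : v (algebraMap F Ω α) ≤ 1) (h : v (algebraMap F Ω (η - α)) < 1)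
    (p : Polynomial E) (hp : ∀ i, v (algebraMap E Ω (p.coeff i)) ≤ 1) :
    v (algebraMap F Ω (Polynomial.aeval η p - Polynomial.aeval α p)) < 1 := by
  rw [Polynomial.aeval_eq_sum_range, Polynomial.aeval_eq_sum_range]
  exact sum_congr_lt v _ _ _ _ (fun i _ => hp i) fun i _ => pow_congr v hα h i

theorem lt_of_sub_lt {a b : Ω} (h : v (a - b) < 1) (hb : v b < 1) : v a < 1 := by
  have : a = (a - b) + b := by ring
  rw [this]; exact (v.map_add _ _).trans_lt (max_lt h hb)

theorem eq_one_of_sub_lt {a b : Ω} (h : v (a - b) < 1) (hb : v b = 1) : v a = 1 := by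
  have : a = b + (a - b) := by ring
  rw [this, v.map_add_eq_of_lt_left (by rwa [hb]), hb]

theorem der_coeff_le (p : Polynomial E) (hp : ∀ i, v (algebraMap E Ω (p.coeff i)) ≤ 1) (i : ℕ) :
    v (algebraMap E Ω ((Polynomial.derivative p).coeff i)) ≤ 1 := by
  rw [Polynomial.coeff_derivative, map_mul, map_mul]
  refine mul_le_one' (hp _) ?_
  have : algebraMap E Ω ((i : E) + 1) = ((i + 1 : ℕ) : Ω) := by push_cast; simp
  rw [this]
  exact (v.mem_integer_iff _).1 (natCast_mem v.integer (i + 1))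

theorem ResGen.congr {α η : F} {g : Polynomial E} (h : ResGen E v α g)
    (hη : v (algebraMap F Ω (η - α)) < 1) : ResGen E v η g := by
  have h1 : v (algebraMap F Ω α) ≤ 1 := h.unit.le
  refine ⟨h.val, ?_, h.monic, h.coeff, ?_, ?_, ?_, ?_⟩
  · rw [map_sub] at hη
    exact eq_one_of_sub_lt v hη h.unit
  · have := aeval_congr v h1 hη g h.coeff
    rw [map_sub] at this
    exact lt_of_sub_lt v this h.root
  · have := aeval_congr v h1 hη _ (der_coeff_le v g h.coeff)
    rw [map_sub] at this
    exact eq_one_of_sub_lt v this h.der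
  · intro u hu
    obtain ⟨a, ha, hua⟩ := h.gen u hu
    refine ⟨a, ha, ?_⟩
    have h2 := sum_congr_lt v Finset.univ a _ _ (fun i _ => ha i) fun i _ => pow_congr v h1 hη i
    have h3 : u - ∑ i, a i • η ^ (i : ℕ) = (u - ∑ i, a i • α ^ (i : ℕ)) -
      (∑ i, a i • η ^ (i : ℕ) - ∑ i, a i • α ^ (i : ℕ)) := by ring
    rw [h3, map_sub]
    exact (v.map_sub _ _).trans_lt (max_lt hua h2)
  · intro a ha hlt
    refine h.ind a ha ?_
    have h2 := sum_congr_lt v Finset.univ a _ _ (fun i _ => ha i) fun i _ => pow_congr v h1 hη i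
    rw [map_sub, Valuation.map_sub_swap] at h2
    exact lt_of_sub_lt v h2 hlt

theorem ResGen.exists_eta [IsAlgClosed Ω] {α : F} {g : Polynomial E} (h : ResGen E v α g) :
    ∃ η : F, ResGen E v η g ∧ nrm E v η ≤ 1 ∧
      ∀ z : F, v (algebraMap F Ω z) < nrm E v z → nrm E v (η * z) < nrm E v z := by
  classical
  let H : Set (F →ₐ[E] Ω) := {σ | ∀ z, v (algebraMap F Ω z) ≤ 1 → v (σ z) ≤ 1}
  have hH : ∀ σ ∈ H, ∀ z, v (σ z) ≤ v (algebraMap F Ω z) := by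
    intro σ hσ z
    by_cases hz : z = 0
    · subst hz; simp
    obtain ⟨a, ha⟩ := h.val z hz
    have hvz : v (algebraMap F Ω z) ≠ 0 := by rw [v.ne_zero_iff]; simpa using hz
    have h1 := hσ (z / algebraMap E F a) (by
      rw [map_div₀, map_div₀, vE, ← ha, div_self hvz])
    rw [map_div₀, map_div₀, AlgHom.commutes, ← ha] at h1
    exact (div_le_one₀ (zero_lt_iff.2 hvz)).1 h1
  have hden : ∀ σ : F →ₐ[E] Ω, ∃ d : F, nrm E v d ≤ 1 ∧ v (algebraMap F Ω d) = 1 ∧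
      (σ ∉ H → v (σ d) < 1) := by
    intro σ
    by_cases hσ : σ ∈ H
    · exact ⟨1, nrm_le v fun τ => by simp, by simp, fun h => absurd hσ h⟩
    · have : ∃ z, v (algebraMap F Ω z) ≤ 1 ∧ 1 < v (σ z) := by
        by_contra hcon
        push Not at hcon
        exact hσ hcon
      obtain ⟨z, hz1, hz2⟩ := this
      obtain ⟨d, -, hd, -, hτ⟩ := exists_den E v z
      exact ⟨d, hd, (hτ (IsScalarTower.toAlgHom E F Ω)).1 hz1, fun _ => (hτ σ).2 hz2⟩
  choose d hd hd1 hdσ using hden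
  set b := ∏ σ, d σ with hb
  have hb1 : v (algebraMap F Ω b) = 1 := by
    rw [hb, map_prod, map_prod]
    exact Finset.prod_eq_one fun σ _ => hd1 σ
  have hbσ : ∀ σ, σ ∉ H → v (σ b) < 1 := by
    intro σ hσ
    rw [hb, map_prod, map_prod, ← Finset.mul_prod_erase _ _ (Finset.mem_univ σ)]
    refine (mul_le_of_le_one_right' ?_).trans_lt (hdσ σ hσ)
    exact Finset.prod_le_one' fun τ _ => (le_nrm v σ _).trans (hd τ)
  have hbn : nrm E v b ≤ 1 := nrm_le v fun σ => by
    rw [hb, map_prod, map_prod]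
    exact Finset.prod_le_one' fun τ _ => (le_nrm v σ _).trans (hd τ)
  have hb0 : b ≠ 0 := by intro h0; rw [h0] at hb1; simp at hb1
  obtain ⟨u, hu, hub⟩ := exists_approx_int (E := E) v (z := α / b) (by
    rw [map_div₀, map_div₀, h.unit, hb1, div_one])
  have hub' : v (algebraMap F Ω (b * u - α)) < 1 := by
    have : b * u - α = b * (u - α / b) := by field_simp
    rw [this, map_mul, map_mul, hb1, one_mul]; exact hub
  have hlast : ∀ z : F, v (algebraMap F Ω z) < nrm E v z → nrm E v (b * u * z) < nrm E v z := by
    intro z hz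
    have hz0 : z ≠ 0 := by rintro rfl; simp at hz
    refine nrm_lt v fun σ => ?_
    rw [map_mul, map_mul]
    by_cases hσ : σ ∈ H
    · refine (mul_le_of_le_one_left' ?_).trans_lt ((hH σ hσ z).trans_lt hz)
      exact (le_nrm v σ _).trans ((nrm_mul v _ _).trans (mul_le_one' hbn hu))
    · have h1 : v (σ (b * u)) < 1 := by
        rw [map_mul, map_mul]
        exact (mul_le_of_le_one_right' ((le_nrm v σ u).trans hu)).trans_lt (hbσ σ hσ)
      have hp := nrm_pos (E := E) v hz0
      calc v (σ (b * u)) * v (σ z) ≤ v (σ (b * u)) * nrm E v z := mul_le_mul_right (le_nrm v σ z) _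
        _ < 1 * nrm E v z := mul_lt_mul_of_pos_right h1 hp
        _ = _ := one_mul _
  exact ⟨b * u, h.congr v hub', (nrm_mul v _ _).trans (mul_le_one' hbn hu), hlast⟩

end

end LU

namespace LU

variable {Γ₀ : Type*} [LinearOrderedCommGroupWithZero Γ₀]

section coefs
variable {Ω : Type*} [Field Ω] (v : Valuation Ω Γ₀)

def LowMax (k : ℕ) (p : Polynomial Ω) : Prop :=
  (∀ i, v (p.coeff i) ≤ 1) ∧ ∀ i < k, v (p.coeff i) < 1

theorem LowMax.mul {k l : ℕ} {p q : Polynomial Ω} (hp : LowMax v k p) (hq : LowMax v l q) :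
    LowMax v (k + l) (p * q) := by
  constructor
  · intro i
    rw [Polynomial.coeff_mul]
    refine v.map_sum_le fun a _ => ?_
    rw [map_mul]; exact mul_le_one' (hp.1 _) (hq.1 _)
  · intro i hi
    rw [Polynomial.coeff_mul]
    refine v.map_sum_lt one_ne_zero fun a ha => ?_
    have ha := Finset.HasAntidiagonal.mem_antidiagonal.1 ha
    rw [map_mul]
    rcases Nat.lt_or_ge a.1 k with h | h
    · exact (mul_le_of_le_one_right' (hq.1 _)).trans_lt (hp.2 _ h)
    · exact (mul_le_of_le_one_left' (hp.1 _)).trans_lt (hq.2 _ (by omega))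

theorem LowMax.prod {ι : Type*} (s : Finset ι) (k : ι → ℕ) (p : ι → Polynomial Ω)
    (h : ∀ i ∈ s, LowMax v (k i) (p i)) : LowMax v (∑ i ∈ s, k i) (∏ i ∈ s, p i) := by
  classical
  induction s using Finset.induction_on with
  | empty =>
    refine ⟨fun i => ?_, fun i hi => by simp at hi⟩
    rw [Finset.prod_empty, Polynomial.coeff_one]
    split_ifs <;> simp
  | insert a s ha ih =>
    rw [Finset.sum_insert ha, Finset.prod_insert ha]
    exact (h a (Finset.mem_insert_self _ _)).mul v
      (ih fun i hi => h i (Finset.mem_insert_of_mem hi))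

theorem LowMax.charpoly {ι : Type*} [Fintype ι] [DecidableEq ι] (A : Matrix ι ι Ω) (k : ι → ℕ)
    (hk : ∀ i, k i ≤ 1)
    (hA : ∀ i j, v (A i j) ≤ 1) (hA' : ∀ i j, k j = 1 → v (A i j) < 1) :
    LowMax v (∑ i, k i) A.charpoly := by
  have key : ∀ σ : Equiv.Perm ι, LowMax v (∑ i, k i) (∏ i, A.charmatrix (σ i) i) := by
    intro σ
    refine LowMax.prod v _ _ _ fun i _ => ?_
    by_cases hi : σ i = i
    · rw [hi, Matrix.charmatrix_apply_eq]
      refine ⟨fun j => ?_, fun j hj => ?_⟩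
      · rw [Polynomial.coeff_sub]
        refine (v.map_sub _ _).trans (max_le ?_ ?_)
        · rw [Polynomial.coeff_X]; split_ifs <;> simp
        · rw [Polynomial.coeff_C]; split_ifs
          · exact hA _ _
          · simp
      · have := hk i
        obtain rfl : j = 0 := by omega
        simp only [Polynomial.coeff_sub, Polynomial.coeff_X_zero, Polynomial.coeff_C_zero, zero_sub,
          Valuation.map_neg]
        exact hA' _ _ (by omega)
    · rw [Matrix.charmatrix_apply_ne _ _ _ hi]
      refine ⟨fun j => ?_, fun j hj => ?_⟩
      · rw [Polynomial.coeff_neg, Valuation.map_neg, Polynomial.coeff_C]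
        split_ifs
        · exact hA _ _
        · simp
      · have := hk i
        obtain rfl : j = 0 := by omega
        simp only [Polynomial.coeff_neg, Polynomial.coeff_C_zero, Valuation.map_neg]
        exact hA' _ _ (by omega)
  have key2 : ∀ σ : Equiv.Perm ι, ∀ i, v ((Equiv.Perm.sign σ • ∏ i, A.charmatrix (σ i) i).coeff i)
      = v ((∏ i, A.charmatrix (σ i) i).coeff i) := by
    intro σ i
    rcases Int.units_eq_one_or (Equiv.Perm.sign σ) with h | h
    · rw [h, one_smul]
    · rw [h, Units.neg_smul, one_smul, Polynomial.coeff_neg, Valuation.map_neg]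
  rw [Matrix.charpoly, Matrix.det_apply]
  constructor
  · intro i
    rw [Polynomial.finsetSum_coeff]
    refine v.map_sum_le fun σ _ => ?_
    rw [key2]; exact (key σ).1 i
  · intro i hi
    rw [Polynomial.finsetSum_coeff]
    refine v.map_sum_lt one_ne_zero fun σ _ => ?_
    rw [key2]; exact (key σ).2 i hi

end coefs

section

variable {L E F Ω : Type*} [Field L] [Field E] [Field F] [Field Ω] [Algebra L E] [Algebra E F]
  [Algebra L F] [IsScalarTower L E F] [Algebra E Ω] [Algebra F Ω]
  [IsScalarTower E F Ω] [FiniteDimensional E F] {v : Valuation Ω Γ₀} {ρ : ℕ} {x : Fin ρ → E}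

theorem ResGen.pow_max {η : F} {g : Polynomial E} (h : ResGen E v η g)
    (a : Fin g.natDegree → E) (j : Fin g.natDegree) :
    v (algebraMap E Ω (a j)) ≤ v (algebraMap F Ω (∑ i, a i • η ^ ((i : ℕ) + 1))) := by
  have : Nonempty (Fin g.natDegree) := ⟨j⟩
  obtain ⟨m, -, hm⟩ := Finset.exists_max_image Finset.univ (fun i => v (algebraMap E Ω (a i)))
    Finset.univ_nonempty
  refine (hm j (Finset.mem_univ j)).trans ?_
  by_cases h0 : a m = 0
  · rw [h0]; simp
  by_contra hlt
  push Not at hlt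
  have hv0 : v (algebraMap E Ω (a m)) ≠ 0 := by rw [v.ne_zero_iff]; simpa using h0
  have h1 := h.ind (fun i => a i / a m) (fun i => by
    rw [map_div₀, map_div₀]
    exact (div_le_one₀ (zero_lt_iff.2 hv0)).2 (hm i (Finset.mem_univ i))) (by
      have e : ∑ i, a i • η ^ ((i : ℕ) + 1) =
          (algebraMap E F (a m) * η) * ∑ i : Fin g.natDegree, (a i / a m) • η ^ (i : ℕ) := by
        have : algebraMap E F (a m) ≠ 0 := by simpa using h0
        rw [Finset.mul_sum]
        refine Finset.sum_congr rfl fun i _ => ?_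
        simp only [Algebra.smul_def, map_div₀]
        field_simp
        ring
      rw [e, map_mul, map_mul, map_mul, map_mul, h.unit, mul_one, vE] at hlt
      by_contra hge
      push Not at hge
      exact absurd hlt (not_lt.2 (le_mul_of_one_le_right' hge))) m
  rw [div_self h0] at h1
  simp at h1

theorem ResGen.exists_basis [IsAlgClosed Ω] (hf : Frame L (v.comap (algebraMap E Ω)) x)
    {η : F} {g : Polynomial E} (h : ResGen E v η g) (hη : nrm E v η ≤ 1) :
    ∃ (s : ℕ) (w : Fin g.natDegree ⊕ Fin s → F), Orth E v w ∧
      (∀ j, v (algebraMap F Ω (w (Sum.inr j))) < nrm E v (w (Sum.inr j))) ∧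
      Module.finrank E F = g.natDegree + s := by
  classical
  let pw : Fin g.natDegree → F := fun i => η ^ ((i : ℕ) + 1)
  let Good : ℕ → Prop := fun s => ∃ w : Fin s → F, Orth E v (Sum.elim pw w) ∧
    ∀ j, v (algebraMap F Ω (w j)) < nrm E v (w j)
  have hη0 : η ≠ 0 := by
    intro h0; have := h.unit; rw [h0] at this; simp at this
  have hpn : ∀ i, nrm E v (pw i) ≤ 1 := fun i => nrm_le v fun σ => by
    simp only [pw, map_pow]
    exact pow_le_one' ((le_nrm v σ η).trans hη) _
  have hg0 : Good 0 := by
    refine ⟨Fin.elim0, ⟨?_, ?_⟩, fun j => j.elim0⟩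
    · rintro (i | i)
      · exact pow_ne_zero _ hη0
      · exact i.elim0
    · rintro a (j | j)
      · rw [Fintype.sum_sum_type]
        simp only [Sum.elim_inl, Finset.univ_eq_empty, Finset.sum_empty, add_zero]
        refine (mul_le_of_le_one_right' (hpn j)).trans ?_
        exact (h.pow_max (fun i => a (Sum.inl i)) j).trans (v_le_nrm v _)
      · exact j.elim0
  have hbound : ∀ s, Good s → s ≤ Module.finrank E F := by
    rintro s ⟨w, hw, -⟩
    have := hw.linInd.fintype_card_le_finrank
    simp at this
    omega
  have hex : ∃ s, Good s ∧ ¬ Good (s + 1) := by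
    by_contra hcon
    push Not at hcon
    have hall : ∀ s, Good s := fun s => by
      induction s with
      | zero => exact hg0
      | succ s ih => exact hcon s ih
    have := hbound _ (hall (Module.finrank E F + 1))
    omega
  obtain ⟨s, ⟨w, hw, hwl⟩, hmax⟩ := hex
  set W : Fin g.natDegree ⊕ Fin s → F := Sum.elim pw w with hW
  have case1 : ∀ z : F, v (algebraMap F Ω z) < nrm E v z →
      ∃ a : Fin g.natDegree ⊕ Fin s → E, nrm E v (z - ∑ i, a i • W i) < nrm E v z := by
    intro z hz
    by_contra hcon
    push Not at hcon
    apply hmax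
    refine ⟨Fin.snoc w z, ⟨?_, ?_⟩, ?_⟩
    · rintro (i | i)
      · exact hw.1 (Sum.inl i)
      · refine Fin.lastCases ?_ (fun i => ?_) i
        · simp only [Sum.elim_inr, Fin.snoc_last]
          rintro rfl; simp at hz
        · simp only [Sum.elim_inr, Fin.snoc_castSucc]
          exact hw.1 (Sum.inr i)
    · intro a
      set c := a (Sum.inr (Fin.last s)) with hc
      let a' : Fin g.natDegree ⊕ Fin s → E := Sum.elim (fun i => a (Sum.inl i))
        fun i => a (Sum.inr i.castSucc)
      have hsum : ∑ i, a i • (Sum.elim pw (Fin.snoc (α := fun _ => F) w z) : _ → F) i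
          = ∑ i, a' i • W i + c • z := by
        rw [Fintype.sum_sum_type, Fintype.sum_sum_type, Fin.sum_univ_castSucc]
        simp only [Sum.elim_inl, Sum.elim_inr, Fin.snoc_castSucc, Fin.snoc_last, a', hW, hc, add_assoc]
      rw [hsum]
      have hA : nrm E v (c • z) ≤ nrm E v (∑ i, a' i • W i + c • z) := by
        by_cases hc0 : c = 0
        · rw [hc0, zero_smul, nrm_zero]; exact zero_le
        · have := hcon (fun i => -(c⁻¹ * a' i))
          have e : ∑ i, a' i • W i + c • z = c • (z - ∑ i, (-(c⁻¹ * a' i)) • W i) := by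
            rw [smul_sub, Finset.smul_sum]
            simp only [neg_smul, smul_neg, Finset.sum_neg_distrib, sub_neg_eq_add, smul_smul,
              mul_inv_cancel_left₀ hc0]
            rw [add_comm]
          rw [e, nrm_smul, nrm_smul]
          exact mul_le_mul_right this _
      have hB : nrm E v (∑ i, a' i • W i) ≤ nrm E v (∑ i, a' i • W i + c • z) := by
        have e := nrm_sub (E := E) v (∑ i, a' i • W i + c • z) (c • z)
        rw [add_sub_cancel_right] at e
        exact e.trans (max_le le_rfl hA)
      rintro (j | j)
      · exact (hw.2 a' (Sum.inl j)).trans hB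
      · refine Fin.lastCases ?_ (fun j => ?_) j
        · simp only [Sum.elim_inr, Fin.snoc_last]
          rw [← nrm_smul]; exact hA
        · simp only [Sum.elim_inr, Fin.snoc_castSucc]
          exact (hw.2 a' (Sum.inr j)).trans hB
    · intro j
      refine Fin.lastCases ?_ (fun j => ?_) j
      · simpa using hz
      · simpa using hwl j
  have happ : ∀ z : F, z ≠ 0 →
      ∃ a : Fin g.natDegree ⊕ Fin s → E, nrm E v (z - ∑ i, a i • W i) < nrm E v z := by
    intro z hz0
    rcases (v_le_nrm (E := E) v z).lt_or_eq with hlt | heq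
    · exact case1 z hlt
    · obtain ⟨a, ha⟩ := h.val z hz0
      have hvz : v (algebraMap F Ω z) ≠ 0 := by rw [v.ne_zero_iff]; simpa using hz0
      have ha0 : algebraMap E F a ≠ 0 := by
        intro h0
        rw [← vE (E := E) (F := F) v a, h0, map_zero, map_zero] at ha
        exact hvz ha
      obtain ⟨c, hc, hcl⟩ := h.gen (z / (algebraMap E F a * η)) (by
        rw [map_div₀, map_div₀, map_mul, map_mul, h.unit, mul_one, vE, ← ha, div_self hvz])
      let a1 : Fin g.natDegree ⊕ Fin s → E := Sum.elim (fun i => a * c i) fun _ => 0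
      have e1 : z - ∑ i, a1 i • W i = (algebraMap E F a * η) *
          (z / (algebraMap E F a * η) - ∑ i, c i • η ^ (i : ℕ)) := by
        rw [mul_sub, mul_div_cancel₀ _ (mul_ne_zero ha0 hη0), Fintype.sum_sum_type]
        simp only [a1, hW, Sum.elim_inl, Sum.elim_inr, zero_smul, Finset.sum_const_zero, add_zero]
        congr 1
        rw [Finset.mul_sum]
        refine Finset.sum_congr rfl fun i _ => ?_
        simp only [pw, Algebra.smul_def, map_mul]; ring
      have h1 : v (algebraMap F Ω (z - ∑ i, a1 i • W i)) < nrm E v z := by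
        rw [e1, map_mul, map_mul, map_mul, map_mul, h.unit, mul_one, vE, ← ha, ← heq]
        exact (mul_lt_of_lt_one_right (zero_lt_iff.2 hvz) hcl)
      have h2 : nrm E v (∑ i, a1 i • W i) ≤ nrm E v z := by
        refine nrm_sum_le v _ _ _ ?_
        rintro (i | i) -
        · simp only [a1, hW, Sum.elim_inl]
          rw [nrm_smul, map_mul, map_mul, ← ha, heq, mul_assoc]
          exact mul_le_of_le_one_right' (mul_le_one' (hc i) (hpn i))
        · simp [a1]
      have h3 : nrm E v (z - ∑ i, a1 i • W i) ≤ nrm E v z :=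
        (nrm_sub v _ _).trans (max_le le_rfl h2)
      rcases h3.lt_or_eq with hlt | heq'
      · exact ⟨a1, hlt⟩
      · obtain ⟨a2, ha2⟩ := case1 (z - ∑ i, a1 i • W i) (by rw [heq']; exact h1)
        refine ⟨fun i => a1 i + a2 i, ?_⟩
        have : z - ∑ i, (a1 i + a2 i) • W i = z - ∑ i, a1 i • W i - ∑ i, a2 i • W i := by
          simp only [add_smul, Finset.sum_add_distrib]; ring
        rw [this, ← heq']; exact ha2
  refine ⟨s, W, hw, hwl, le_antisymm ?_ ?_⟩
  · have := Orth.card_ge hf hw happ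
    simpa using this
  · have := hw.linInd.fintype_card_le_finrank
    simpa using this

theorem ResGen.charpoly_low [IsAlgClosed Ω] (hf : Frame L (v.comap (algebraMap E Ω)) x)
    {η : F} {g : Polynomial E} (h : ResGen E v η g) (hη : nrm E v η ≤ 1)
    (hl : ∀ z : F, v (algebraMap F Ω z) < nrm E v z → nrm E v (η * z) < nrm E v z) :
    ∃ s, Module.finrank E F = g.natDegree + s ∧
      LowMax v s ((Algebra.lmul E F η).charpoly.map (algebraMap E Ω)) := by
  classical
  obtain ⟨s, w, hw, hwl, hfin⟩ := h.exists_basis hf hη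
  refine ⟨s, hfin, ?_⟩
  haveI : Nonempty (Fin g.natDegree ⊕ Fin s) := Fintype.card_pos_iff.1 (by
    have : 0 < Module.finrank E F := Module.finrank_pos
    simpa [← hfin] using this)
  let b : Module.Basis (Fin g.natDegree ⊕ Fin s) E F :=
    basisOfLinearIndependentOfCardEqFinrank hw.linInd (by simp [hfin])
  have hb : ∀ i, b i = w i := fun i => by simp [b]
  have hd : ∀ j, ∃ d : Ω, v d = nrm E v (w j) := fun j => by
    obtain ⟨σ, hσ⟩ := exists_nrm (E := E) v (w j)
    exact ⟨_, hσ.symm⟩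
  choose d hd using hd
  have hd0 : ∀ j, d j ≠ 0 := fun j h0 => by
    have := hd j
    rw [h0, map_zero] at this
    exact (nrm_pos v (hw.1 j)).ne this
  set A := Algebra.leftMulMatrix b η with hA
  have hAv : ∀ i j, v (algebraMap E Ω (A i j)) * nrm E v (w i) ≤ nrm E v (η * w j) := by
    intro i j
    have h1 := hw.2 (fun i => A i j) i
    have h2 : ∑ i, A i j • w i = η * w j := by
      have := b.sum_repr (η * w j)
      rw [← this]
      refine Finset.sum_congr rfl fun i _ => ?_
      rw [hb, hA, Algebra.leftMulMatrix_eq_repr_mul, hb]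
    rwa [h2] at h1
  let B : Matrix (Fin g.natDegree ⊕ Fin s) (Fin g.natDegree ⊕ Fin s) Ω :=
    Matrix.diagonal d * A.map (algebraMap E Ω) * Matrix.diagonal fun i => (d i)⁻¹
  have hBe : ∀ i j, B i j = d i * algebraMap E Ω (A i j) * (d j)⁻¹ := by
    intro i j
    simp [B, Matrix.mul_diagonal, Matrix.diagonal_mul]
  have hBc : B.charpoly = (Algebra.lmul E F η).charpoly.map (algebraMap E Ω) := by
    have h1 : (Algebra.lmul E F η).charpoly = A.charpoly := by
      rw [hA, Algebra.leftMulMatrix_apply, LinearMap.charpoly_toMatrix]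
    rw [h1, ← Matrix.charpoly_map]
    have hu : Matrix.diagonal d * Matrix.diagonal (fun i => (d i)⁻¹) = 1 := by
      rw [Matrix.diagonal_mul_diagonal, ← Matrix.diagonal_one]
      congr 1; funext i; exact mul_inv_cancel₀ (hd0 i)
    have hu' : Matrix.diagonal (fun i => (d i)⁻¹) * Matrix.diagonal d = 1 := by
      rw [Matrix.diagonal_mul_diagonal, ← Matrix.diagonal_one]
      congr 1; funext i; exact inv_mul_cancel₀ (hd0 i)
    let M : (Matrix (Fin g.natDegree ⊕ Fin s) (Fin g.natDegree ⊕ Fin s) Ω)ˣ :=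
      ⟨Matrix.diagonal d, Matrix.diagonal fun i => (d i)⁻¹, hu, hu'⟩
    have hM := Matrix.charpoly_units_conj M (A.map (algebraMap E Ω))
    rw [← Matrix.coe_units_inv] at hM
    exact hM
  rw [← hBc]
  have hpos : ∀ j, 0 < nrm E v (w j) := fun j => nrm_pos v (hw.1 j)
  have := LowMax.charpoly v B (Sum.elim (fun _ => 0) fun _ => 1) (by rintro (i | i) <;> simp) ?_ ?_
  · simpa using this
  · intro i j
    rw [hBe, map_mul, map_mul, map_inv₀, hd, hd, mul_comm (nrm E v (w i)), ← div_eq_mul_inv,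
      div_le_one₀ (hpos j)]
    exact (hAv i j).trans ((nrm_mul v _ _).trans (mul_le_of_le_one_left' hη))
  · rintro i (j | j) hj
    · simp at hj
    · rw [hBe, map_mul, map_mul, map_inv₀, hd, hd, mul_comm (nrm E v (w i)), ← div_eq_mul_inv,
        div_lt_one₀ (hpos _)]
      exact (hAv i _).trans_lt (hl _ (hwl j))

theorem ResGen.charpoly_der [IsAlgClosed Ω] (hf : Frame L (v.comap (algebraMap E Ω)) x)
    {η : F} {g : Polynomial E} (h : ResGen E v η g) (hη : nrm E v η ≤ 1)
    (hl : ∀ z : F, v (algebraMap F Ω z) < nrm E v z → nrm E v (η * z) < nrm E v z) :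
    v (algebraMap F Ω (Polynomial.aeval η
      (Polynomial.derivative (Algebra.lmul E F η).charpoly))) = 1 := by
  classical
  obtain ⟨s, hfin, hlow⟩ := h.charpoly_low hf hη hl
  set p := (Algebra.lmul E F η).charpoly with hp
  have hpm : p.Monic := LinearMap.charpoly_monic _
  have hdeg : p.natDegree = g.natDegree + s := by rw [← hfin]; exact LinearMap.charpoly_natDegree _
  have hpc : ∀ i, v (algebraMap E Ω (p.coeff i)) ≤ 1 := fun i => by
    rw [← Polynomial.coeff_map]; exact hlow.1 i
  have hps : ∀ i < s, v (algebraMap E Ω (p.coeff i)) < 1 := fun i hi => by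
    rw [← Polynomial.coeff_map]; exact hlow.2 i hi
  have hp0 : Polynomial.aeval η p = 0 := by
    rw [hp, charpoly_eq_pow, map_pow, minpoly.aeval, zero_pow Module.finrank_pos.ne']
  have hvη := h.unit
  have hlt : ∀ (q : Polynomial E), (∀ i, v (algebraMap E Ω (q.coeff i)) < 1) →
      v (algebraMap F Ω (Polynomial.aeval η q)) < 1 := by
    intro q hq
    rw [Polynomial.aeval_eq_sum_range, map_sum]
    refine v.map_sum_lt one_ne_zero fun i _ => ?_
    rw [Algebra.smul_def, map_mul, map_mul, map_pow, map_pow, hvη, one_pow, mul_one, vE]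
    exact hq i
  have hdiff : ∀ i : Fin g.natDegree, v (algebraMap E Ω (p.coeff (i + s) - g.coeff i)) < 1 := by
    apply h.ind
    · intro i
      rw [map_sub]
      exact (v.map_sub _ _).trans (max_le (hpc _) (h.coeff _))
    · have e1 : ∑ i ∈ Finset.range s, p.coeff i • η ^ i + η ^ s *
          (∑ i : Fin g.natDegree, p.coeff (i + s) • η ^ (i : ℕ) + η ^ g.natDegree) = 0 := by
        rw [Polynomial.aeval_eq_sum_range, hdeg, show g.natDegree + s + 1 = s + (g.natDegree + 1) by ring,
          Finset.sum_range_add, Finset.sum_range_succ] at hp0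
        rw [← hp0]
        congr 1
        rw [mul_add, Finset.mul_sum, Finset.sum_range]
        congr 1
        · refine Finset.sum_congr rfl fun i _ => ?_
          rw [add_comm s, Algebra.smul_def, Algebra.smul_def]; ring
        · rw [add_comm s, ← hdeg, hpm.coeff_natDegree, one_smul, hdeg]; ring
      have e2 : v (algebraMap F Ω
          (∑ i : Fin g.natDegree, p.coeff (i + s) • η ^ (i : ℕ) + η ^ g.natDegree)) < 1 := by
        have h1 : v (algebraMap F Ω (η ^ s *
          (∑ i : Fin g.natDegree, p.coeff (i + s) • η ^ (i : ℕ) + η ^ g.natDegree))) < 1 := by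
          rw [eq_neg_of_add_eq_zero_right e1, map_neg, Valuation.map_neg, map_sum]
          refine v.map_sum_lt one_ne_zero fun i hi => ?_
          rw [Algebra.smul_def, map_mul, map_mul, map_pow, map_pow, hvη, one_pow, mul_one, vE]
          exact hps i (Finset.mem_range.1 hi)
        rwa [map_mul, map_mul, map_pow, map_pow, hvη, one_pow, one_mul] at h1
      have e3 : ∑ i : Fin g.natDegree, (p.coeff (i + s) - g.coeff i) • η ^ (i : ℕ) =
          (∑ i : Fin g.natDegree, p.coeff (i + s) • η ^ (i : ℕ) + η ^ g.natDegree)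
          - Polynomial.aeval η g := by
        rw [Polynomial.aeval_eq_sum_range, Finset.sum_range_succ, h.monic.coeff_natDegree, one_smul,
          Finset.sum_range]
        simp only [sub_smul, Finset.sum_sub_distrib]
        ring
      rw [e3, map_sub]
      exact (v.map_sub _ _).trans_lt (max_lt e2 h.root)
  have hD : ∀ i, v (algebraMap E Ω ((p - Polynomial.X ^ s * g).coeff i)) < 1 := by
    intro i
    rw [Polynomial.coeff_sub, Polynomial.coeff_X_pow_mul']
    split_ifs with his
    · rcases Nat.lt_trichotomy (i - s) g.natDegree with hi | hi | hi
      · have := hdiff ⟨i - s, hi⟩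
        simp only [Nat.sub_add_cancel his] at this
        exact this
      · rw [hi, h.monic.coeff_natDegree, show i = p.natDegree by omega, hpm.coeff_natDegree]
        simp
      · rw [Polynomial.coeff_eq_zero_of_natDegree_lt hi,
          Polynomial.coeff_eq_zero_of_natDegree_lt (show p.natDegree < i by omega)]
        simp
    · rw [sub_zero]; exact hps i (by omega)
  have hD' : v (algebraMap F Ω (Polynomial.aeval η
      (Polynomial.derivative (p - Polynomial.X ^ s * g)))) < 1 := by
    apply hlt
    intro i
    rw [Polynomial.coeff_derivative, map_mul, map_mul]
    have : algebraMap E Ω ((i : E) + 1) = ((i + 1 : ℕ) : Ω) := by push_cast; simp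
    rw [this]
    exact (mul_le_of_le_one_right' ((v.mem_integer_iff _).1
      (natCast_mem v.integer (i + 1)))).trans_lt (hD _)
  rw [Polynomial.derivative_sub, map_sub, map_sub] at hD'
  refine eq_one_of_sub_lt v hD' ?_
  rw [Polynomial.derivative_mul, map_add, map_mul, map_mul, map_add]
  have hr : v (algebraMap F Ω (Polynomial.aeval η (Polynomial.X ^ s : Polynomial E) *
      Polynomial.aeval η (Polynomial.derivative g))) = 1 := by
    rw [map_pow, Polynomial.aeval_X, map_mul, map_mul, map_pow, map_pow, hvη, h.der, one_pow, one_mul]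
  rw [v.map_add_eq_of_lt_right, hr]
  rw [hr, map_mul, map_mul]
  refine (mul_le_of_le_one_left' ?_).trans_lt h.root
  rw [Polynomial.derivative_X_pow, map_mul, Polynomial.aeval_C, map_pow, Polynomial.aeval_X,
    map_mul, map_mul, map_pow, map_pow, hvη, one_pow, mul_one, vE, map_natCast]
  exact (v.mem_integer_iff _).1 (natCast_mem v.integer s)

theorem ResGen.main [IsAlgClosed Ω] (hf : Frame L (v.comap (algebraMap E Ω)) x)
    {α : F} {g : Polynomial E} (h : ResGen E v α g) :
    ∃ η : F, v (algebraMap F Ω η) = 1 ∧ nrm E v η ≤ 1 ∧ IntermediateField.adjoin E {η} = ⊤ ∧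
      (∀ i, v (algebraMap E Ω ((minpoly E η).coeff i)) ≤ 1) ∧
      v (algebraMap F Ω (Polynomial.aeval η (Polynomial.derivative (minpoly E η)))) = 1 := by
  obtain ⟨η, hη, hn, hl⟩ := h.exists_eta
  have hd := hη.charpoly_der hf hn hl
  have hint : IsIntegral E η := Algebra.IsIntegral.isIntegral η
  have h1 : Module.finrank (IntermediateField.adjoin E {η}) F = 1 := by
    by_contra hne
    have hpos : 0 < Module.finrank (IntermediateField.adjoin E {η}) F := Module.finrank_pos
    rw [charpoly_eq_pow, Polynomial.derivative_pow] at hd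
    simp only [map_mul, map_pow, minpoly.aeval, map_zero] at hd
    rw [zero_pow (show Module.finrank (IntermediateField.adjoin E {η}) F - 1 ≠ 0 by omega)] at hd
    simp at hd
  have h2 : (Algebra.lmul E F η).charpoly = minpoly E η := by
    rw [charpoly_eq_pow, h1, pow_one]
  rw [h2] at hd
  refine ⟨η, hη.unit, hn, ?_, ?_, hd⟩
  · exact IntermediateField.finrank_eq_one_iff_eq_top.1 h1
  · intro i
    rw [← h2]; exact charpoly_coeff_le v hn i

end

end LU

namespace LU

variable {Γ₀ : Type*} [LinearOrderedCommGroupWithZero Γ₀]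

section

variable {E F Ω : Type*} [Field E] [Field F] [Field Ω] [Algebra E F]
  [Algebra E Ω] [Algebra F Ω]
  [IsScalarTower E F Ω] [FiniteDimensional E F] {v : Valuation Ω Γ₀}

theorem trace_le [IsAlgClosed Ω] {z : F} (hz : nrm E v z ≤ 1) :
    v (algebraMap E Ω (Algebra.trace E F z)) ≤ 1 := by
  classical
  have b := Module.finBasis E F
  haveI : Nonempty (Fin (Module.finrank E F)) := ⟨⟨0, Module.finrank_pos⟩⟩
  have h := charpoly_coeff_le v hz (Fintype.card (Fin (Module.finrank E F)) - 1)
  rw [Algebra.trace_eq_matrix_trace b, Matrix.trace_eq_neg_charpoly_coeff, map_neg,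
    Valuation.map_neg, Algebra.leftMulMatrix_apply, LinearMap.charpoly_toMatrix]
  exact h

theorem exists_poly_of_nrm_le [IsAlgClosed Ω] {η : F} (hη : nrm E v η ≤ 1)
    (htop : IntermediateField.adjoin E {η} = ⊤)
    (hc : ∀ i, v (algebraMap E Ω ((minpoly E η).coeff i)) ≤ 1)
    (hd : v (algebraMap F Ω (Polynomial.aeval η (Polynomial.derivative (minpoly E η)))) = 1)
    {b : F} (hb : nrm E v b ≤ 1) :
    ∃ p : Polynomial E, (∀ i, v (algebraMap E Ω (p.coeff i)) ≤ 1) ∧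
      Polynomial.aeval η p =
        Polynomial.aeval η (Polynomial.derivative (minpoly E η)) * b := by
  have hint : IsIntegral E η := Algebra.IsIntegral.isIntegral η
  have hd0 : Polynomial.aeval η (Polynomial.derivative (minpoly E η)) ≠ 0 := by
    intro h0; rw [h0] at hd; simp at hd
  have hsep : IsSeparable E η := by
    rw [IsSeparable, Polynomial.separable_iff_derivative_ne_zero (minpoly.irreducible hint)]
    intro h0; rw [h0] at hd0; simp at hd0
  haveI : Algebra.IsSeparable E F := by
    have := (IntermediateField.isSeparable_adjoin_simple_iff_isSeparable E F).2 hsep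
    rw [htop] at this
    exact AlgEquiv.Algebra.isSeparable (IntermediateField.topEquiv (F := E) (E := F))
  let A := (v.comap (algebraMap E Ω)).valuationSubring
  have hA : ∀ a : E, a ∈ A ↔ v (algebraMap E Ω a) ≤ 1 := fun a => Iff.rfl
  have hx : Algebra.adjoin E {η} = ⊤ := by
    rw [← IntermediateField.adjoin_simple_toSubalgebra_of_isAlgebraic hint.isAlgebraic, htop]
    rfl
  have hsub : (((minpoly E η).coeffs : Set E)) ⊆ A.toSubring := by
    intro c hc'
    obtain ⟨i, -, rfl⟩ := Polynomial.mem_coeffs_iff.1 hc'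
    exact hc i
  have hAx : IsIntegral A η := by
    refine ⟨(minpoly E η).toSubring A.toSubring hsub, ?_, ?_⟩
    · exact (Polynomial.monic_toSubring _ _ _).2 (minpoly.monic hint)
    · have h1 := Polynomial.map_toSubring (minpoly E η) A.toSubring hsub
      have h2 := minpoly.aeval E η
      rw [← h1, Polynomial.aeval_def, Polynomial.eval₂_map] at h2
      exact h2
  have key := traceForm_dualSubmodule_adjoin A E hx hAx
  have hmem : b ∈ (Algebra.traceForm E F).dualSubmodule
      (Subalgebra.toSubmodule (Algebra.adjoin A {η})) := by
    intro y hy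
    have hny : nrm E v y ≤ 1 := by
      rw [Subalgebra.mem_toSubmodule] at hy
      refine nrm_le v fun σ => ?_
      induction hy using Algebra.adjoin_induction with
      | mem x hx =>
        rw [Set.mem_singleton_iff] at hx
        rw [hx]; exact (le_nrm v σ η).trans hη
      | algebraMap r =>
        have : σ (algebraMap A F r) = algebraMap E Ω r := σ.commutes _
        rw [this]; exact r.2
      | add x y _ _ hx hy => rw [map_add]; exact (v.map_add _ _).trans (max_le hx hy)
      | mul x y _ _ hx hy => rw [map_mul, map_mul]; exact mul_le_one' hx hy
    rw [Algebra.traceForm_apply]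
    have := trace_le (E := E) (v := v) (z := b * y) ((nrm_mul v _ _).trans (mul_le_one' hb hny))
    exact Submodule.mem_one.2 ⟨⟨_, this⟩, rfl⟩
  rw [key] at hmem
  obtain ⟨y, hy, hyb⟩ := Submodule.mem_smul_pointwise_iff_exists _ _ _ |>.1 hmem
  rw [Subalgebra.mem_toSubmodule, Algebra.adjoin_singleton_eq_range_aeval] at hy
  obtain ⟨q, hq⟩ := hy
  refine ⟨q.map (algebraMap A E), fun i => ?_, ?_⟩
  · rw [Polynomial.coeff_map]; exact (q.coeff i).2
  · have h3 : Polynomial.aeval η (q.map (algebraMap A E)) = y := by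
      rw [← hq]; exact Polynomial.aeval_map_algebraMap E η q
    rw [h3, ← hyb, smul_eq_mul, mul_inv_cancel_left₀ hd0]

theorem exists_num_den [IsAlgClosed Ω] {η : F} (hη : nrm E v η ≤ 1)
    (htop : IntermediateField.adjoin E {η} = ⊤)
    (hc : ∀ i, v (algebraMap E Ω ((minpoly E η).coeff i)) ≤ 1)
    (hd : v (algebraMap F Ω (Polynomial.aeval η (Polynomial.derivative (minpoly E η)))) = 1)
    {ζ : F} (hζ : v (algebraMap F Ω ζ) ≤ 1) :
    ∃ g h : Polynomial E, (∀ i, v (algebraMap E Ω (g.coeff i)) ≤ 1) ∧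
      (∀ i, v (algebraMap E Ω (h.coeff i)) ≤ 1) ∧
      ζ * Polynomial.aeval η h = Polynomial.aeval η g ∧
      v (algebraMap F Ω (Polynomial.aeval η h)) = 1 := by
  obtain ⟨d, -, hd1, hd2, hτ⟩ := exists_den (E := E) v ζ
  have hvd : v (algebraMap F Ω d) = 1 := (hτ (IsScalarTower.toAlgHom E F Ω)).1 hζ
  obtain ⟨g, hg, hg'⟩ := exists_poly_of_nrm_le hη htop hc hd hd2
  obtain ⟨h, hh, hh'⟩ := exists_poly_of_nrm_le hη htop hc hd hd1
  refine ⟨g, h, hg, hh, ?_, ?_⟩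
  · rw [hg', hh']; ring
  · rw [hh', map_mul, map_mul, hd, hvd, one_mul]

end

end LU

namespace LU

section perron

variable {A : Type*} [AddCommGroup A] {Pos : A → Prop}

theorem pos_sum (hadd : ∀ a b, Pos a → Pos b → Pos (a + b)) {ι : Type*} [Fintype ι]
    (g : ι → A) (hg : ∀ k, Pos (g k)) (c : ι → ℤ) (hc : ∀ k, 0 ≤ c k) (i : ι) (hi : 0 < c i) :
    Pos (∑ k, c k • g k) := by
  classical
  have hn : ∀ (n : ℕ) a, Pos a → Pos ((n + 1) • a) := by
    intro n a ha
    induction n with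
    | zero => simpa using ha
    | succ n ih => rw [succ_nsmul]; exact hadd _ _ ih ha
  have hz : ∀ k, c k • g k = 0 ∨ Pos (c k • g k) := by
    intro k
    rcases (hc k).eq_or_lt with h | h
    · left; rw [← h, zero_smul]
    · right
      obtain ⟨n, hn'⟩ := Int.eq_succ_of_zero_lt h
      rw [hn']
      have := hn n (g k) (hg k)
      rwa [← natCast_zsmul] at this
  have hz2 : ∀ s : Finset ι, ∑ k ∈ s, c k • g k = 0 ∨ Pos (∑ k ∈ s, c k • g k) := by
    intro s
    induction s using Finset.induction_on with
    | empty => left; simp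
    | insert a s ha ih =>
      rw [Finset.sum_insert ha]
      rcases hz a with h | h <;> rcases ih with h' | h'
      · left; rw [h, h', add_zero]
      · right; rwa [h, zero_add]
      · right; rwa [h', add_zero]
      · right; exact hadd _ _ h h'
  have hi' : Pos (c i • g i) := by
    obtain ⟨n, hn'⟩ := Int.eq_succ_of_zero_lt hi
    rw [hn']
    have := hn n (g i) (hg i)
    rwa [← natCast_zsmul] at this
  rw [← Finset.add_sum_erase _ _ (Finset.mem_univ i)]
  rcases hz2 (Finset.univ.erase i) with h | h
  · rwa [h, add_zero]
  · exact hadd _ _ hi' h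

theorem dom_trans {ι ι' ι'' : Type*} {g : ι → A} {g' : ι' → A} {g'' : ι'' → A}
    (h : ∀ k, g k ∈ AddSubmonoid.closure (Set.range g'))
    (h' : ∀ k, g' k ∈ AddSubmonoid.closure (Set.range g'')) (k : ι) :
    g k ∈ AddSubmonoid.closure (Set.range g'') := by
  refine (AddSubmonoid.closure_le.2 ?_ : AddSubmonoid.closure (Set.range g') ≤ _) (h k)
  rintro _ ⟨k, rfl⟩
  exact h' k

def gsub {ι : Type*} [DecidableEq ι] (g : ι → A) (i j : ι) : ι → A := g - Pi.single i (g j)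

def cadd {ι : Type*} [DecidableEq ι] (c : ι → ℤ) (j i : ι) : ι → ℤ := c + Pi.single j (c i)

theorem dom_sub {ι : Type*} [DecidableEq ι] (g : ι → A) {i j : ι} (hij : i ≠ j) (k : ι) :
    g k ∈ AddSubmonoid.closure (Set.range (gsub g i j)) := by
  have hj : ∀ k ≠ i, g k ∈ AddSubmonoid.closure (Set.range (gsub g i j)) := by
    intro k hk
    refine AddSubmonoid.subset_closure ⟨k, ?_⟩
    simp [gsub, hk]
  by_cases hk : k = i
  · subst hk
    have h1 : (gsub g k j) k ∈
      AddSubmonoid.closure (Set.range (gsub g k j)) :=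
        AddSubmonoid.subset_closure ⟨k, rfl⟩
    have := add_mem h1 (hj j hij.symm)
    simpa [gsub] using this
  · exact hj k hk

theorem sum_sub_single {ι : Type*} [Fintype ι] [DecidableEq ι] (g : ι → A) (c : ι → ℤ) {i j : ι}
    (hij : i ≠ j) :
    ∑ k, (cadd c j i) k • (gsub g i j) k = ∑ k, c k • g k := by
  have : ∀ k, (cadd c j i) k • (gsub g i j) k =
      c k • g k - (if k = i then c i • g j else 0) + (if k = j then c i • g j else 0) := by
    intro k
    by_cases h1 : k = i
    · subst h1
      simp [gsub, cadd, hij, smul_sub]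
    · by_cases h2 : k = j
      · subst h2
        simp [gsub, cadd, h1, add_smul]
      · simp [gsub, cadd, h1, h2]
  simp only [this, Finset.sum_add_distrib, Finset.sum_sub_distrib]
  simp

theorem perron_drop (hadd : ∀ a b, Pos a → Pos b → Pos (a + b)) (h0 : ¬ Pos 0)
    (htot : ∀ a, a ≠ 0 → Pos a ∨ Pos (-a)) {n : ℕ} (M N : ℕ) :
    ∀ (g : Fin (n + 1) → A) (c : Fin (n + 1) → ℤ), (∀ k, Pos (g k)) → ∑ k, c k • g k = 0 →
      c ≠ 0 → (∀ k, |c k| ≤ M) → (Finset.univ.filter fun k => |c k| = M).card ≤ N →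
      ∃ g' : Fin n → A, (∀ k, Pos (g' k)) ∧
        ∀ k, g k ∈ AddSubmonoid.closure (Set.range g') := by
  classical
  induction M generalizing N with
  | zero =>
    intro g c _ _ hc hM
    exact absurd (funext fun k => by simpa using hM k) hc
  | succ M ihM =>
    have hnone : ∀ (g : Fin (n + 1) → A) (c : Fin (n + 1) → ℤ), (∀ k, Pos (g k)) →
      ∑ k, c k • g k = 0 →
      c ≠ 0 → (∀ k, |c k| ≤ (M + 1 : ℕ)) → (∀ k, |c k| ≠ (M + 1 : ℕ)) →
      ∃ g' : Fin n → A, (∀ k, Pos (g' k)) ∧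
        ∀ k, g k ∈ AddSubmonoid.closure (Set.range g') := by
      intro g c hg hs hc hM hne
      refine ihM _ g c hg hs hc (fun k => ?_) le_rfl
      have h1 := hM k
      have h2 := hne k
      push_cast at *
      omega
    induction N with
    | zero =>
      intro g c hg hs hc hM hN
      refine hnone g c hg hs hc hM fun k hk => ?_
      have := Finset.card_eq_zero.1 (Nat.le_zero.1 hN)
      have hk' : k ∈ Finset.univ.filter fun k => |c k| = ((M + 1 : ℕ) : ℤ) := by simp [hk]
      rw [this] at hk'; simp at hk'
    | succ N ihN =>
      have key : ∀ (m : ℕ) (g : Fin (n + 1) → A) (c : Fin (n + 1) → ℤ) (i : Fin (n + 1)),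
        (∀ k, Pos (g k)) → ∑ k, c k • g k = 0 → c i = (M + 1 : ℕ) →
        (∀ k, |c k| ≤ (M + 1 : ℕ)) →
        (Finset.univ.filter fun k => |c k| = (M + 1 : ℕ)).card ≤ N + 1 →
        (Finset.univ.filter fun k => c k < 0).card ≤ m →
        ∃ g' : Fin n → A, (∀ k, Pos (g' k)) ∧
          ∀ k, g k ∈ AddSubmonoid.closure (Set.range g') := by
        intro m
        induction m with
        | zero =>
          intro g c i hg hs hi hM hN hm
          exfalso
          have hnn : ∀ k, 0 ≤ c k := by
            intro k
            by_contra hk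
            push Not at hk
            have := Finset.card_eq_zero.1 (Nat.le_zero.1 hm)
            have hk' : k ∈ Finset.univ.filter fun k => c k < 0 := by simp [hk]
            rw [this] at hk'; simp at hk'
          have := pos_sum hadd g hg c hnn i (by rw [hi]; positivity)
          rw [hs] at this
          exact h0 this
        | succ m ihm =>
          intro g c i hg hs hi hM hN hm
          by_cases hex : ∃ j, c j < 0
          swap
          · push Not at hex
            exfalso
            have := pos_sum hadd g hg c hex i (by rw [hi]; positivity)
            rw [hs] at this
            exact h0 this
          obtain ⟨j, hj⟩ := hex
          have hij : i ≠ j := by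
            rintro rfl; rw [hi] at hj; omega
          have hMj := hM j
          rw [abs_of_neg hj] at hMj
          by_cases heq : g i = g j
          · refine ⟨fun k => g (j.succAbove k), fun k => hg _, fun k => ?_⟩
            refine AddSubmonoid.subset_closure ?_
            by_cases hk : k = j
            · obtain ⟨l, hl⟩ := Fin.exists_succAbove_eq hij
              exact ⟨l, by simp only [hl]; rw [hk, heq]⟩
            · obtain ⟨l, hl⟩ := Fin.exists_succAbove_eq hk
              exact ⟨l, by simp only [hl]⟩
          rcases htot (g j - g i) (sub_ne_zero.2 (Ne.symm heq)) with hp | hp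
          · have hpos : ∀ k, Pos ((gsub g j i) k) := by
              intro k
              by_cases hk : k = j
              · subst hk; simpa [gsub] using hp
              · simpa [gsub, hk] using hg k
            have hci : ∀ k, (cadd c i j) k = if k = i then c i + c j else c k := by
              intro k; by_cases hk : k = i
              · subst hk; simp [cadd]
              · simp [cadd, hk]
            have hcabs : |c i + c j| < (M + 1 : ℕ) := by
              rw [hi] at *; rw [abs_lt]; push_cast at *; constructor <;> omega
            obtain ⟨g', hg', hd⟩ := ihN (gsub g j i) (cadd c i j) hpos
              (by rw [sum_sub_single g c hij.symm, hs])
              (by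
                intro h
                have := congrFun h j
                rw [hci, if_neg hij.symm] at this
                simp at this; omega)
              (by
                intro k
                rw [hci]; split_ifs
                · exact hcabs.le
                · exact hM k)
              (by
                refine Nat.lt_succ_iff.1 (lt_of_lt_of_le (Finset.card_lt_card ?_) hN)
                refine Finset.ssubset_iff_of_subset ?_ |>.2 ⟨i, ?_, ?_⟩
                · intro k
                  simp only [Finset.mem_filter, Finset.mem_univ, true_and, hci]
                  split_ifs
                  · intro h; exact absurd h hcabs.ne
                  · exact id
                · simp only [Finset.mem_filter, Finset.mem_univ, true_and, hi]
                  exact abs_of_nonneg (by positivity)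
                · simp only [Finset.mem_filter, Finset.mem_univ, true_and, hci, if_true]
                  exact hcabs.ne)
            exact ⟨g', hg', dom_trans (dom_sub g hij.symm) hd⟩
          · rw [neg_sub] at hp
            have hpos : ∀ k, Pos ((gsub g i j) k) := by
              intro k
              by_cases hk : k = i
              · subst hk; simpa [gsub] using hp
              · simpa [gsub, hk] using hg k
            have hci : ∀ k, (cadd c j i) k = if k = j then c i + c j else c k := by
              intro k; by_cases hk : k = j
              · subst hk; simp [cadd, add_comm]
              · simp [cadd, hk]
            have hcabs : |c i + c j| < (M + 1 : ℕ) := by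
              rw [hi] at *; rw [abs_lt]; push_cast at *; constructor <;> omega
            have hcnn : 0 ≤ c i + c j := by rw [hi]; push_cast at *; omega
            obtain ⟨g', hg', hd⟩ := ihm (gsub g i j) (cadd c j i) i hpos
              (by rw [sum_sub_single g c hij, hs])
              (by rw [hci, if_neg hij, hi])
              (by
                intro k
                rw [hci]; split_ifs
                · exact hcabs.le
                · exact hM k)
              (by
                refine (Finset.card_le_card ?_).trans hN
                intro k
                simp only [Finset.mem_filter, Finset.mem_univ, true_and, hci]
                split_ifs
                · intro h; exact absurd h hcabs.ne
                · exact id)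
              (by
                refine Nat.lt_succ_iff.1 (lt_of_lt_of_le (Finset.card_lt_card ?_) hm)
                refine Finset.ssubset_iff_of_subset ?_ |>.2 ⟨j, ?_, ?_⟩
                · intro k
                  simp only [Finset.mem_filter, Finset.mem_univ, true_and, hci]
                  split_ifs
                  · intro h; omega
                  · exact id
                · simpa using hj
                · simp only [Finset.mem_filter, Finset.mem_univ, true_and, hci, if_true]
                  omega)
            exact ⟨g', hg', dom_trans (dom_sub g hij) hd⟩
      intro g c hg hs hc hM hN
      by_cases hex : ∃ i, |c i| = ((M + 1 : ℕ) : ℤ)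
      · obtain ⟨i, hi⟩ := hex
        rcases abs_choice (c i) with h | h
        · exact key _ g c i hg hs (h ▸ hi) hM hN le_rfl
        · refine key _ g (-c) i hg ?_ ?_ ?_ ?_ le_rfl
          · simp [hs]
          · rw [Pi.neg_apply, ← h, hi]
          · intro k; rw [Pi.neg_apply, abs_neg]; exact hM k
          · simpa only [Pi.neg_apply, abs_neg] using hN
      · push Not at hex
        exact hnone g c hg hs hc hM hex

theorem perron (hadd : ∀ a b, Pos a → Pos b → Pos (a + b)) (h0 : ¬ Pos 0)
    (htot : ∀ a, a ≠ 0 → Pos a ∨ Pos (-a)) (n : ℕ) (g : Fin n → A) (hg : ∀ k, Pos (g k)) :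
    ∃ (l : ℕ) (b : Fin l → A), LinearIndependent ℤ b ∧ (∀ k, Pos (b k)) ∧
        ∀ k, g k ∈ AddSubmonoid.closure (Set.range b) := by
  induction n with
  | zero => exact ⟨0, Fin.elim0, linearIndependent_empty_type, fun k => k.elim0, fun k => k.elim0⟩
  | succ n ih =>
    by_cases hli : LinearIndependent ℤ g
    · exact ⟨_, g, hli, hg, fun k => AddSubmonoid.subset_closure ⟨k, rfl⟩⟩
    · rw [Fintype.linearIndependent_iff] at hli
      push Not at hli
      obtain ⟨c, hs, i, hi⟩ := hli
      obtain ⟨g', hg', hd⟩ := perron_drop hadd h0 htot (∑ k, (c k).natAbs) _ g c hg hs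
        (fun h => hi (by rw [h]; rfl)) (fun k => by
          rw [Int.abs_eq_natAbs]
          exact_mod_cast Finset.single_le_sum (f := fun k => (c k).natAbs)
            (fun _ _ => Nat.zero_le _) (Finset.mem_univ k)) le_rfl
      obtain ⟨l, b, hb, hb', hd'⟩ := ih g' hg'
      exact ⟨l, b, hb, hb', dom_trans hd hd'⟩

end perron

end LU

namespace LU

variable {Γ₀ : Type*} [LinearOrderedCommGroupWithZero Γ₀]

section

variable {L E : Type*} [Field L] [Field E] [Algebra L E] {v : Valuation E Γ₀}
  {ρ : ℕ} {x : Fin ρ → E}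

theorem Frame.span_le (h : Frame L v x) {p : E} (hp : p ∈ Submodule.span L (Set.range (mon x)))
    (hv : v p ≤ 1) : ∃ S : Finset (Fin ρ → ℤ), (∀ e ∈ S, v (mon x e) ≤ 1) ∧
      p ∈ Submodule.span L (mon x '' S) := by
  classical
  obtain ⟨c, rfl⟩ := Finsupp.mem_span_range_iff_exists_finsupp.1 hp
  have e1 := Finset.sum_filter_add_sum_filter_not c.support (fun e => v (mon x e) ≤ 1)
    (fun e => c e • mon x e)
  rw [Finsupp.sum, ← e1] at hv ⊢
  set S := c.support.filter fun e => v (mon x e) ≤ 1 with hS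
  set T := c.support.filter fun e => ¬ v (mon x e) ≤ 1 with hT
  have h1 : v (∑ e ∈ S, c e • mon x e) ≤ 1 := by
    refine v.map_sum_le fun e he => ?_
    have he := Finset.mem_filter.1 he
    rw [Algebra.smul_def, h.lt_val (Finsupp.mem_support_iff.1 he.1)]
    exact he.2
  have hTe : T = ∅ := by
    by_contra hne
    obtain ⟨u, hu⟩ := Finset.nonempty_iff_ne_empty.2 hne
    obtain ⟨e, he, hce, -, h2⟩ := h.lead_sum T c ⟨u, hu, Finsupp.mem_support_iff.1
      (Finset.mem_filter.1 hu).1⟩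
    simp only [← Algebra.smul_def] at h2
    have h3 : 1 < v (∑ e ∈ T, c e • mon x e) := by
      rw [h2]; exact not_le.1 (Finset.mem_filter.1 he).2
    rw [v.map_add_eq_of_lt_right (h1.trans_lt h3)] at hv
    exact absurd h3 (not_lt.2 hv)
  refine ⟨S, fun e he => (Finset.mem_filter.1 he).2, ?_⟩
  rw [hTe, Finset.sum_empty, add_zero]
  exact Submodule.sum_mem _ fun e he => Submodule.smul_mem _ _ (Submodule.subset_span ⟨e, he, rfl⟩)

theorem Frame.mul_mon_span (h : Frame L v x) {p : E}
    (hp : p ∈ Submodule.span L (Set.range (mon x))) (e : Fin ρ → ℤ) :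
    p * mon x e ∈ Submodule.span L (Set.range (mon x)) :=
  span_mon_mul h.x_ne (Submodule.mul_mem_mul hp (Submodule.subset_span ⟨e, rfl⟩))

theorem Frame.int_form (h : Frame L v x) {a : E} (ha : v a ≤ 1) :
    ∃ (S : Finset (Fin ρ → ℤ)) (p q : E), (∀ e ∈ S, v (mon x e) ≤ 1) ∧
      p ∈ Submodule.span L (mon x '' S) ∧ q ∈ Submodule.span L (mon x '' S) ∧ v q = 1 ∧
      a * q = p := by
  classical
  obtain ⟨r, hr, s, hs, rfl⟩ := IntermediateField.mem_adjoin_iff_div.1 (h.gen a)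
  have hr := adjoin_le_span h.x_ne hr
  have hs := adjoin_le_span h.x_ne hs
  by_cases hs0 : s = 0
  · subst hs0
    refine ⟨{0}, 0, 1, ?_, Submodule.zero_mem _, Submodule.subset_span ⟨0, ?_, mon_zero⟩, ?_, ?_⟩
    · intro e he; rw [Finset.mem_singleton] at he; rw [he, mon_zero, map_one]
    · simp
    · simp
    · simp
  obtain ⟨e, c, hc, -, h2⟩ := h.hasLT_span hs hs0
  have hm := mon_ne h.x_ne (-e)
  have hq : v (s * mon x (-e)) = 1 := by
    rw [map_mul, h2, ← map_mul, ← mon_add h.x_ne, add_neg_cancel, mon_zero, map_one]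
  have hpq : r / s * (s * mon x (-e)) = r * mon x (-e) := by field_simp
  have hp : v (r * mon x (-e)) ≤ 1 := by
    rw [← hpq, map_mul, hq, mul_one]; exact ha
  obtain ⟨S, hS, hpS⟩ := h.span_le (h.mul_mon_span hr (-e)) hp
  obtain ⟨T, hT, hqT⟩ := h.span_le (h.mul_mon_span hs (-e)) hq.le
  refine ⟨S ∪ T, _, _, ?_, ?_, ?_, hq, hpq⟩
  · intro e he
    rcases Finset.mem_union.1 he with he | he
    · exact hS e he
    · exact hT e he
  · exact Submodule.span_mono (Set.image_mono (by simp)) hpS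
  · exact Submodule.span_mono (Set.image_mono (by simp)) hqT

theorem Frame.perron (h : Frame L v x) (S : Finset (Fin ρ → ℤ)) (hS : ∀ e ∈ S, v (mon x e) ≤ 1) :
    ∃ b : Fin ρ → (Fin ρ → ℤ), (∀ i, v (mon x (b i)) < 1) ∧ LinearIndependent ℤ b ∧
      Submodule.span ℤ (Set.range b) = ⊤ ∧ ∀ e ∈ S, e ∈ AddSubmonoid.closure (Set.range b) := by
  classical
  let Pos : (Fin ρ → ℤ) → Prop := fun e => v (mon x e) < 1
  have hadd : ∀ a b, Pos a → Pos b → Pos (a + b) := fun a b ha hb => by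
    simp only [Pos, mon_add h.x_ne, map_mul] at *
    exact mul_lt_one_of_nonneg_of_lt_one_left zero_le ha hb.le
  have h0 : ¬ Pos 0 := by simp [Pos, mon_zero]
  have hinv : ∀ a, 1 < v (mon x a) → Pos (-a) := fun a ha => by
    simp only [Pos, mon_neg, map_inv₀]
    exact inv_lt_one_of_one_lt₀ ha
  have htot : ∀ a, a ≠ 0 → Pos a ∨ Pos (-a) := fun a ha => by
    rcases lt_trichotomy (v (mon x a)) 1 with hl | hl | hl
    · exact Or.inl hl
    · exact absurd (h.ind a hl) ha
    · exact Or.inr (hinv a hl)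
  let T : Finset (Fin ρ → ℤ) := (S ∪ Finset.univ.image (fun i => Pi.single i 1) ∪
    Finset.univ.image (fun i => -Pi.single i 1)).filter Pos
  let g : Fin T.card → (Fin ρ → ℤ) := fun i => T.equivFin.symm i
  have hg : ∀ k, Pos (g k) := fun k => (Finset.mem_filter.1 (T.equivFin.symm k).2).2
  obtain ⟨l, b, hb, hpos, hd⟩ := LU.perron hadd h0 htot _ g hg
  have hT : ∀ e ∈ T, e ∈ AddSubmonoid.closure (Set.range b) := fun e he => by
    have := hd (T.equivFin ⟨e, he⟩)
    simpa [g] using this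
  have hcl : ∀ e ∈ AddSubmonoid.closure (Set.range b), e ∈ Submodule.span ℤ (Set.range b) := by
    intro e he
    induction he using AddSubmonoid.closure_induction with
    | mem y hy => exact Submodule.subset_span hy
    | zero => exact Submodule.zero_mem _
    | add y z _ _ hy hz => exact Submodule.add_mem _ hy hz
  have hsp : Submodule.span ℤ (Set.range b) = ⊤ := by
    rw [eq_top_iff, ← (Pi.basisFun ℤ (Fin ρ)).span_eq, Submodule.span_le]
    rintro _ ⟨i, rfl⟩
    rw [Pi.basisFun_apply]
    have hne : (Pi.single i 1 : Fin ρ → ℤ) ≠ 0 := by simp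
    rcases htot _ hne with hp | hp
    · exact hcl _ (hT _ (Finset.mem_filter.2 ⟨by simp, hp⟩))
    · have := hcl _ (hT (-Pi.single i 1) (Finset.mem_filter.2 ⟨by simp, hp⟩))
      simpa using Submodule.neg_mem _ this
  have hl : l = ρ := by
    have B := Module.Basis.mk hb hsp.ge
    have := Module.finrank_eq_card_basis B
    simpa using this.symm
  subst hl
  refine ⟨b, hpos, hb, hsp, fun e he => ?_⟩
  by_cases he0 : e = 0
  · rw [he0]; exact zero_mem _
  · refine hT e (Finset.mem_filter.2 ⟨by simp [he], ?_⟩)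
    rcases (hS e he).lt_or_eq with hl | hl
    · exact hl
    · exact absurd (h.ind e hl) he0

theorem mon_mon (hx : ∀ i, x i ≠ 0) (b : Fin ρ → (Fin ρ → ℤ)) (e : Fin ρ → ℤ) :
    mon (fun i => mon x (b i)) e = mon x (∑ i, e i • b i) := by
  classical
  have : ∀ s : Finset (Fin ρ), ∏ i ∈ s, (mon x (b i)) ^ (e i) = mon x (∑ i ∈ s, e i • b i) := by
    intro s
    induction s using Finset.induction_on with
    | empty => simp [mon_zero]
    | insert a s ha ih => rw [Finset.prod_insert ha, Finset.sum_insert ha, mon_add hx, ih, mon_zsmul]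
  exact this _

theorem Frame.change (h : Frame L v x) {b : Fin ρ → (Fin ρ → ℤ)} (hb : LinearIndependent ℤ b)
    (hsp : Submodule.span ℤ (Set.range b) = ⊤) : Frame L v (fun i => mon x (b i)) where
  x_ne i := mon_ne h.x_ne _
  triv := h.triv
  ind e he := by
    rw [mon_mon h.x_ne] at he
    have := h.ind _ he
    funext i
    exact Fintype.linearIndependent_iff.1 hb e this i
  gen a := by
    have h1 : ∀ i, x i ∈ IntermediateField.adjoin L (Set.range fun i => mon x (b i)) := by
      intro i
      have : (Pi.single i 1 : Fin ρ → ℤ) ∈ Submodule.span ℤ (Set.range b) := by rw [hsp]; trivial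
      obtain ⟨c, hc⟩ := (Submodule.mem_span_range_iff_exists_fun ℤ).1 this
      rw [← mon_single (x := x) i, ← hc, ← mon_mon h.x_ne]
      refine prod_mem fun j _ => zpow_mem ?_ _
      exact IntermediateField.subset_adjoin L _ ⟨j, rfl⟩
    have h2 : IntermediateField.adjoin L (Set.range x) ≤
        IntermediateField.adjoin L (Set.range fun i => mon x (b i)) := by
      rw [IntermediateField.adjoin_le_iff]
      rintro _ ⟨i, rfl⟩
      exact h1 i
    exact h2 (h.gen a)

theorem Frame.perron_elems (h : Frame L v x) {ι : Type*} [Finite ι] (a : ι → E)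
    (ha : ∀ k, v (a k) ≤ 1) :
    ∃ x' : Fin ρ → E, Frame L v x' ∧ (∀ i, v (x' i) < 1) ∧
      ∀ k, ∃ p ∈ Algebra.adjoin L (Set.range x'), ∃ q ∈ Algebra.adjoin L (Set.range x'),
        v q = 1 ∧ a k * q = p := by
  classical
  cases nonempty_fintype ι
  choose S p q hS hp hq hq1 hpq using fun k => h.int_form (ha k)
  obtain ⟨b, hb1, hb2, hb3, hb4⟩ := h.perron (Finset.univ.biUnion S) (fun e he => by
    obtain ⟨k, -, hk⟩ := Finset.mem_biUnion.1 he
    exact hS k e hk)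
  have hmem : ∀ e ∈ AddSubmonoid.closure (Set.range b),
      mon x e ∈ Algebra.adjoin L (Set.range fun i => mon x (b i)) := by
    intro e he
    induction he using AddSubmonoid.closure_induction with
    | mem y hy => obtain ⟨i, rfl⟩ := hy; exact Algebra.subset_adjoin ⟨i, rfl⟩
    | zero => rw [mon_zero]; exact one_mem _
    | add y z _ _ hy hz => rw [mon_add h.x_ne]; exact mul_mem hy hz
  have hspan : ∀ k, ∀ z ∈ Submodule.span L (mon x '' (S k)),
      z ∈ Algebra.adjoin L (Set.range fun i => mon x (b i)) := by
    intro k z hz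
    have : Submodule.span L (mon x '' (S k)) ≤
        Subalgebra.toSubmodule (Algebra.adjoin L (Set.range fun i => mon x (b i))) := by
      rw [Submodule.span_le]
      rintro _ ⟨e, he, rfl⟩
      exact hmem e (hb4 e (Finset.mem_biUnion.2 ⟨k, Finset.mem_univ _, he⟩))
    exact this hz
  exact ⟨_, h.change hb2 hb3, hb1, fun k => ⟨p k, hspan k _ (hp k), q k, hspan k _ (hq k),
    hq1 k, hpq k⟩⟩

theorem clear_den {K : Type*} [Field K] [Algebra K L] [Algebra K E] [IsScalarTower K L E]
    (htriv : ∀ c : L, c ≠ 0 → v (algebraMap L E c) = 1) {τ : ℕ}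
    (y : Fin τ → L) (hy : ∀ a : L, a ∈ IntermediateField.adjoin K (Set.range y)) (x' : Fin ρ → E)
    {a : E} (ha : a ∈ Algebra.adjoin L (Set.range x')) :
    ∃ d ∈ Algebra.adjoin K (Set.range x' ∪ Set.range fun i => algebraMap L E (y i)),
      v d = 1 ∧ a * d ∈ Algebra.adjoin K (Set.range x' ∪ Set.range fun i => algebraMap L E (y i)) := by
  set R := Algebra.adjoin K (Set.range x' ∪ Set.range fun i => algebraMap L E (y i)) with hR
  have hyR : ∀ c ∈ Algebra.adjoin K (Set.range y), algebraMap L E c ∈ R := by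
    intro c hc
    have h1 : (Algebra.adjoin K (Set.range y)).map (IsScalarTower.toAlgHom K L E) ≤ R := by
      rw [AlgHom.map_adjoin, Algebra.adjoin_le_iff]
      rintro _ ⟨_, ⟨i, rfl⟩, rfl⟩
      exact Algebra.subset_adjoin (Or.inr ⟨i, rfl⟩)
    exact h1 ⟨c, hc, rfl⟩
  induction ha using Algebra.adjoin_induction with
  | mem z hz =>
    exact ⟨1, one_mem _, map_one _, by rw [mul_one]; exact Algebra.subset_adjoin (Or.inl hz)⟩
  | algebraMap c =>
    obtain ⟨r, hr, s, hs, rfl⟩ := IntermediateField.mem_adjoin_iff_div.1 (hy c)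
    by_cases hs0 : s = 0
    · refine ⟨1, one_mem _, map_one _, ?_⟩
      subst hs0
      simp
    · refine ⟨algebraMap L E s, hyR s hs, htriv s hs0, ?_⟩
      rw [← map_mul, div_mul_cancel₀ _ hs0]
      exact hyR r hr
  | add a b _ _ ha hb =>
    obtain ⟨d, hd, hd1, hda⟩ := ha
    obtain ⟨e, he, he1, heb⟩ := hb
    refine ⟨d * e, mul_mem hd he, by rw [map_mul, hd1, he1, one_mul], ?_⟩
    have : (a + b) * (d * e) = (a * d) * e + (b * e) * d := by ring
    rw [this]
    exact add_mem (mul_mem hda he) (mul_mem heb hd)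
  | mul a b _ _ ha hb =>
    obtain ⟨d, hd, hd1, hda⟩ := ha
    obtain ⟨e, he, he1, heb⟩ := hb
    refine ⟨d * e, mul_mem hd he, by rw [map_mul, hd1, he1, one_mul], ?_⟩
    have : (a * b) * (d * e) = (a * d) * (b * e) := by ring
    rw [this]
    exact mul_mem hda heb

theorem Frame.perron_final {K : Type*} [Field K] [Algebra K L] [Algebra K E] [IsScalarTower K L E]
    (h : Frame L v x) {τ : ℕ}
    (y : Fin τ → L) (hy : ∀ a : L, a ∈ IntermediateField.adjoin K (Set.range y))
    {ι : Type*} [Finite ι] (a : ι → E) (ha : ∀ k, v (a k) ≤ 1) :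
    ∃ x' : Fin ρ → E, Frame L v x' ∧ (∀ i, v (x' i) < 1) ∧
      ∃ q ∈ Algebra.adjoin K (Set.range x' ∪ Set.range fun i => algebraMap L E (y i)),
        v q = 1 ∧ ∀ k, a k * q ∈
          Algebra.adjoin K (Set.range x' ∪ Set.range fun i => algebraMap L E (y i)) := by
  classical
  cases nonempty_fintype ι
  obtain ⟨x', hx', hlt, hk⟩ := h.perron_elems a ha
  refine ⟨x', hx', hlt, ?_⟩
  set R := Algebra.adjoin K (Set.range x' ∪ Set.range fun i => algebraMap L E (y i)) with hR
  have key : ∀ k, ∃ q ∈ R, v q = 1 ∧ a k * q ∈ R := by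
    intro k
    obtain ⟨p, hp, q, hq, hq1, hpq⟩ := hk k
    obtain ⟨d, hd, hd1, hdp⟩ := clear_den (v := v) h.triv y hy x' hp
    obtain ⟨e, he, he1, heq⟩ := clear_den (v := v) h.triv y hy x' hq
    refine ⟨(q * e) * d, mul_mem heq hd, by simp [map_mul, hq1, hd1, he1], ?_⟩
    have : a k * (q * e * d) = (p * d) * e := by rw [← hpq]; ring
    rw [this]
    exact mul_mem hdp he
  choose q hq hq1 hqa using key
  refine ⟨∏ k, q k, prod_mem fun k _ => hq k, by simp [map_prod, hq1], fun k => ?_⟩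
  rw [← Finset.mul_prod_erase _ _ (Finset.mem_univ k), ← mul_assoc]
  exact mul_mem (hqa k) (prod_mem fun k _ => hq k)

end

end LU

namespace LU

open LocalUnif

section

variable {Ω : Type*} [Field Ω]

theorem isVUnit_iff (O : ValuationSubring Ω) (z : Ω) : IsVUnit O z ↔ O.valuation z = 1 := by
  constructor
  · rintro ⟨h0, h1, h2⟩
    rw [← O.valuation_le_one_iff] at h1 h2
    rw [map_inv₀] at h2
    have h3 : O.valuation z ≠ 0 := (O.valuation.ne_zero_iff).2 h0
    exact le_antisymm h1 ((inv_le_one₀ (zero_lt_iff.2 h3)).1 h2)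
  · intro h
    refine ⟨?_, ?_, ?_⟩
    · rintro rfl; simp at h
    · rw [← O.valuation_le_one_iff]; exact h.le
    · rw [← O.valuation_le_one_iff, map_inv₀, h, inv_one]

theorem inMax_iff (O : ValuationSubring Ω) (z : Ω) : InMax O z ↔ O.valuation z < 1 := by
  by_cases h0 : z = 0
  · simp [InMax, h0]
  · have h3 : O.valuation z ≠ 0 := (O.valuation.ne_zero_iff).2 h0
    rw [InMax, or_iff_right h0, ← O.valuation_le_one_iff, map_inv₀, not_le,
      one_lt_inv₀ (zero_lt_iff.2 h3)]

noncomputable def mvp {m : ℕ} (P : Polynomial Ω) : MvPolynomial (Fin (m + 1)) Ω :=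
  Polynomial.aeval (MvPolynomial.X 0) P

theorem eval_mvp {m : ℕ} (P : Polynomial Ω) (u : Fin (m + 1) → Ω) :
    MvPolynomial.eval u (mvp P) = P.eval (u 0) := by
  rw [mvp, Polynomial.aeval_def, Polynomial.hom_eval₂, MvPolynomial.eval_X, Polynomial.eval]
  congr 1
  ext a
  simp

theorem supp_mvp {m : ℕ} (P : Polynomial Ω) (s : Set (Fin (m + 1))) (h0 : 0 ∈ s) :
    mvp P ∈ MvPolynomial.supported Ω s := by
  rw [mvp, Polynomial.aeval_eq_sum_range]
  exact Subalgebra.sum_mem _ fun i _ => Subalgebra.smul_mem _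
    (Subalgebra.pow_mem _ (MvPolynomial.X_mem_supported.2 h0) _) _

theorem pderiv_mvp {m : ℕ} (P : Polynomial Ω) :
    MvPolynomial.pderiv 0 (mvp (m := m) P) = mvp (Polynomial.derivative P) := by
  rw [mvp, mvp, Derivation.map_aeval, MvPolynomial.pderiv_X_self, smul_eq_mul, mul_one]

theorem coeff_of_mem {m : ℕ} (R : Subring Ω) {f : MvPolynomial (Fin (m + 1)) Ω}
    (hf : f ∈ (MvPolynomial.map R.subtype).range) (u) : f.coeff u ∈ R := by
  obtain ⟨g, rfl⟩ := hf
  rw [MvPolynomial.coeff_map]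
  exact (g.coeff u).2

theorem X_mem_range {m : ℕ} (R : Subring Ω) (i : Fin (m + 1)) :
    (MvPolynomial.X i : MvPolynomial (Fin (m + 1)) Ω) ∈ (MvPolynomial.map R.subtype).range :=
  ⟨MvPolynomial.X i, by simp⟩

theorem mvp_mem {m : ℕ} (R : Subring Ω) {P : Polynomial Ω} (hP : ∀ i, P.coeff i ∈ R) :
    mvp (m := m) P ∈ (MvPolynomial.map R.subtype).range := by
  rw [mvp, Polynomial.aeval_eq_sum_range]
  refine Subring.sum_mem _ fun i _ => ?_
  rw [MvPolynomial.smul_eq_C_mul]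
  refine Subring.mul_mem _ ⟨MvPolynomial.C ⟨_, hP i⟩, by simp⟩ (Subring.pow_mem _ (X_mem_range R 0) _)

theorem unif_polys (O : ValuationSubring Ω) (R : Subring Ω) {m : ℕ} (η : Ω) (ζ : Fin m → Ω)
    (P : Polynomial Ω) (hPR : ∀ i, P.coeff i ∈ R) (hP0 : P.eval η = 0)
    (hPd : O.valuation ((Polynomial.derivative P).eval η) = 1)
    (g h : Fin m → Polynomial Ω) (hg : ∀ k i, (g k).coeff i ∈ R) (hh : ∀ k i, (h k).coeff i ∈ R)
    (hgh : ∀ k, ζ k * (h k).eval η = (g k).eval η) (hhv : ∀ k, O.valuation ((h k).eval η) = 1) :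
    ∃ f : Fin (m + 1) → MvPolynomial (Fin (m + 1)) Ω,
    (∀ i u, (f i).coeff u ∈ R) ∧
    (∀ i j : Fin (m + 1), (i : ℕ) < (j : ℕ) → MvPolynomial.degreeOf j (f i) = 0) ∧
    (∀ i, MvPolynomial.eval (Fin.cons η ζ : Fin (m + 1) → Ω) (f i) = 0) ∧
    IsVUnit O (Matrix.det (Matrix.of fun i j : Fin (m + 1) =>
      MvPolynomial.eval (Fin.cons η ζ : Fin (m + 1) → Ω) (MvPolynomial.pderiv j (f i)))) := by
  classical
  let f : Fin (m + 1) → MvPolynomial (Fin (m + 1)) Ω :=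
    Fin.cons (mvp P) fun k => mvp (h k) * MvPolynomial.X k.succ - mvp (g k)
  have f0 : f 0 = mvp P := rfl
  have fs : ∀ k : Fin m, f k.succ = mvp (h k) * MvPolynomial.X k.succ - mvp (g k) := fun k => rfl
  have hsupp : ∀ i, f i ∈ MvPolynomial.supported Ω {k : Fin (m + 1) | k ≤ i} := by
    intro i
    refine Fin.cases ?_ (fun k => ?_) i
    · rw [f0]; exact supp_mvp _ _ (by simp)
    · rw [fs]
      exact Subalgebra.sub_mem _ (Subalgebra.mul_mem _ (supp_mvp _ _ (by simp))
        (MvPolynomial.X_mem_supported.2 (by simp))) (supp_mvp _ _ (by simp))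
  have hvars : ∀ i j : Fin (m + 1), i < j → j ∉ (f i).vars := by
    intro i j hij hj
    have := (MvPolynomial.mem_supported.1 (hsupp i)) hj
    exact absurd hij (not_lt.2 this)
  have hd0 : ∀ i j : Fin (m + 1), i < j → MvPolynomial.pderiv j (f i) = 0 := fun i j hij =>
    MvPolynomial.pderiv_eq_zero_of_notMem_vars (hvars i j hij)
  have hnz : ∀ k : Fin m, ∀ Q : Polynomial Ω, MvPolynomial.pderiv k.succ (mvp (m := m) Q) = 0 := by
    intro k Q
    refine MvPolynomial.pderiv_eq_zero_of_notMem_vars fun hk => ?_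
    have := (MvPolynomial.mem_supported.1 (supp_mvp Q {0} rfl)) hk
    exact Fin.succ_ne_zero k this
  refine ⟨f, ?_, ?_, ?_, ?_⟩
  · intro i u
    refine coeff_of_mem R ?_ u
    refine Fin.cases ?_ (fun k => ?_) i
    · rw [f0]; exact mvp_mem R hPR
    · rw [fs]
      exact Subring.sub_mem _ (Subring.mul_mem _ (mvp_mem R (hh k)) (X_mem_range R _))
        (mvp_mem R (hg k))
  · intro i j hij
    have := hvars i j hij
    rw [MvPolynomial.mem_vars_iff_degreeOf_ne_zero, not_not] at this
    exact this
  · intro i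
    refine Fin.cases ?_ (fun k => ?_) i
    · rw [f0, eval_mvp, Fin.cons_zero, hP0]
    · rw [fs, map_sub, map_mul, eval_mvp, eval_mvp, MvPolynomial.eval_X, Fin.cons_zero,
        Fin.cons_succ, ← hgh]
      ring
  · rw [isVUnit_iff, Matrix.det_of_lowerTriangular, map_prod]
    · refine Finset.prod_eq_one fun i _ => ?_
      rw [Matrix.of_apply]
      refine Fin.cases ?_ (fun k => ?_) i
      · rw [f0, pderiv_mvp, eval_mvp, Fin.cons_zero, hPd]
      · rw [fs, map_sub, Derivation.leibniz, hnz, hnz, MvPolynomial.pderiv_X_self]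
        simp [eval_mvp, hhv]
    · intro i j hij
      rw [Matrix.of_apply, hd0 i j hij, map_zero]

end

section
variable {Γ₀ : Type*} [LinearOrderedCommGroupWithZero Γ₀]
variable {L E : Type*} [Field L] [Field E] [Algebra L E] {v : Valuation E Γ₀}
  {ρ : ℕ} {x : Fin ρ → E}

theorem Frame.algInd (h : Frame L v x) : AlgebraicIndependent L x := by
  rw [algebraicIndependent_iff]
  intro p hp
  have hli := h.linInd.comp (fun d : Fin ρ →₀ ℕ => fun i => (d i : ℤ)) (by
    intro d d' hd
    ext i
    have := congrFun hd i
    simpa using this)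
  rw [linearIndependent_iff'] at hli
  rw [MvPolynomial.aeval_def, MvPolynomial.eval₂_eq'] at hp
  have h2 := hli p.support (fun d => p.coeff d) (by
    rw [← hp]
    refine Finset.sum_congr rfl fun d _ => ?_
    rw [Algebra.smul_def]
    simp [mon])
  ext d
  rw [MvPolynomial.coeff_zero]
  by_contra hd
  exact hd (h2 d (MvPolynomial.mem_support_iff.2 hd))

end

end LU

namespace LU

open LocalUnif

section

variable {Ω : Type*} [Field Ω] [IsAlgClosed Ω]

set_option maxHeartbeats 1000000 in
theorem unif_core (O : ValuationSubring Ω) (𝓚 : Subfield Ω)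
    {L E F : Type*} [Field L] [Field E] [Field F] [Algebra 𝓚 L] [Algebra L E] [Algebra 𝓚 E]
    [IsScalarTower 𝓚 L E] [Algebra E F] [Algebra L F] [IsScalarTower L E F]
    [Algebra E Ω] [Algebra F Ω] [IsScalarTower E F Ω] [IsScalarTower 𝓚 E Ω]
    [FiniteDimensional E F]
    {ρ τ : ℕ} {x : Fin ρ → E} (hf : Frame L (O.valuation.comap (algebraMap E Ω)) x)
    {y : Fin τ → L} (hy : AlgebraicIndependent 𝓚 y)
    (hyg : ∀ a : L, a ∈ IntermediateField.adjoin 𝓚 (Set.range y))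
    {α : F} {g : Polynomial E} (hα : ResGen E O.valuation α g)
    (htriv : ∀ c ∈ 𝓚, c ∈ O)
    {m : ℕ} (ζ : Fin m → F) (hζ : ∀ k, algebraMap F Ω (ζ k) ∈ O) :
    UnifWrt (algebraMap F Ω).fieldRange 𝓚 O (fun k => algebraMap F Ω (ζ k)) := by
  classical
  obtain ⟨η, hη1, hηn, htop, hc, hd⟩ := hα.main hf
  choose p q hp hq hpq hq1 using fun k => exists_num_den hηn htop hc hd
    ((O.valuation_le_one_iff _).2 (hζ k))
  set v := O.valuation with hv
  let N : ℕ := (minpoly E η).natDegree + ∑ k, ((p k).natDegree + (q k).natDegree) + 1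
  have hNp : ∀ k, (p k).natDegree + (q k).natDegree < N := fun k => by
    have := Finset.single_le_sum (f := fun k => (p k).natDegree + (q k).natDegree)
      (fun _ _ => Nat.zero_le _) (Finset.mem_univ k)
    omega
  let a : Option (Fin m ⊕ Fin m) × Fin N → E := fun r => match r.1 with
    | none => (minpoly E η).coeff r.2
    | some (Sum.inl k) => (p k).coeff r.2
    | some (Sum.inr k) => (q k).coeff r.2
  have ha : ∀ r, (v.comap (algebraMap E Ω)) (a r) ≤ 1 := by
    rintro ⟨(_ | (k | k)), i⟩
    · exact hc i
    · exact hp k i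
    · exact hq k i
  obtain ⟨x', hx', hx'1, d, hdR, hd1, hda⟩ := hf.perron_final (K := 𝓚) y hyg a ha
  set yE : Fin τ → E := fun i => algebraMap L E (y i) with hyE
  let t : Fin (ρ + τ) → Ω := Fin.append (fun i => algebraMap E Ω (x' i)) fun i => algebraMap E Ω (yE i)
  have htl : ∀ i, t (Fin.castAdd τ i) = algebraMap E Ω (x' i) := fun i => Fin.append_left _ _ i
  have htr : ∀ i, t (Fin.natAdd ρ i) = algebraMap E Ω (yE i) := fun i => Fin.append_right _ _ i
  have htE : ∀ i, ∃ b : E, t i = algebraMap E Ω b := fun i => by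
    refine Fin.addCases (fun i => ?_) (fun i => ?_) i
    · exact ⟨_, htl i⟩
    · exact ⟨_, htr i⟩
  have hEF : ∀ b : E, algebraMap E Ω b = algebraMap F Ω (algebraMap E F b) := fun b =>
    IsScalarTower.algebraMap_apply E F Ω b
  have hKE : ∀ c : 𝓚, (c : Ω) = algebraMap E Ω (algebraMap 𝓚 E c) := fun c =>
    IsScalarTower.algebraMap_apply 𝓚 E Ω c
  set R := Subring.closure ((↑(𝓚.toSubring ⊓ O.toSubring) : Set Ω) ∪ Set.range t) with hR
  have hKR : ∀ c ∈ 𝓚, c ∈ R := fun c hc => Subring.subset_closure (Or.inl ⟨hc, htriv c hc⟩)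
  have hAR : ∀ b ∈ Algebra.adjoin 𝓚 (Set.range x' ∪ Set.range yE), algebraMap E Ω b ∈ R := by
    intro b hb
    induction hb using Algebra.adjoin_induction with
    | mem z hz =>
      rcases hz with ⟨i, rfl⟩ | ⟨i, rfl⟩
      · rw [← htl]; exact Subring.subset_closure (Or.inr ⟨_, rfl⟩)
      · rw [← htr]; exact Subring.subset_closure (Or.inr ⟨_, rfl⟩)
    | algebraMap c => rw [← hKE]; exact hKR _ c.2
    | add a b _ _ ha hb => rw [map_add]; exact add_mem ha hb
    | mul a b _ _ ha hb => rw [map_mul]; exact mul_mem ha hb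
  have hcoef : ∀ r, algebraMap E Ω (d * a r) ∈ R := fun r => by
    rw [mul_comm]; exact hAR _ (hda r)
  let sc : Polynomial E → Polynomial Ω := fun P => (Polynomial.C d * P).map (algebraMap E Ω)
  have hscc : ∀ P i, (sc P).coeff i = algebraMap E Ω (d * P.coeff i) := fun P i => by
    simp only [sc, Polynomial.coeff_map, Polynomial.coeff_C_mul]
  have hsce : ∀ P : Polynomial E, (sc P).eval (algebraMap F Ω η) =
      algebraMap E Ω d * algebraMap F Ω (Polynomial.aeval η P) := fun P => by
    simp only [sc, Polynomial.eval_map_algebraMap, map_mul, Polynomial.aeval_C]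
    rw [Polynomial.aeval_algebraMap_apply]
  have hscR : ∀ (P : Polynomial E) , P.natDegree < N →
      (∀ i : Fin N, ∃ r, a r = P.coeff i) → ∀ i, (sc P).coeff i ∈ R := by
    intro P hP hr i
    rw [hscc]
    rcases lt_or_ge i N with hi | hi
    · obtain ⟨r, hr⟩ := hr ⟨i, hi⟩
      simp only at hr
      rw [← hr]; exact hcoef r
    · rw [Polynomial.coeff_eq_zero_of_natDegree_lt (by omega), mul_zero, map_zero]
      exact zero_mem _
  have hscv : ∀ P : Polynomial E, v (algebraMap F Ω (Polynomial.aeval η P)) = 1 →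
      v ((sc P).eval (algebraMap F Ω η)) = 1 := fun P hP => by
    rw [hsce, map_mul, hP, mul_one]; exact hd1
  refine ⟨ρ + τ, m + 1, t, Fin.cons (algebraMap F Ω η) fun k => algebraMap F Ω (ζ k),
    ⟨?_, ?_, ?_, ?_, ?_, ?_⟩, Fin.succ, fun k => Fin.cons_succ _ _ _⟩
  · intro i
    refine ⟨?_, ?_⟩
    · obtain ⟨b, hb⟩ := htE i
      rw [hb, hEF]; exact ⟨_, rfl⟩
    · rw [← O.valuation_le_one_iff]
      refine Fin.addCases (fun i => ?_) (fun i => ?_) i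
      · rw [htl]; exact (hx'1 i).le
      · rw [htr]
        by_cases h0 : y i = 0
        · simp [yE, h0]
        · exact (hf.triv _ h0).le
  · intro i
    refine Fin.cases ?_ (fun k => ?_) i
    · exact ⟨⟨η, rfl⟩, (O.valuation_le_one_iff _).1 hη1.le⟩
    · exact ⟨⟨ζ k, rfl⟩, hζ k⟩
  · have h1 := (AlgebraicIndependent.sumElim_comp (R := 𝓚) (S := L) (A := E) hy hx'.algInd).map'
      (f := IsScalarTower.toAlgHom 𝓚 E Ω) (algebraMap E Ω).injective
    have h2 := h1.comp finSumFinEquiv.symm finSumFinEquiv.symm.injective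
    convert h2 using 1
    funext i
    refine Fin.addCases (fun i => ?_) (fun i => ?_) i
    · simp [htl]
    · simp [htr, yE]
  · rintro _ ⟨z, rfl⟩
    set T := IntermediateField.adjoin 𝓚 (Set.range t) with hT
    have hLT : ∀ b : L, algebraMap E Ω (algebraMap L E b) ∈ T := by
      intro b
      have hb := hyg b
      induction hb using IntermediateField.adjoin_induction with
      | mem z hz =>
        obtain ⟨i, rfl⟩ := hz
        have := htr i
        simp only [yE] at this
        rw [← this]; exact IntermediateField.subset_adjoin _ _ ⟨_, rfl⟩
      | algebraMap c =>
        rw [← IsScalarTower.algebraMap_apply 𝓚 L E, ← hKE]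
        exact T.algebraMap_mem c
      | add a b _ _ ha hb => rw [map_add, map_add]; exact add_mem ha hb
      | inv a _ ha => rw [map_inv₀, map_inv₀]; exact inv_mem ha
      | mul a b _ _ ha hb => rw [map_mul, map_mul]; exact mul_mem ha hb
    have hET : ∀ b : E, algebraMap E Ω b ∈ T := by
      intro b
      have hb := hx'.gen b
      induction hb using IntermediateField.adjoin_induction with
      | mem z hz =>
        obtain ⟨i, rfl⟩ := hz
        rw [← htl]; exact IntermediateField.subset_adjoin _ _ ⟨_, rfl⟩
      | algebraMap c => exact hLT c
      | add a b _ _ ha hb => rw [map_add]; exact add_mem ha hb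
      | inv a _ ha => rw [map_inv₀]; exact inv_mem ha
      | mul a b _ _ ha hb => rw [map_mul]; exact mul_mem ha hb
    obtain ⟨P, hP0, hP⟩ := Algebra.IsAlgebraic.isAlgebraic (R := E) z
    let φ : E →+* T := (algebraMap E Ω).codRestrict T.toSubfield hET
    refine ⟨P.map φ, (Polynomial.map_ne_zero_iff φ.injective).2 hP0, ?_⟩
    rw [Polynomial.aeval_def, Polynomial.eval₂_map]
    have h2 : (algebraMap T Ω).comp φ = algebraMap E Ω := rfl
    rw [h2, ← Polynomial.aeval_def, Polynomial.aeval_algebraMap_apply, hP, map_zero]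
  · apply le_antisymm
    · rw [Subfield.closure_le]
      rintro _ ((hz | ⟨i, rfl⟩) | ⟨i, rfl⟩)
      · have := hKE ⟨_, hz⟩
        simp only at this
        rw [this, hEF]; exact ⟨_, rfl⟩
      · obtain ⟨b, hb⟩ := htE i
        rw [hb, hEF]; exact ⟨_, rfl⟩
      · refine Fin.cases ?_ (fun k => ?_) i
        · exact ⟨η, rfl⟩
        · exact ⟨ζ k, rfl⟩
    · set T := Subfield.closure ((𝓚 : Set Ω) ∪ Set.range t ∪ Set.range
        (Fin.cons (algebraMap F Ω η) fun k => algebraMap F Ω (ζ k) : Fin (m + 1) → Ω)) with hT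
      have htT : ∀ i, t i ∈ T := fun i => Subfield.subset_closure (Or.inl (Or.inr ⟨i, rfl⟩))
      have hLT : ∀ b : L, algebraMap E Ω (algebraMap L E b) ∈ T := by
        intro b
        have hb := hyg b
        induction hb using IntermediateField.adjoin_induction with
        | mem z hz =>
          obtain ⟨i, rfl⟩ := hz
          have := htr i
          simp only [yE] at this
          rw [← this]; exact htT _
        | algebraMap c =>
          rw [← IsScalarTower.algebraMap_apply 𝓚 L E, ← hKE]
          exact Subfield.subset_closure (Or.inl (Or.inl c.2))
        | add a b _ _ ha hb => rw [map_add, map_add]; exact add_mem ha hb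
        | inv a _ ha => rw [map_inv₀, map_inv₀]; exact inv_mem ha
        | mul a b _ _ ha hb => rw [map_mul, map_mul]; exact mul_mem ha hb
      have hET : ∀ b : E, algebraMap E Ω b ∈ T := by
        intro b
        have hb := hx'.gen b
        induction hb using IntermediateField.adjoin_induction with
        | mem z hz =>
          obtain ⟨i, rfl⟩ := hz
          rw [← htl]; exact htT _
        | algebraMap c => exact hLT c
        | add a b _ _ ha hb => rw [map_add]; exact add_mem ha hb
        | inv a _ ha => rw [map_inv₀]; exact inv_mem ha
        | mul a b _ _ ha hb => rw [map_mul]; exact mul_mem ha hb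
      rintro _ ⟨z, rfl⟩
      have hz : z ∈ IntermediateField.adjoin E {η} := by rw [htop]; trivial
      induction hz using IntermediateField.adjoin_induction with
      | mem z hz =>
        rw [Set.mem_singleton_iff] at hz
        rw [hz]
        exact Subfield.subset_closure (Or.inr ⟨0, rfl⟩)
      | algebraMap c => rw [← hEF]; exact hET c
      | add a b _ _ ha hb => rw [map_add]; exact add_mem ha hb
      | inv a _ ha => rw [map_inv₀]; exact inv_mem ha
      | mul a b _ _ ha hb => rw [map_mul]; exact mul_mem ha hb
  · refine unif_polys O R (algebraMap F Ω η) (fun k => algebraMap F Ω (ζ k)) (sc (minpoly E η))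
      ?_ ?_ ?_ (fun k => sc (p k)) (fun k => sc (q k)) ?_ ?_ ?_ ?_
    · exact hscR _ (by omega) fun i => ⟨(none, i), rfl⟩
    · rw [hsce, minpoly.aeval, map_zero, mul_zero]
    · have e : Polynomial.derivative (sc (minpoly E η)) = sc (Polynomial.derivative (minpoly E η)) := by
        simp only [sc, Polynomial.derivative_map, Polynomial.derivative_C_mul]
      rw [e]; exact hscv _ hd
    · exact fun k => hscR _ (by have := hNp k; omega) fun i => ⟨(some (Sum.inl k), i), rfl⟩
    · exact fun k => hscR _ (by have := hNp k; omega) fun i => ⟨(some (Sum.inr k), i), rfl⟩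
    · intro k
      simp only [hsce]
      rw [← hpq k, map_mul]; ring
    · intro k; exact hscv _ (hq1 k)

end

end LU

namespace LU

open LocalUnif

section

variable {Ω : Type*} [Field Ω]

theorem res_eq_zero (O : ValuationSubring Ω) (a : O) :
    IsLocalRing.residue O a = 0 ↔ O.valuation (a : Ω) < 1 := by
  rw [IsLocalRing.residue_eq_zero_iff, ← O.valuation_lt_one_iff]

def resF (O : ValuationSubring Ω) (F : Subfield Ω) : Subfield (IsLocalRing.ResidueField O) where
  carrier := {c | ∃ a : O, (a : Ω) ∈ F ∧ IsLocalRing.residue O a = c}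
  mul_mem' := by
    rintro _ _ ⟨a, ha, rfl⟩ ⟨b, hb, rfl⟩
    exact ⟨a * b, F.mul_mem ha hb, map_mul _ _ _⟩
  one_mem' := ⟨1, F.one_mem, map_one _⟩
  add_mem' := by
    rintro _ _ ⟨a, ha, rfl⟩ ⟨b, hb, rfl⟩
    exact ⟨a + b, F.add_mem ha hb, map_add _ _ _⟩
  zero_mem' := ⟨0, F.zero_mem, map_zero _⟩
  neg_mem' := by
    rintro _ ⟨a, ha, rfl⟩
    exact ⟨-a, F.neg_mem ha, map_neg _ _⟩
  inv_mem' := by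
    rintro _ ⟨a, ha, rfl⟩
    by_cases h : IsLocalRing.residue O a = 0
    · rw [h, inv_zero]; exact ⟨0, F.zero_mem, map_zero _⟩
    · have hu : IsUnit a := by
        by_contra hu
        exact h ((IsLocalRing.residue_eq_zero_iff a).2 hu)
      obtain ⟨u, rfl⟩ := hu
      refine ⟨((u⁻¹ : Oˣ) : O), ?_, ?_⟩
      · have : (((u⁻¹ : Oˣ) : O) : Ω) = ((u : O) : Ω)⁻¹ := by
          refine eq_inv_of_mul_eq_one_left ?_
          rw [← MulMemClass.coe_mul, Units.inv_mul]; rfl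
        rw [this]; exact F.inv_mem ha
      · refine eq_inv_of_mul_eq_one_left ?_
        rw [← map_mul, Units.inv_mul, map_one]

noncomputable def resMap {L : Type*} [Field L] [Algebra L Ω] (O : ValuationSubring Ω) (F : Subfield Ω)
    (hF : ∀ l : L, algebraMap L Ω l ∈ F) (hO : ∀ l : L, algebraMap L Ω l ∈ O) : L →+* resF O F :=
  RingHom.codRestrict ((IsLocalRing.residue O).comp
    (RingHom.codRestrict (algebraMap L Ω) O.toSubring hO)) (resF O F)
    fun l => ⟨⟨algebraMap L Ω l, hO l⟩, hF l, rfl⟩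

theorem resMap_coe {L : Type*} [Field L] [Algebra L Ω] (O : ValuationSubring Ω) (F : Subfield Ω)
    (hF : ∀ l : L, algebraMap L Ω l ∈ F) (hO : ∀ l : L, algebraMap L Ω l ∈ O) (l : L) :
    (resMap O F hF hO l : IsLocalRing.ResidueField O) =
      IsLocalRing.residue O ⟨algebraMap L Ω l, hO l⟩ := rfl

theorem resMap_eq {L : Type*} [Field L] [Algebra L Ω] (O : ValuationSubring Ω) (F : Subfield Ω)
    (hF : ∀ l : L, algebraMap L Ω l ∈ F) (hO : ∀ l : L, algebraMap L Ω l ∈ O) (l : L) {a : O}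
    (ha : (a : Ω) ∈ F) :
    resMap O F hF hO l = ⟨IsLocalRing.residue O a, a, ha, rfl⟩ ↔
      O.valuation (algebraMap L Ω l - a) < 1 := by
  rw [Subtype.ext_iff, resMap_coe, ← sub_eq_zero, ← map_sub, res_eq_zero]; rfl

variable {L E : Type*} [Field L] [Field E] [Algebra L E] [Algebra E Ω] [Algebra L Ω]
  [IsScalarTower L E Ω] {ρ : ℕ} {x : Fin ρ → E}

theorem Frame.res_red {O : ValuationSubring Ω} (hf : Frame L (O.valuation.comap (algebraMap E Ω)) x)
    {a : E} (ha : O.valuation (algebraMap E Ω a) ≤ 1) :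
    ∃ l : L, O.valuation (algebraMap E Ω a - algebraMap L Ω l) < 1 := by
  rcases ha.lt_or_eq with h | h
  · exact ⟨0, by simpa using h⟩
  have ha0 : a ≠ 0 := by rintro rfl; simp at h
  obtain ⟨e, c, hc, h1, h2⟩ := hf.hasLT a ha0
  have he : e = 0 := hf.ind e (h2.symm.trans h)
  subst he
  refine ⟨c, ?_⟩
  rw [mon_zero, mul_one, Valuation.comap_apply, Valuation.comap_apply, map_sub, h,
    ← IsScalarTower.algebraMap_apply] at h1
  exact h1

theorem Frame.memO {O : ValuationSubring Ω} (hf : Frame L (O.valuation.comap (algebraMap E Ω)) x)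
    (l : L) : algebraMap L Ω l ∈ O := by
  rw [← O.valuation_le_one_iff]
  by_cases h : l = 0
  · simp [h]
  · have := hf.triv l h
    rw [Valuation.comap_apply, ← IsScalarTower.algebraMap_apply] at this
    exact this.le

theorem Frame.resF_finite {O : ValuationSubring Ω}
    (hf : Frame L (O.valuation.comap (algebraMap E Ω)) x) (F : IntermediateField E Ω)
    [FiniteDimensional E F] (hLF : ∀ l : L, algebraMap L Ω l ∈ F.toSubfield) :
    letI := (resMap O F.toSubfield hLF hf.memO).toAlgebra
    FiniteDimensional L (resF O F.toSubfield) := by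
  classical
  letI := (resMap O F.toSubfield hLF hf.memO).toAlgebra
  have hle : Module.rank L (resF O F.toSubfield) ≤ Module.finrank E F := by
    refine rank_le fun s hs => ?_
    choose B hBF hB using fun c : s => (c : resF O F.toSubfield).2
    have hli : LinearIndependent E (fun c : s => (⟨B c, hBF c⟩ : F)) := by
      rw [Fintype.linearIndependent_iff]
      by_contra! hcon
      obtain ⟨a, ha, i0, hi0⟩ := hcon
      obtain ⟨j, -, hj⟩ := Finset.exists_max_image Finset.univ
        (fun i => O.valuation (algebraMap E Ω (a i))) ⟨i0, Finset.mem_univ _⟩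
      have haj : a j ≠ 0 := by
        intro h
        have := hj i0 (Finset.mem_univ _)
        rw [h, map_zero, map_zero] at this
        exact hi0 (by simpa using this)
      have hb : ∀ i, O.valuation (algebraMap E Ω (a i / a j)) ≤ 1 := fun i => by
        rw [map_div₀, map_div₀]
        exact div_le_one_of_le₀ (hj i (Finset.mem_univ _)) zero_le
      choose l hl using fun i => hf.res_red (hb i)
      have hsum : ∑ i, algebraMap E Ω (a i / a j) * (B i : Ω) = 0 := by
        have := congrArg (fun z : F => (algebraMap E Ω (a j))⁻¹ * (z : Ω)) ha
        simp only [ZeroMemClass.coe_zero, mul_zero] at this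
        rw [← this, AddSubmonoidClass.coe_finsetSum, Finset.mul_sum]
        refine Finset.sum_congr rfl fun i _ => ?_
        rw [map_div₀, IntermediateField.coe_smul, Algebra.smul_def]
        ring
      have h0 : O.valuation (((∑ i, (⟨algebraMap L Ω (l i), hf.memO (l i)⟩ : O) * B i : O)) : Ω) < 1 := by
        have : (((∑ i, (⟨algebraMap L Ω (l i), hf.memO (l i)⟩ : O) * B i : O)) : Ω) =
            - ∑ i, (algebraMap E Ω (a i / a j) - algebraMap L Ω (l i)) * (B i : Ω) := by
          simp only [sub_mul, Finset.sum_sub_distrib, hsum]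
          simp [AddSubmonoidClass.coe_finsetSum]
        rw [this, Valuation.map_neg]
        refine Valuation.map_sum_lt _ one_ne_zero fun i _ => ?_
        rw [map_mul]
        exact (mul_le_of_le_one_right' ((O.valuation_le_one_iff _).2 (B i).2)).trans_lt (hl i)
      rw [← res_eq_zero, map_sum] at h0
      have h1 : ∑ i, l i • (i : resF O F.toSubfield) = 0 := by
        apply Subtype.ext
        rw [AddSubmonoidClass.coe_finsetSum]
        refine Eq.trans (Finset.sum_congr rfl fun i _ => ?_) h0
        rw [map_mul, hB]
        rfl
      have h2 := Fintype.linearIndependent_iff.1 hs l h1 j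
      have h3 := hl j
      rw [h2, div_self haj] at h3
      simp at h3
    have := hli.fintype_card_le_finrank
    simpa using this
  exact Module.rank_lt_aleph0_iff.1 (hle.trans_lt (Cardinal.natCast_lt_aleph0))

end

end LU

namespace LU

open LocalUnif Polynomial

section

variable {Ω : Type*} [Field Ω]
variable {L E : Type*} [Field L] [Field E] [Algebra L E] [Algebra E Ω] [Algebra L Ω]
  [IsScalarTower L E Ω] {ρ : ℕ} {x : Fin ρ → E}

theorem resMap_aeval (O : ValuationSubring Ω) (F : Subfield Ω)
    (hF : ∀ l : L, algebraMap L Ω l ∈ F) (hO : ∀ l : L, algebraMap L Ω l ∈ O)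
    (A : O) (hA : (A : Ω) ∈ F) (p : L[X]) :
    aeval (A : Ω) p ∈ O ∧ (eval₂ (resMap O F hF hO) ⟨IsLocalRing.residue O A, A, hA, rfl⟩ p = 0 ↔
      O.valuation (aeval (A : Ω) p) < 1) := by
  let φ : L →+* O := RingHom.codRestrict (algebraMap L Ω) O.toSubring hO
  have h1 : aeval (A : Ω) p = ((eval₂ φ A p : O) : Ω) := by
    rw [aeval_def]
    exact (hom_eval₂ p φ O.subtype A).symm
  refine ⟨h1 ▸ (eval₂ φ A p : O).2, ?_⟩
  rw [h1, ← res_eq_zero, hom_eval₂, Subtype.ext_iff]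
  have := hom_eval₂ p (resMap O F hF hO) (resF O F).subtype ⟨IsLocalRing.residue O A, A, hA, rfl⟩
  rw [Subfield.subtype_apply] at this
  rw [this]; rfl

set_option maxHeartbeats 1000000 in
theorem Frame.exists_resGen {O : ValuationSubring Ω}
    (hf : Frame L (O.valuation.comap (algebraMap E Ω)) x) (F : IntermediateField E Ω)
    [FiniteDimensional E F] (hLF : ∀ l : L, algebraMap L Ω l ∈ F.toSubfield)
    (hsep : letI := (resMap O F.toSubfield hLF hf.memO).toAlgebra
      Algebra.IsSeparable L (resF O F.toSubfield))
    (hval : ∀ z : F, z ≠ 0 → ∃ a : E, O.valuation (algebraMap F Ω z) = O.valuation (algebraMap E Ω a)) :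
    ∃ (α : F) (g : Polynomial E), ResGen E O.valuation α g := by
  classical
  letI := (resMap O F.toSubfield hLF hf.memO).toAlgebra
  haveI : FiniteDimensional L (resF O F.toSubfield) := hf.resF_finite F hLF
  haveI : Algebra.IsSeparable L (resF O F.toSubfield) := hsep
  obtain ⟨β, hβ0, hβ⟩ : ∃ β : resF O F.toSubfield, β ≠ 0 ∧ IntermediateField.adjoin L {β} = ⊤ := by
    obtain ⟨β, hβ⟩ := Field.exists_primitive_element L (resF O F.toSubfield)
    by_cases h : β = 0
    · refine ⟨1, one_ne_zero, ?_⟩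
      rw [h, IntermediateField.adjoin_zero] at hβ
      rw [IntermediateField.adjoin_one, hβ]
    · exact ⟨β, h, hβ⟩
  obtain ⟨_, A, hAF, rfl⟩ := β
  set β : resF O F.toSubfield := ⟨IsLocalRing.residue O A, A, hAF, rfl⟩ with hβd
  let α : F := ⟨A, hAF⟩
  have hint : IsIntegral L β := Algebra.IsIntegral.isIntegral β
  have haev : ∀ p : L[X], algebraMap F Ω (aeval α (p.map (algebraMap L E))) = aeval (A : Ω) p := by
    intro p
    rw [← aeval_algebraMap_apply, aeval_map_algebraMap]; rfl
  have key : ∀ p : L[X], O.valuation (aeval (A : Ω) p) ≤ 1 ∧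
      (aeval β p = 0 ↔ O.valuation (aeval (A : Ω) p) < 1) := fun p =>
    ⟨(O.valuation_le_one_iff _).2 (resMap_aeval O F.toSubfield hLF hf.memO A hAF p).1,
      (resMap_aeval O F.toSubfield hLF hf.memO A hAF p).2⟩
  have hvA : O.valuation (algebraMap F Ω α) = 1 := by
    have h := key X
    rw [aeval_X, aeval_X] at h
    exact h.1.eq_of_not_lt (fun h' => hβ0 (h.2.2 h'))
  have hvL : ∀ l : L, O.valuation (algebraMap E Ω (algebraMap L E l)) ≤ 1 := fun l => by
    rw [← IsScalarTower.algebraMap_apply]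
    exact (O.valuation_le_one_iff _).2 (hf.memO l)
  have hsumL : ∀ (n : ℕ) (l : Fin n → L), algebraMap F Ω (∑ i, algebraMap L E (l i) • α ^ (i : ℕ)) =
      aeval (A : Ω) (∑ i, C (l i) * X ^ (i : ℕ)) := by
    intro n l
    rw [← haev, Polynomial.map_sum, map_sum (aeval α)]
    congr 1
    refine Finset.sum_congr rfl fun i _ => ?_
    simp [Algebra.smul_def]
  have hsumβ : ∀ (n : ℕ) (l : Fin n → L), aeval β (∑ i, C (l i) * X ^ (i : ℕ)) =
      ∑ i, l i • β ^ (i : ℕ) := by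
    intro n l
    rw [map_sum]
    refine Finset.sum_congr rfl fun i _ => ?_
    simp [Algebra.smul_def]
  have hn : ((minpoly L β).map (algebraMap L E)).natDegree = (minpoly L β).natDegree := natDegree_map _
  refine ⟨α, (minpoly L β).map (algebraMap L E), hval, hvA, (minpoly.monic hint).map _, ?_, ?_, ?_, ?_, ?_⟩
  · intro i
    rw [coeff_map]; exact hvL _
  · rw [haev]
    exact (key _).2.1 (minpoly.aeval _ _)
  · rw [derivative_map, haev]
    refine (key _).1.eq_of_not_lt fun h => ?_
    exact (Algebra.IsSeparable.isSeparable L β).aeval_derivative_ne_zero (minpoly.aeval _ _) ((key _).2.2 h)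
  · rw [hn]
    intro u hu
    have huO : algebraMap F Ω u ∈ O := (O.valuation_le_one_iff _).1 hu
    let ub : resF O F.toSubfield := ⟨IsLocalRing.residue O ⟨_, huO⟩, ⟨_, huO⟩, u.2, rfl⟩
    have hub : ub ∈ IntermediateField.adjoin L {β} := by rw [hβ]; trivial
    rw [← IntermediateField.mem_toSubalgebra,
      IntermediateField.adjoin_simple_toSubalgebra_of_isAlgebraic hint.isAlgebraic,
      Algebra.adjoin_singleton_eq_range_aeval] at hub
    obtain ⟨p0, hp0⟩ := hub
    set p := p0 %ₘ minpoly L β with hp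
    have hpu : aeval β p = ub := by
      rw [← hp0, hp]
      exact aeval_modByMonic_eq_self_of_root (minpoly.aeval _ _)
    have hpd : p.natDegree < (minpoly L β).natDegree :=
      natDegree_modByMonic_lt _ (minpoly.monic hint) (minpoly.ne_one L β)
    refine ⟨fun i => algebraMap L E (p.coeff i), fun i => hvL _, ?_⟩
    rw [map_sub, hsumL]
    have hps : p = ∑ i : Fin (minpoly L β).natDegree, C (p.coeff i) * X ^ (i : ℕ) := by
      rw [Fin.sum_univ_eq_sum_range (fun i => C (p.coeff i) * X ^ i)]
      exact as_sum_range' p _ hpd |>.trans (by simp [C_mul_X_pow_eq_monomial])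
    rw [← hps]
    obtain ⟨hO1, -⟩ := resMap_aeval O F.toSubfield hLF hf.memO A hAF p
    let φ : L →+* O := RingHom.codRestrict (algebraMap L Ω) O.toSubring hf.memO
    have h1 : aeval (A : Ω) p = ((eval₂ φ A p : O) : Ω) := by
      rw [aeval_def]
      exact (hom_eval₂ p φ O.subtype A).symm
    have h2 : ((aeval β p : resF O F.toSubfield) : IsLocalRing.ResidueField O) =
        IsLocalRing.residue O (eval₂ φ A p) := by
      rw [hom_eval₂]
      exact hom_eval₂ p (resMap O F.toSubfield hLF hf.memO) (resF O F.toSubfield).subtype β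
    rw [hpu] at h2
    have h3 : IsLocalRing.residue O (⟨_, huO⟩ - eval₂ φ A p) = 0 := by
      rw [map_sub, ← h2, sub_self]
    rw [res_eq_zero] at h3
    rw [h1]; exact h3
  · rw [hn]
    intro a ha hs
    choose l hl using fun i => hf.res_red (ha i)
    have h1 : O.valuation (algebraMap F Ω (∑ i, algebraMap L E (l i) • α ^ (i : ℕ))) < 1 := by
      have : ∑ i, algebraMap L E (l i) • α ^ (i : ℕ) = ∑ i, a i • α ^ (i : ℕ) -
          ∑ i, (a i - algebraMap L E (l i)) • α ^ (i : ℕ) := by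
        simp [sub_smul]
      rw [this, map_sub]
      refine (O.valuation.map_sub _ _).trans_lt (max_lt hs ?_)
      rw [map_sum]
      refine Valuation.map_sum_lt _ one_ne_zero fun i _ => ?_
      rw [Algebra.smul_def, map_mul, map_mul, map_pow, map_pow, hvA, one_pow, mul_one,
        ← IsScalarTower.algebraMap_apply, map_sub, ← IsScalarTower.algebraMap_apply L E Ω]
      exact hl i
    rw [hsumL, ← (key _).2, hsumβ] at h1
    have h2 := Fintype.linearIndependent_iff.1 (linearIndependent_pow β) l h1
    intro i
    have h3 := hl i
    rw [h2 i, map_zero, sub_zero] at h3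
    exact h3

end

end LU

namespace LU

open LocalUnif Polynomial

section

variable {Ω : Type*} [Field Ω]

theorem exists_pow_val {Γ₀ : Type*} [LinearOrderedCommGroupWithZero Γ₀] {E : Type*} [Field E]
    [Algebra E Ω] (v : Valuation Ω Γ₀) {z : Ω} (hz : z ≠ 0) (hi : IsIntegral E z) :
    ∃ n : ℕ, 0 < n ∧ n ≤ (minpoly E z).natDegree ∧ ∃ a : E, a ≠ 0 ∧ v z ^ n = v (algebraMap E Ω a) := by
  classical
  set p := minpoly E z with hp
  let d := p.natDegree
  let T : ℕ → Ω := fun i => algebraMap E Ω (p.coeff i) * z ^ i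
  have h0 : ∑ i ∈ Finset.range (d + 1), T i = 0 := by
    have := minpoly.aeval E z
    rw [aeval_eq_sum_range] at this
    rw [← this]
    exact Finset.sum_congr rfl fun i _ => (Algebra.smul_def _ _).symm
  obtain ⟨i, hi1, hi2⟩ := Finset.exists_max_image (Finset.range (d + 1)) (fun i => v (T i))
    ⟨0, by simp⟩
  have hTd : T d = z ^ d := by
    have : p.coeff d = 1 := minpoly.monic hi
    simp [T, this]
  have hTi : v (T i) ≠ 0 := by
    have h := hi2 d (by simp)
    have h' : 0 < v (T d) := by
      rw [hTd]; exact zero_lt_iff.2 ((Valuation.ne_zero_iff _).2 (pow_ne_zero _ hz))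
    exact (h'.trans_le h).ne'
  obtain ⟨j, hj, hji, hij⟩ : ∃ j ∈ Finset.range (d + 1), j ≠ i ∧ v (T j) = v (T i) := by
    by_contra! hcon
    have h1 : v (∑ j ∈ (Finset.range (d + 1)).erase i, T j) < v (T i) :=
      Valuation.map_sum_lt _ hTi fun j hj => by
        rw [Finset.mem_erase] at hj
        exact (hi2 j hj.2).lt_of_ne (hcon j hj.2 hj.1)
    rw [← Finset.add_sum_erase _ _ hi1, add_eq_zero_iff_eq_neg] at h0
    rw [h0, Valuation.map_neg] at h1
    exact lt_irrefl _ h1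
  have key : ∀ a b : ℕ, a ≤ d → b ≤ d → a < b → v (T a) = v (T b) → v (T a) ≠ 0 →
      ∃ n : ℕ, 0 < n ∧ n ≤ d ∧ ∃ a : E, a ≠ 0 ∧ v z ^ n = v (algebraMap E Ω a) := by
    intro a b ha hb hab hT hT0
    have hT0b : v (T b) ≠ 0 := hT ▸ hT0
    have hca : p.coeff a ≠ 0 := fun h => hT0 (by simp [T, h])
    have hcb : p.coeff b ≠ 0 := fun h => hT0b (by simp [T, h])
    refine ⟨b - a, by omega, by omega, p.coeff a / p.coeff b, div_ne_zero hca hcb, ?_⟩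
    have hva : v (algebraMap E Ω (p.coeff b)) ≠ 0 := by simpa using hcb
    have hvz : v z ≠ 0 := by simpa using hz
    simp only [T, map_mul, map_pow] at hT
    rw [map_div₀, map_div₀, eq_div_iff hva]
    have hb' : v z ^ b = v z ^ (b - a) * v z ^ a := by rw [← pow_add]; congr 1; omega
    rw [hb', ← mul_assoc] at hT
    have := mul_right_cancel₀ (pow_ne_zero a hvz) hT
    rw [this, mul_comm]
  have hid : i ≤ d := by simpa [Nat.lt_succ_iff] using hi1
  have hjd : j ≤ d := by simpa [Nat.lt_succ_iff] using hj
  rcases lt_or_gt_of_ne hji with h | h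
  · exact key j i hjd hid h hij (hij ▸ hTi)
  · exact key i j hid hjd h hij.symm hTi

def ResInd {ι : Type*} (O : ValuationSubring Ω) (𝓚 : Subfield Ω) (y : ι → Ω) : Prop :=
  ∀ p : MvPolynomial ι 𝓚, p ≠ 0 → O.valuation (MvPolynomial.aeval y p) = 1

theorem ResInd.algInd {ι : Type*} {O : ValuationSubring Ω} {𝓚 : Subfield Ω} {y : ι → Ω}
    (h : ResInd O 𝓚 y) : AlgebraicIndependent 𝓚 y := by
  rw [algebraicIndependent_iff]
  intro p hp
  by_contra hp0
  have := h p hp0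
  rw [hp, map_zero] at this
  exact zero_ne_one this

theorem ResInd.triv {ι : Type*} {O : ValuationSubring Ω} {𝓚 : Subfield Ω} {y : ι → Ω}
    (h : ResInd O 𝓚 y) {l : Ω} (hl : l ∈ IntermediateField.adjoin 𝓚 (Set.range y)) (hl0 : l ≠ 0) :
    O.valuation l = 1 := by
  obtain ⟨r, s, rfl⟩ := (IntermediateField.mem_adjoin_range_iff 𝓚 y l).1 hl
  have hr : r ≠ 0 := by rintro rfl; simp at hl0
  have hs : s ≠ 0 := by rintro rfl; simp at hl0
  rw [map_div₀, h r hr, h s hs, div_one]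

abbrev LL {τ : ℕ} (𝓚 : Subfield Ω) (y : Fin τ → Ω) : IntermediateField 𝓚 Ω :=
  IntermediateField.adjoin 𝓚 (Set.range y)

abbrev EE {ρ τ : ℕ} (𝓚 : Subfield Ω) (x : Fin ρ → Ω) (y : Fin τ → Ω) :
    IntermediateField (LL 𝓚 y) Ω :=
  IntermediateField.adjoin (LL 𝓚 y) (Set.range x)

instance {ρ τ : ℕ} (𝓚 : Subfield Ω) (x : Fin ρ → Ω) (y : Fin τ → Ω) :
    IsScalarTower 𝓚 (EE 𝓚 x y) Ω := IsScalarTower.of_algebraMap_eq fun _ => rfl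

instance {ρ τ : ℕ} (𝓚 : Subfield Ω) (x : Fin ρ → Ω) (y : Fin τ → Ω) :
    IsScalarTower 𝓚 (LL 𝓚 y) (EE 𝓚 x y) := IsScalarTower.of_algebraMap_eq fun _ => rfl

def xE {ρ τ : ℕ} (𝓚 : Subfield Ω) (x : Fin ρ → Ω) (y : Fin τ → Ω) (i : Fin ρ) : EE 𝓚 x y :=
  ⟨x i, IntermediateField.subset_adjoin _ _ ⟨i, rfl⟩⟩

def yL {τ : ℕ} (𝓚 : Subfield Ω) (y : Fin τ → Ω) (i : Fin τ) : LL 𝓚 y :=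
  ⟨y i, IntermediateField.subset_adjoin _ _ ⟨i, rfl⟩⟩

theorem gen_self {k : Type*} [Field k] [Algebra k Ω] {ι : Type*} (u : ι → Ω)
    (a : IntermediateField.adjoin k (Set.range u)) :
    a ∈ IntermediateField.adjoin k (Set.range fun i =>
      (⟨u i, IntermediateField.subset_adjoin _ _ ⟨i, rfl⟩⟩ : IntermediateField.adjoin k (Set.range u))) := by
  have h := IntermediateField.adjoin_map k (Set.range fun i =>
      (⟨u i, IntermediateField.subset_adjoin _ _ ⟨i, rfl⟩⟩ : IntermediateField.adjoin k (Set.range u)))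
      (IntermediateField.adjoin k (Set.range u)).val
  rw [← Set.range_comp] at h
  have h2 : (a : Ω) ∈ IntermediateField.adjoin k (Set.range u) := a.2
  have h3 : ((IntermediateField.adjoin k (Set.range u)).val ∘ fun i =>
      (⟨u i, IntermediateField.subset_adjoin _ _ ⟨i, rfl⟩⟩ : IntermediateField.adjoin k (Set.range u))) = u := rfl
  rw [h3] at h
  obtain ⟨b, hb, hba⟩ := h.ge h2
  have : b = a := Subtype.ext hba
  exact this ▸ hb

theorem frame_of {ρ τ : ℕ} {O : ValuationSubring Ω} {𝓚 : Subfield Ω} {x : Fin ρ → Ω} {y : Fin τ → Ω}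
    (hx0 : ∀ i, x i ≠ 0) (hind : ∀ e, O.valuation (mon x e) = 1 → e = 0) (hy : ResInd O 𝓚 y) :
    Frame (LL 𝓚 y) (O.valuation.comap (algebraMap (EE 𝓚 x y) Ω)) (xE 𝓚 x y) where
  x_ne i := fun h => hx0 i (congrArg Subtype.val h)
  triv c hc := hy.triv c.2 (by simpa using hc)
  ind e he := by
    rw [Valuation.comap_apply, map_mon] at he
    exact hind e he
  gen a := gen_self x a

def FF {ρ τ : ℕ} {𝓚 : Subfield Ω} {x : Fin ρ → Ω} {y : Fin τ → Ω} (F₀ : IntermediateField 𝓚 Ω)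
    (hx : ∀ i, x i ∈ F₀) (hy : ∀ i, y i ∈ F₀) : IntermediateField (EE 𝓚 x y) Ω where
  toSubalgebra := { F₀.toSubfield.toSubring with
    algebraMap_mem' := fun e => by
      have h1 : LL 𝓚 y ≤ F₀ := IntermediateField.adjoin_le_iff.2 (by rintro _ ⟨i, rfl⟩; exact hy i)
      have h2 : EE 𝓚 x y ≤ IntermediateField.extendScalars h1 :=
        IntermediateField.adjoin_le_iff.2 (by rintro _ ⟨i, rfl⟩; exact hx i)
      exact h2 e.2 }
  inv_mem' := fun a ha => F₀.inv_mem ha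

theorem mem_FF {ρ τ : ℕ} {𝓚 : Subfield Ω} {x : Fin ρ → Ω} {y : Fin τ → Ω} (F₀ : IntermediateField 𝓚 Ω)
    (hx : ∀ i, x i ∈ F₀) (hy : ∀ i, y i ∈ F₀) (z : Ω) : z ∈ FF F₀ hx hy ↔ z ∈ F₀ := Iff.rfl

theorem FF_toSubfield {ρ τ : ℕ} {𝓚 : Subfield Ω} {x : Fin ρ → Ω} {y : Fin τ → Ω}
    (F₀ : IntermediateField 𝓚 Ω)
    (hx : ∀ i, x i ∈ F₀) (hy : ∀ i, y i ∈ F₀) : (FF F₀ hx hy).toSubfield = F₀.toSubfield := rfl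

theorem algInd_xy {ρ τ : ℕ} {O : ValuationSubring Ω} {𝓚 : Subfield Ω} {x : Fin ρ → Ω} {y : Fin τ → Ω}
    (hx0 : ∀ i, x i ≠ 0) (hind : ∀ e, O.valuation (mon x e) = 1 → e = 0) (hy : ResInd O 𝓚 y) :
    AlgebraicIndependent 𝓚 (Sum.elim x y) := by
  have h1 : AlgebraicIndependent (LL 𝓚 y) x :=
    ((frame_of hx0 hind hy).algInd).map' (f := (EE 𝓚 x y).val) Subtype.val_injective
  exact hy.algInd.sumElim_of_tower (by rintro _ ⟨i, rfl⟩; exact ⟨yL 𝓚 y i, rfl⟩) h1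

theorem finite_of {ρ τ : ℕ} {O : ValuationSubring Ω} {𝓚 : Subfield Ω} {x : Fin ρ → Ω} {y : Fin τ → Ω}
    (hx0 : ∀ i, x i ≠ 0) (hind : ∀ e, O.valuation (mon x e) = 1 → e = 0) (hy : ResInd O 𝓚 y)
    (F₀ : IntermediateField 𝓚 Ω) (hx : ∀ i, x i ∈ F₀) (hyF : ∀ i, y i ∈ F₀) (hfg : F₀.FG)
    (htr : Algebra.trdeg 𝓚 F₀ ≤ ((ρ + τ : ℕ) : Cardinal)) :
    FiniteDimensional (EE 𝓚 x y) (FF F₀ hx hyF) := by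
  classical
  let w : Fin ρ ⊕ Fin τ → F₀ := Sum.elim (fun i => ⟨x i, hx i⟩) (fun i => ⟨y i, hyF i⟩)
  have hw : AlgebraicIndependent 𝓚 w := by
    refine AlgebraicIndependent.of_comp F₀.val ?_
    convert algInd_xy hx0 hind hy using 1
    ext i; rcases i with i | i <;> rfl
  have htb : IsTranscendenceBasis 𝓚 w := by
    refine hw.isTranscendenceBasis_of_lift_trdeg_le (htr.trans_lt Cardinal.natCast_lt_aleph0) ?_
    simpa using htr
  have halg := htb.isAlgebraic_field
  have hint : ∀ z ∈ F₀, IsIntegral (EE 𝓚 x y) z := by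
    intro z hz
    have h1 : IsAlgebraic (IntermediateField.adjoin 𝓚 (Set.range w)) (⟨z, hz⟩ : F₀) :=
      Algebra.IsAlgebraic.isAlgebraic _
    have hle : ∀ c : IntermediateField.adjoin 𝓚 (Set.range w), ((c : F₀) : Ω) ∈ EE 𝓚 x y := by
      intro c
      have : ((c : F₀) : Ω) ∈ (IntermediateField.adjoin 𝓚 (Set.range w)).map F₀.val := ⟨_, c.2, rfl⟩
      rw [IntermediateField.adjoin_map] at this
      have h2 : IntermediateField.adjoin 𝓚 (F₀.val '' Set.range w) ≤
          (EE 𝓚 x y).restrictScalars 𝓚 := by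
        refine IntermediateField.adjoin_le_iff.2 ?_
        rintro _ ⟨_, ⟨i | i, rfl⟩, rfl⟩
        · exact (xE 𝓚 x y i).2
        · exact (algebraMap (LL 𝓚 y) (EE 𝓚 x y) (yL 𝓚 y i)).2
      exact h2 this
    let φ : IntermediateField.adjoin 𝓚 (Set.range w) →+* EE 𝓚 x y :=
      RingHom.codRestrict ((algebraMap F₀ Ω).comp (algebraMap _ F₀)) (EE 𝓚 x y).toSubfield hle
    obtain ⟨p, hp0, hp⟩ := h1
    refine IsAlgebraic.isIntegral ⟨p.map φ, (Polynomial.map_ne_zero_iff φ.injective).2 hp0, ?_⟩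
    have h3 : algebraMap F₀ Ω (aeval (⟨z, hz⟩ : F₀) p) = 0 := by rw [hp, map_zero]
    rw [aeval_def, hom_eval₂] at h3
    rw [aeval_def, eval₂_map]
    exact h3
  obtain ⟨S, hS⟩ := hfg
  have hSF : ∀ s ∈ S, s ∈ F₀ := fun s hs => hS ▸ IntermediateField.subset_adjoin _ _ hs
  have hFE : FF F₀ hx hyF = IntermediateField.adjoin (EE 𝓚 x y) (S : Set Ω) := by
    apply le_antisymm
    · intro z hz
      have hz : z ∈ F₀ := hz
      rw [← hS] at hz
      have : IntermediateField.adjoin 𝓚 (S : Set Ω) ≤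
          ((IntermediateField.adjoin (EE 𝓚 x y) (S : Set Ω)).restrictScalars 𝓚) :=
        IntermediateField.adjoin_le_iff.2 (IntermediateField.subset_adjoin (EE 𝓚 x y) (S : Set Ω))
      exact this hz
    · exact IntermediateField.adjoin_le_iff.2 fun s hs => hSF s hs
  rw [hFE]
  exact IntermediateField.finiteDimensional_adjoin fun s hs => hint s (hSF s hs)

end

end LU

namespace LU

open LocalUnif Polynomial

section

variable {Ω : Type*} [Field Ω]

theorem minpoly_bound {E : Type*} [Field E] [Algebra E Ω] (F : IntermediateField E Ω)
    [FiniteDimensional E F] {z : Ω} (hz : z ∈ F) :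
    IsIntegral E z ∧ (minpoly E z).natDegree ≤ Module.finrank E F := by
  let z' : F := ⟨z, hz⟩
  have hi' : IsIntegral E z' := Algebra.IsIntegral.isIntegral _
  refine ⟨hi'.map F.val, ?_⟩
  have hmp : minpoly E z = minpoly E z' := minpoly.algebraMap_eq F.val.injective z'
  rw [hmp]
  exact minpoly.natDegree_le z'

theorem norm_x {ρ τ : ℕ} {O : ValuationSubring Ω} {𝓚 : Subfield Ω} {x : Fin ρ → Ω} {y : Fin τ → Ω}
    (hx0 : ∀ i, x i ≠ 0) (hind : ∀ e, O.valuation (mon x e) = 1 → e = 0) (hy : ResInd O 𝓚 y)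
    (F₀ : IntermediateField 𝓚 Ω) (hx : ∀ i, x i ∈ F₀) (hyF : ∀ i, y i ∈ F₀) (hfg : F₀.FG)
    (htr : Algebra.trdeg 𝓚 F₀ ≤ ((ρ + τ : ℕ) : Cardinal)) :
    ∃ x' : Fin ρ → Ω, (∀ i, x' i ∈ F₀) ∧ (∀ i, x' i ≠ 0) ∧
      (∀ e, O.valuation (mon x' e) = 1 → e = 0) ∧
      ∀ z ∈ F₀, z ≠ 0 → ∃ e, O.valuation z = O.valuation (mon x' e) := by
  classical
  haveI := finite_of hx0 hind hy F₀ hx hyF hfg htr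
  have hf := frame_of hx0 hind hy
  let M := (Module.finrank (EE 𝓚 x y) (FF F₀ hx hyF)).factorial
  have hM : M ≠ 0 := Nat.factorial_ne_zero _
  have hpow : ∀ z ∈ F₀, z ≠ 0 → ∃ u, O.valuation z ^ M = O.valuation (mon x u) := by
    intro z hz hz0
    obtain ⟨hi, hb⟩ := minpoly_bound (FF F₀ hx hyF) hz
    obtain ⟨n, hn0, hn, a, ha0, ha⟩ := exists_pow_val O.valuation hz0 hi
    have hnM : n ∣ M := Nat.dvd_factorial hn0 (hn.trans hb)
    obtain ⟨q, hq⟩ := hnM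
    obtain ⟨e, c, -, -, hae⟩ := hf.hasLT a ha0
    rw [Valuation.comap_apply, Valuation.comap_apply, map_mon] at hae
    refine ⟨q • e, ?_⟩
    rw [hq, pow_mul, ha, hae, mon_nsmul, map_pow]
    rfl
  let G : AddSubgroup (Fin ρ → ℤ) :=
    { carrier := {u | ∃ z ∈ F₀, z ≠ 0 ∧ O.valuation z ^ M = O.valuation (mon x u)}
      zero_mem' := ⟨1, F₀.one_mem, one_ne_zero, by simp [mon_zero]⟩
      add_mem' := by
        rintro u w ⟨z, hz, hz0, hzu⟩ ⟨z', hz', hz0', hzu'⟩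
        exact ⟨z * z', F₀.mul_mem hz hz', mul_ne_zero hz0 hz0', by
          rw [map_mul, mul_pow, hzu, hzu', mon_add hx0, map_mul]⟩
      neg_mem' := by
        rintro u ⟨z, hz, hz0, hzu⟩
        exact ⟨z⁻¹, F₀.inv_mem hz, inv_ne_zero hz0, by rw [map_inv₀, inv_pow, hzu, mon_neg, map_inv₀]⟩ }
  let N : Submodule ℤ (Fin ρ → ℤ) := AddSubgroup.toIntSubmodule G
  have hN : ∀ u, u ∈ N ↔ ∃ z ∈ F₀, z ≠ 0 ∧ O.valuation z ^ M = O.valuation (mon x u) := fun u => Iff.rfl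
  obtain ⟨n, ⟨b⟩⟩ := Submodule.nonempty_basis_of_pid (Pi.basisFun ℤ (Fin ρ)) N
  have hn : n = ρ := by
    have h1 : Module.finrank ℤ N = n := by simp [Module.finrank_eq_card_basis b]
    have h2 : Module.finrank ℤ N ≤ ρ := (Submodule.finrank_le N).trans (by simp)
    have h3 : ρ ≤ Module.finrank ℤ N := by
      have hmem : ∀ i : Fin ρ, (M : ℤ) • (Pi.single i 1 : Fin ρ → ℤ) ∈ N := fun i =>
        (hN _).2 ⟨x i, hx i, hx0 i, by rw [mon_zsmul, mon_single, zpow_natCast, map_pow]⟩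
      have hli : LinearIndependent ℤ (fun i : Fin ρ => (⟨_, hmem i⟩ : N)) := by
        refine LinearIndependent.of_comp N.subtype ?_
        rw [Fintype.linearIndependent_iff]
        intro g hg i
        have := congrFun hg i
        simpa [Finset.sum_apply, Pi.single_apply, hM] using this
      simpa using hli.fintype_card_le_finrank
    omega
  subst hn
  choose x' hx'F hx'0 hx' using fun i => (hN _).1 (b i).2
  have hmon : ∀ e : Fin n → ℤ, O.valuation (mon x' e) ^ M =
      O.valuation (mon x (∑ i, e i • (b i : Fin n → ℤ))) := by
    intro e
    have h1 : ∀ s : Finset (Fin n), mon x (∑ i ∈ s, e i • (b i : Fin n → ℤ)) =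
        ∏ i ∈ s, mon x (b i) ^ e i := by
      intro s
      induction s using Finset.induction_on with
      | empty => simp [mon_zero]
      | insert a s ha ih => rw [Finset.sum_insert ha, Finset.prod_insert ha, mon_add hx0, ih, mon_zsmul]
    rw [h1, mon, map_prod, map_prod, ← Finset.prod_pow]
    refine Finset.prod_congr rfl fun i _ => ?_
    rw [map_zpow₀, map_zpow₀, ← hx' i, ← zpow_natCast, ← zpow_natCast, ← zpow_mul, ← zpow_mul, mul_comm]
  refine ⟨x', hx'F, hx'0, fun e he => ?_, fun z hz hz0 => ?_⟩
  · have h1 := hmon e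
    rw [he, one_pow] at h1
    have h2 := hind _ h1.symm
    have h3 : ∑ i, e i • b i = 0 := by
      apply Subtype.ext
      simpa using h2
    exact funext (Fintype.linearIndependent_iff.1 b.linearIndependent e h3)
  · obtain ⟨u, hu⟩ := hpow z hz hz0
    let u' : N := ⟨u, (hN u).2 ⟨z, hz, hz0, hu⟩⟩
    refine ⟨b.repr u', ?_⟩
    have h1 : ∑ i, b.repr u' i • (b i : Fin n → ℤ) = u := by
      have := congrArg N.subtype (b.sum_repr u')
      rw [map_sum] at this
      exact this
    have h2 := hmon (b.repr u')
    rw [h1, ← hu] at h2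
    exact ((pow_left_inj₀ zero_le zero_le hM).1 h2).symm

theorem resMap_mvaeval {L : Type*} [Field L] [Algebra L Ω] (O : ValuationSubring Ω) (F : Subfield Ω)
    (hF : ∀ l : L, algebraMap L Ω l ∈ F) (hO : ∀ l : L, algebraMap L Ω l ∈ O) {ι : Type*}
    (A : ι → O) (hA : ∀ i, (A i : Ω) ∈ F) (p : MvPolynomial ι L) :
    MvPolynomial.aeval (fun i => (A i : Ω)) p ∈ O ∧
    (MvPolynomial.eval₂ (resMap O F hF hO) (fun i => ⟨IsLocalRing.residue O (A i), A i, hA i, rfl⟩) p = 0 ↔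
      O.valuation (MvPolynomial.aeval (fun i => (A i : Ω)) p) < 1) := by
  let φ : L →+* O := RingHom.codRestrict (algebraMap L Ω) O.toSubring hO
  have h1 : MvPolynomial.aeval (fun i => (A i : Ω)) p = ((MvPolynomial.eval₂ φ A p : O) : Ω) := by
    rw [MvPolynomial.aeval_def]
    exact (MvPolynomial.eval₂_comp_left O.subtype φ A p).symm
  refine ⟨h1 ▸ (MvPolynomial.eval₂ φ A p : O).2, ?_⟩
  rw [h1, ← res_eq_zero, MvPolynomial.eval₂_comp_left, Subtype.ext_iff]
  have := MvPolynomial.eval₂_comp_left (resF O F).subtype (resMap O F hF hO)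
    (fun i => ⟨IsLocalRing.residue O (A i), A i, hA i, rfl⟩) p
  rw [Subfield.subtype_apply] at this
  rw [this]; rfl

end

end LU

namespace LU

open LocalUnif Polynomial

section

theorem exists_sep {k R : Type*} [Field k] [PerfectField k] [Field R] [Algebra k R]
    [Algebra.EssFiniteType k R] {τ : ℕ} {y₀ : Fin τ → R} (hy₀ : AlgebraicIndependent k y₀) :
    ∃ (τ' : ℕ) (y : Fin τ' → R), τ ≤ τ' ∧ AlgebraicIndependent k y ∧
      Algebra.IsSeparable (IntermediateField.adjoin k (Set.range y)) R := by
  classical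
  obtain ⟨s, hs, hsep⟩ := exists_isTranscendenceBasis_and_isSeparable_of_perfectField k R
  let e : Fin s.card ≃ s := s.equivFin.symm
  have hr : Set.range (fun i => (e i : R)) = (s : Set R) := by
    have : (fun i => (e i : R)) = Subtype.val ∘ e := rfl
    rw [this, e.surjective.range_comp]; exact Subtype.range_coe
  refine ⟨s.card, fun i => (e i : R), ?_, hs.1.comp e e.injective, ?_⟩
  · have h1 := hy₀.lift_cardinalMk_le_trdeg
    have h2 := hs.lift_cardinalMk_eq_trdeg
    simp only [Cardinal.mk_fin, Cardinal.lift_natCast, Cardinal.lift_id, Cardinal.lift_uzero] at h1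
    rw [← Cardinal.lift_le.{0}] at h1
    rw [← hs.cardinalMk_eq_trdeg] at h1
    simpa using h1
  · rw [hr]; exact hsep

variable {Ω : Type*} [Field Ω]

theorem LL_le {τ : ℕ} {𝓚 : Subfield Ω} {y : Fin τ → Ω} {F₀ : IntermediateField 𝓚 Ω}
    (hyF : ∀ i, y i ∈ F₀) (l : LL 𝓚 y) : algebraMap (LL 𝓚 y) Ω l ∈ F₀.toSubfield :=
  (IntermediateField.adjoin_le_iff.2 (by rintro _ ⟨i, rfl⟩; exact hyF i) : LL 𝓚 y ≤ F₀) l.2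

theorem sep_tower {k L R : Type*} [Field k] [Field L] [Field R] [Algebra k L] [Algebra k R] [Algebra L R]
    [IsScalarTower k L R] {ι : Type*} {y : ι → L}
    (h : Algebra.IsSeparable (IntermediateField.adjoin k (Set.range fun i => algebraMap L R (y i))) R) :
    Algebra.IsSeparable L R := by
  let Φ : L →ₐ[k] R := IsScalarTower.toAlgHom k L R
  have hle : IntermediateField.adjoin k (Set.range fun i => algebraMap L R (y i)) ≤ Φ.fieldRange :=
    IntermediateField.adjoin_le_iff.2 (by rintro _ ⟨i, rfl⟩; exact ⟨y i, rfl⟩)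
  let e : L ≃ₐ[k] Φ.fieldRange := AlgEquiv.ofInjectiveField Φ
  let ψ := (e.symm : Φ.fieldRange →+* L).comp (IntermediateField.inclusion hle).toRingHom
  letI := ψ.toAlgebra
  haveI : IsScalarTower (IntermediateField.adjoin k (Set.range fun i => algebraMap L R (y i))) L R := by
    refine IsScalarTower.of_algebraMap_eq fun c => ?_
    have h1 : e (ψ c) = IntermediateField.inclusion hle c := e.apply_symm_apply _
    exact (congrArg Subtype.val h1).symm
  exact Algebra.isSeparable_tower_top_of_isSeparable
    (IntermediateField.adjoin k (Set.range fun i => algebraMap L R (y i))) L R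

theorem norm_y {ρ τ : ℕ} {O : ValuationSubring Ω} {𝓚 : Subfield Ω} [PerfectField 𝓚]
    {x : Fin ρ → Ω} {y : Fin τ → Ω} (hO : ∀ c : 𝓚, algebraMap 𝓚 Ω c ∈ O)
    (hx0 : ∀ i, x i ≠ 0) (hind : ∀ e, O.valuation (mon x e) = 1 → e = 0) (hy : ResInd O 𝓚 y)
    (F₀ : IntermediateField 𝓚 Ω) (hx : ∀ i, x i ∈ F₀) (hyF : ∀ i, y i ∈ F₀) (hyO : ∀ i, y i ∈ O)
    (hfg : F₀.FG) (htr : Algebra.trdeg 𝓚 F₀ ≤ ((ρ + τ : ℕ) : Cardinal)) :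
    ∃ (τ' : ℕ) (y' : Fin τ' → Ω) (hyF' : ∀ i, y' i ∈ F₀) (_ : ∀ i, y' i ∈ O) (hy' : ResInd O 𝓚 y'),
      τ ≤ τ' ∧ ∀ hO : ∀ l : LL 𝓚 y', algebraMap (LL 𝓚 y') Ω l ∈ O,
        letI := (resMap O F₀.toSubfield (LL_le hyF') hO).toAlgebra
        Algebra.IsSeparable (LL 𝓚 y') (resF O F₀.toSubfield) := by
  classical
  have hf := frame_of hx0 hind hy
  haveI := finite_of hx0 hind hy F₀ hx hyF hfg htr
  letI iL := (resMap O F₀.toSubfield (LL_le hyF) hf.memO).toAlgebra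
  have hfin : Module.Finite (LL 𝓚 y) (resF O F₀.toSubfield) := hf.resF_finite (FF F₀ hx hyF) (LL_le hyF)
  have hKF : ∀ c : 𝓚, algebraMap 𝓚 Ω c ∈ F₀.toSubfield := fun c => F₀.algebraMap_mem c
  letI iK := (resMap O F₀.toSubfield hKF hO).toAlgebra
  haveI : IsScalarTower 𝓚 (LL 𝓚 y) (resF O F₀.toSubfield) := IsScalarTower.of_algebraMap_eq fun _ => rfl
  haveI : Algebra.EssFiniteType 𝓚 (LL 𝓚 y) :=
    IntermediateField.essFiniteType_iff.2 (IntermediateField.fg_adjoin_of_finite (Set.finite_range y))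
  haveI : Algebra.EssFiniteType 𝓚 (resF O F₀.toSubfield) := Algebra.EssFiniteType.comp _ (LL 𝓚 y) _
  have hval1 : ∀ z : Ω, z ∈ O → ¬ O.valuation z < 1 → O.valuation z = 1 := fun z hz hz1 =>
    ((O.valuation_le_one_iff _).2 hz).eq_of_not_lt hz1
  have hy₀ : AlgebraicIndependent 𝓚 (fun i => (⟨IsLocalRing.residue O ⟨y i, hyO i⟩, ⟨y i, hyO i⟩, hyF i, rfl⟩ :
      resF O F₀.toSubfield)) := by
    rw [algebraicIndependent_iff]
    intro p hp
    by_contra hp0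
    have h1 := ((resMap_mvaeval O F₀.toSubfield hKF hO (fun i => ⟨y i, hyO i⟩) hyF p).2).1 hp
    have h2 := hy p hp0
    exact h1.ne h2
  obtain ⟨τ', c, hτ, hc, hsep⟩ := exists_sep hy₀
  choose B hBF hB using fun i => (c i).2
  have hBc : (fun i => (⟨IsLocalRing.residue O (B i), B i, hBF i, rfl⟩ : resF O F₀.toSubfield)) = c :=
    funext fun i => Subtype.ext (hB i)
  refine ⟨τ', fun i => B i, hBF, fun i => (B i).2, ?_, hτ, ?_⟩
  · intro p hp
    have h := resMap_mvaeval O F₀.toSubfield hKF hO B hBF p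
    refine hval1 _ h.1 fun h1 => ?_
    have h2 := h.2.2 h1
    rw [hBc] at h2
    exact hp (algebraicIndependent_iff.1 hc p h2)
  · intro hO'
    letI := (resMap O F₀.toSubfield (LL_le (y := fun i => (B i : Ω)) hBF) hO').toAlgebra
    haveI : IsScalarTower 𝓚 (LL 𝓚 fun i => (B i : Ω)) (resF O F₀.toSubfield) :=
      IsScalarTower.of_algebraMap_eq fun _ => rfl
    have hcy : c = fun i => algebraMap (LL 𝓚 fun i => (B i : Ω)) (resF O F₀.toSubfield)
        (yL 𝓚 (fun i => (B i : Ω)) i) := hBc.symm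
    rw [hcy] at hsep
    exact sep_tower hsep

set_option maxHeartbeats 1000000 in
theorem unif_perfect [IsAlgClosed Ω] {ρ τ : ℕ} {O : ValuationSubring Ω} {𝓚 : Subfield Ω} [PerfectField 𝓚]
    {x : Fin ρ → Ω} {y : Fin τ → Ω} (hO : ∀ c ∈ 𝓚, c ∈ O)
    (hx0 : ∀ i, x i ≠ 0) (hind : ∀ e, O.valuation (mon x e) = 1 → e = 0) (hy : ResInd O 𝓚 y)
    (F₀ : IntermediateField 𝓚 Ω) (hx : ∀ i, x i ∈ F₀) (hyF : ∀ i, y i ∈ F₀) (hyO : ∀ i, y i ∈ O)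
    (hfg : F₀.FG) (htr : Algebra.trdeg 𝓚 F₀ ≤ ((ρ + τ : ℕ) : Cardinal))
    {m : ℕ} (ζ : Fin m → Ω) (hζF : ∀ k, ζ k ∈ F₀) (hζ : ∀ k, ζ k ∈ O) :
    UnifWrt F₀.toSubfield 𝓚 O ζ := by
  obtain ⟨x', hxF', hx0', hind', hval'⟩ := norm_x hx0 hind hy F₀ hx hyF hfg htr
  obtain ⟨τ', y', hyF', hyO', hy', hτ, hsep⟩ :=
    norm_y (fun c => hO c c.2) hx0 hind hy F₀ hx hyF hyO hfg htr
  have htr' : Algebra.trdeg 𝓚 F₀ ≤ ((ρ + τ' : ℕ) : Cardinal) :=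
    htr.trans (Nat.cast_le.2 (by omega))
  haveI := finite_of hx0' hind' hy' F₀ hxF' hyF' hfg htr'
  have hf := frame_of hx0' hind' hy'
  obtain ⟨α, g, hα⟩ := hf.exists_resGen (FF F₀ hxF' hyF') (LL_le hyF') (hsep hf.memO) (by
    intro z hz
    obtain ⟨e, he⟩ := hval' z z.2 (by simpa using hz)
    refine ⟨mon (xE 𝓚 x' y') e, ?_⟩
    rw [map_mon]; exact he)
  have h := unif_core O 𝓚 hf (y := yL 𝓚 y')
    (AlgebraicIndependent.of_comp (LL 𝓚 y').val hy'.algInd) (gen_self y') hα hO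
    (fun k => (⟨ζ k, hζF k⟩ : FF F₀ hxF' hyF')) hζ
  have he : (algebraMap (FF F₀ hxF' hyF') Ω).fieldRange = F₀.toSubfield := by
    ext z
    constructor
    · rintro ⟨a, rfl⟩; exact a.2
    · intro hz; exact ⟨⟨z, hz⟩, rfl⟩
  rw [he] at h
  exact h

end

end LU

namespace LU

open LocalUnif Polynomial

section

variable {Ω : Type*} [Field Ω]

theorem isAlg_mono {A B M N : Type*} [Field A] [Field B] [Field M] [Field N] [Algebra A M] [Algebra B N]
    (φ : M →+* N) {z : M}
    (h : ∀ a : B, ∃ b : A, φ (algebraMap A M b) = algebraMap B N a) (hz : IsAlgebraic B (φ z)) :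
    IsAlgebraic A z := by
  choose g hg using h
  obtain ⟨p, hp0, hp⟩ := hz
  have hinj : ∀ a, g a = 0 → a = 0 := fun a ha => by
    have := hg a
    rw [ha, map_zero, map_zero] at this
    exact ((map_eq_zero _).1 this.symm)
  let q : A[X] := ∑ i ∈ p.support, C (g (p.coeff i)) * X ^ i
  have hq : q.map (φ.comp (algebraMap A M)) = p.map (algebraMap B N) := by
    conv_rhs => rw [p.as_sum_support_C_mul_X_pow]
    simp only [q, Polynomial.map_sum, Polynomial.map_mul, Polynomial.map_pow, map_C, map_X,
      RingHom.comp_apply, hg]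
  refine ⟨q, fun h0 => hp0 ?_, ?_⟩
  · rw [h0, Polynomial.map_zero] at hq
    exact (Polynomial.map_eq_zero_iff (algebraMap B N).injective).1 hq.symm
  · apply φ.injective
    rw [map_zero, ← hp, aeval_def, aeval_def, hom_eval₂, ← eval_map, ← eval_map, hq]

theorem algInd_mono {A B M N ι : Type*} [Field A] [Field B] [Field M] [Field N] [Algebra A M] [Algebra B N]
    (φ : M →+* N) (ψ : A →+* B) (h : ∀ a : A, φ (algebraMap A M a) = algebraMap B N (ψ a))
    {t : ι → M} (ht : AlgebraicIndependent B (fun i => φ (t i))) : AlgebraicIndependent A t := by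
  rw [algebraicIndependent_iff] at ht ⊢
  intro p hp
  refine (MvPolynomial.map_injective ψ ψ.injective) ?_
  rw [map_zero]
  refine ht _ ?_
  rw [MvPolynomial.aeval_def, MvPolynomial.eval₂_map]
  have h1 : φ (MvPolynomial.aeval t p) = 0 := by rw [hp, map_zero]
  rw [MvPolynomial.aeval_def, MvPolynomial.eval₂_comp_left] at h1
  rw [← h1]
  congr 1
  ext a; exact (h a).symm

theorem subfield_fin {A B : Set Ω} {z : Ω} (hz : z ∈ Subfield.closure (A ∪ B)) :
    ∃ T : Finset Ω, (T : Set Ω) ⊆ B ∧ z ∈ Subfield.closure (A ∪ T) := by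
  classical
  have mono : ∀ {T T' : Finset Ω} {w : Ω}, T ⊆ T' → w ∈ Subfield.closure (A ∪ T) →
      w ∈ Subfield.closure (A ∪ T') := fun hT hw =>
    Subfield.closure_mono (Set.union_subset_union_right A (Finset.coe_subset.2 hT)) hw
  induction hz using Subfield.closure_induction with
  | mem x hx =>
    rcases hx with hx | hx
    · exact ⟨∅, by simp, Subfield.subset_closure (Or.inl hx)⟩
    · exact ⟨{x}, by simpa using hx, Subfield.subset_closure (Or.inr (by simp))⟩
  | one => exact ⟨∅, by simp, Subfield.one_mem _⟩
  | add x y _ _ hx hy =>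
    obtain ⟨T, hT, h1⟩ := hx
    obtain ⟨T', hT', h2⟩ := hy
    exact ⟨T ∪ T', by simp [hT, hT'], Subfield.add_mem _ (mono Finset.subset_union_left h1)
      (mono Finset.subset_union_right h2)⟩
  | mul x y _ _ hx hy =>
    obtain ⟨T, hT, h1⟩ := hx
    obtain ⟨T', hT', h2⟩ := hy
    exact ⟨T ∪ T', by simp [hT, hT'], Subfield.mul_mem _ (mono Finset.subset_union_left h1)
      (mono Finset.subset_union_right h2)⟩
  | neg x _ hx =>
    obtain ⟨T, hT, h1⟩ := hx
    exact ⟨T, hT, Subfield.neg_mem _ h1⟩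
  | inv x _ hx =>
    obtain ⟨T, hT, h1⟩ := hx
    exact ⟨T, hT, Subfield.inv_mem _ h1⟩

theorem subring_fin {A B : Set Ω} {z : Ω} (hz : z ∈ Subring.closure (A ∪ B)) :
    ∃ T : Finset Ω, (T : Set Ω) ⊆ B ∧ z ∈ Subring.closure (A ∪ T) := by
  classical
  have mono : ∀ {T T' : Finset Ω} {w : Ω}, T ⊆ T' → w ∈ Subring.closure (A ∪ T) →
      w ∈ Subring.closure (A ∪ T') := fun hT hw =>
    Subring.closure_mono (Set.union_subset_union_right A (Finset.coe_subset.2 hT)) hw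
  induction hz using Subring.closure_induction with
  | mem x hx =>
    rcases hx with hx | hx
    · exact ⟨∅, by simp, Subring.subset_closure (Or.inl hx)⟩
    · exact ⟨{x}, by simpa using hx, Subring.subset_closure (Or.inr (by simp))⟩
  | zero => exact ⟨∅, by simp, Subring.zero_mem _⟩
  | one => exact ⟨∅, by simp, Subring.one_mem _⟩
  | add x y _ _ hx hy =>
    obtain ⟨T, hT, h1⟩ := hx
    obtain ⟨T', hT', h2⟩ := hy
    exact ⟨T ∪ T', by simp [hT, hT'], Subring.add_mem _ (mono Finset.subset_union_left h1)
      (mono Finset.subset_union_right h2)⟩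
  | mul x y _ _ hx hy =>
    obtain ⟨T, hT, h1⟩ := hx
    obtain ⟨T', hT', h2⟩ := hy
    exact ⟨T ∪ T', by simp [hT, hT'], Subring.mul_mem _ (mono Finset.subset_union_left h1)
      (mono Finset.subset_union_right h2)⟩
  | neg x _ hx =>
    obtain ⟨T, hT, h1⟩ := hx
    exact ⟨T, hT, Subring.neg_mem _ h1⟩

theorem descend {Kh K F : Subfield Ω} {O : ValuationSubring Ω} (hKh : ∀ c ∈ Kh, IsAlgebraic K c)
    (hKK : K ≤ Kh) (S : Finset Ω) (hS : F = Subfield.closure ((K : Set Ω) ∪ S))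
    (hO : ∀ c ∈ Kh, c ∈ O) {m : ℕ} {ζ : Fin m → Ω}
    (h : UnifWrt (Subfield.closure ((F : Set Ω) ∪ Kh)) Kh O ζ) :
    ∃ C : Finset Ω, (C : Set Ω) ⊆ Kh ∧
      UnifWrt (Subfield.closure ((F : Set Ω) ∪ C)) (Subfield.closure ((K : Set Ω) ∪ C)) O ζ := by
  classical
  obtain ⟨s, n, t, η, ⟨ht, hη, hAI, hAlg, hcl, f, hf1, hf2, hf3, hf4⟩, σ, hσ⟩ := h
  choose Ct hCt1 hCt2 using fun i => subfield_fin (ht i).1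
  choose Cn hCn1 hCn2 using fun i => subfield_fin (hη i).1
  have hSF : ∀ g ∈ S, g ∈ F := fun g hg => hS ▸ Subfield.subset_closure (Or.inr hg)
  have hSg : ∀ g : S, (g : Ω) ∈ Subfield.closure ((Set.range t ∪ Set.range η) ∪ (Kh : Set Ω)) := by
    intro g
    have : (g : Ω) ∈ Subfield.closure ((F : Set Ω) ∪ Kh) := Subfield.subset_closure (Or.inl (hSF g g.2))
    rw [← hcl] at this
    refine Subfield.closure_mono ?_ this
    rintro z ((hz | hz) | hz)
    · exact Or.inr hz
    · exact Or.inl (Or.inl hz)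
    · exact Or.inl (Or.inr hz)
  choose Cs hCs1 hCs2 using fun g => subfield_fin (hSg g)
  have hfc : ∀ (i : Fin n) (a : (f i).support), (f i).coeff a ∈
      Subring.closure (Set.range t ∪ (Kh : Set Ω)) := by
    intro i a
    refine Subring.closure_mono ?_ (hf1 i a)
    rintro z (hz | hz)
    · exact Or.inr hz.1
    · exact Or.inl hz
  choose Cf hCf1 hCf2 using fun i a => subring_fin (hfc i a)
  let C : Finset Ω := (Finset.univ.biUnion Ct ∪ Finset.univ.biUnion Cn) ∪
    (Finset.univ.biUnion Cs ∪ Finset.univ.biUnion fun i => Finset.univ.biUnion (Cf i))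
  have hCK : (C : Set Ω) ⊆ Kh := by
    intro z hz
    simp only [C, Finset.mem_coe, Finset.mem_union, Finset.mem_biUnion, Finset.mem_univ, true_and] at hz
    rcases hz with (⟨i, hz⟩ | ⟨i, hz⟩) | (⟨i, hz⟩ | ⟨i, a, hz⟩)
    · exact hCt1 i hz
    · exact hCn1 i hz
    · exact hCs1 i hz
    · exact hCf1 i a hz
  have hCt : ∀ i, (Ct i : Set Ω) ⊆ C := fun i z hz => by
    simp only [C, Finset.mem_coe, Finset.mem_union, Finset.mem_biUnion, Finset.mem_univ, true_and]
    exact Or.inl (Or.inl ⟨i, hz⟩)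
  have hCn : ∀ i, (Cn i : Set Ω) ⊆ C := fun i z hz => by
    simp only [C, Finset.mem_coe, Finset.mem_union, Finset.mem_biUnion, Finset.mem_univ, true_and]
    exact Or.inl (Or.inr ⟨i, hz⟩)
  have hCs : ∀ i, (Cs i : Set Ω) ⊆ C := fun i z hz => by
    simp only [C, Finset.mem_coe, Finset.mem_union, Finset.mem_biUnion, Finset.mem_univ, true_and]
    exact Or.inr (Or.inl ⟨i, hz⟩)
  have hCf : ∀ i a, (Cf i a : Set Ω) ⊆ C := fun i a z hz => by
    simp only [C, Finset.mem_coe, Finset.mem_union, Finset.mem_biUnion, Finset.mem_univ, true_and]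
    exact Or.inr (Or.inr ⟨i, a, hz⟩)
  set k := Subfield.closure ((K : Set Ω) ∪ C) with hk
  have hkK : k ≤ Kh := Subfield.closure_le.2 (Set.union_subset hKK hCK)
  have hKk : ∀ z ∈ K, z ∈ k := fun z hz => Subfield.subset_closure (Or.inl hz)
  have hCk : ∀ z ∈ C, z ∈ k := fun z hz => Subfield.subset_closure (Or.inr hz)
  have hKF : ∀ z ∈ K, z ∈ F := fun z hz => hS ▸ Subfield.subset_closure (Or.inl hz)
  set FC := Subfield.closure ((F : Set Ω) ∪ C) with hFC
  have hFCF : FC ≤ Subfield.closure ((F : Set Ω) ∪ Kh) :=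
    Subfield.closure_mono (Set.union_subset_union_right _ hCK)
  have htF : ∀ i, t i ∈ FC := fun i =>
    Subfield.closure_mono (Set.union_subset_union_right _ (hCt i)) (hCt2 i)
  have hηF : ∀ i, η i ∈ FC := fun i =>
    Subfield.closure_mono (Set.union_subset_union_right _ (hCn i)) (hCn2 i)
  refine ⟨C, hCK, s, n, t, η, ⟨fun i => ⟨htF i, (ht i).2⟩, fun i => ⟨hηF i, (hη i).2⟩,
    ?_, ?_, ?_, f, ?_, hf2, hf3, hf4⟩, σ, hσ⟩
  · exact algInd_mono (RingHom.id Ω) (Subfield.inclusion hkK) (fun _ => rfl) hAI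
  · intro z hz
    set A := IntermediateField.adjoin k (Set.range t) with hA
    have h1 := hAlg z (hFCF hz)
    have h2 : IsAlgebraic (algebraicClosure A Ω) z := by
      refine isAlg_mono (RingHom.id Ω) ?_ h1
      intro a
      suffices h3 : (a : Ω) ∈ algebraicClosure A Ω from ⟨⟨a, h3⟩, rfl⟩
      obtain ⟨a, ha⟩ := a
      show a ∈ _
      induction ha using IntermediateField.adjoin_induction with
      | mem x hx =>
        exact IntermediateField.algebraMap_mem (algebraicClosure A Ω)
          (⟨x, IntermediateField.subset_adjoin _ _ hx⟩ : A)
      | algebraMap c =>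
        rw [mem_algebraicClosure_iff]
        refine isAlg_mono (RingHom.id Ω) ?_ (hKh c c.2)
        intro b
        exact ⟨⟨b, IntermediateField.algebraMap_mem A (⟨b, hKk b b.2⟩ : k)⟩, rfl⟩
      | add x y _ _ hx hy => exact add_mem hx hy
      | mul x y _ _ hx hy => exact mul_mem hx hy
      | inv x _ hx => exact inv_mem hx
    exact h2.restrictScalars A
  · apply le_antisymm
    · refine Subfield.closure_le.2 ?_
      rintro z ((hz | ⟨i, rfl⟩) | ⟨i, rfl⟩)
      · refine Subfield.closure_mono ?_ hz
        exact Set.union_subset_union_left _ hKF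
      · exact htF i
      · exact hηF i
    · have hkk : ∀ z ∈ k, z ∈ Subfield.closure ((k : Set Ω) ∪ Set.range t ∪ Set.range η) := fun z hz =>
        Subfield.subset_closure (Or.inl (Or.inl hz))
      refine Subfield.closure_le.2 (Set.union_subset ?_ fun z hz => hkk z (hCk z hz))
      have : F ≤ Subfield.closure ((k : Set Ω) ∪ Set.range t ∪ Set.range η) := by
        rw [hS]
        refine Subfield.closure_le.2 (Set.union_subset (fun z hz => hkk z (hKk z hz)) fun g hg => ?_)
        refine (Subfield.closure_le.2 ?_ :
          Subfield.closure ((Set.range t ∪ Set.range η) ∪ (Cs ⟨g, hg⟩ : Set Ω)) ≤ _) (hCs2 ⟨g, hg⟩)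
        rintro z ((hz | hz) | hz)
        · exact Subfield.subset_closure (Or.inl (Or.inr hz))
        · exact Subfield.subset_closure (Or.inr hz)
        · exact hkk z (hCk z (hCs _ hz))
      exact this
  · intro i a
    by_cases ha : a ∈ (f i).support
    · refine Subring.closure_mono ?_ (hCf2 i ⟨a, ha⟩)
      rintro z (hz | hz)
      · exact Or.inr hz
      · exact Or.inl ⟨hCk z (hCf i _ hz), hO z (hCf1 i _ hz)⟩
    · rw [MvPolynomial.notMem_support_iff.1 ha]
      exact Subring.zero_mem _

end

end LU

namespace LU

open LocalUnif Polynomial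

section

theorem isVUnit_comap {M Ω : Type*} [Field M] [Field Ω] (φ : M →+* Ω) (O : ValuationSubring Ω) (z : M) :
    IsVUnit (O.comap φ) z ↔ IsVUnit O (φ z) := by
  simp [IsVUnit, ValuationSubring.mem_comap]

theorem inMax_comap {M Ω : Type*} [Field M] [Field Ω] (φ : M →+* Ω) (O : ValuationSubring Ω) (z : M) :
    InMax (O.comap φ) z ↔ InMax O (φ z) := by
  simp [InMax, ValuationSubring.mem_comap]

theorem unif_pull {M Ω : Type*} [Field M] [Field Ω] (φ : M →+* Ω) (𝓚 : Subfield Ω)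
    (hK : 𝓚 ≤ φ.fieldRange) (O : ValuationSubring Ω) {m : ℕ} (ζ : Fin m → M)
    (h : UnifWrt φ.fieldRange 𝓚 O (fun k => φ (ζ k))) :
    UnifWrt ⊤ (𝓚.comap φ) (O.comap φ) ζ := by
  classical
  obtain ⟨s, n, t, η, ⟨ht, hη, hAI, hAlg, hcl, f, hf1, hf2, hf3, hf4⟩, σ, hσ⟩ := h
  choose t' ht' using fun i => (ht i).1
  choose η' hη' using fun i => (hη i).1
  have htt : (fun i => φ (t' i)) = t := funext ht'
  have hηη : (fun i => φ (η' i)) = η := funext hη'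
  have hkey : ∀ a ∈ IntermediateField.adjoin 𝓚 (Set.range t),
      ∃ b ∈ IntermediateField.adjoin (𝓚.comap φ) (Set.range t'), φ b = a := by
    intro a ha
    induction ha using IntermediateField.adjoin_induction with
    | mem x hx =>
      obtain ⟨i, rfl⟩ := hx
      exact ⟨t' i, IntermediateField.subset_adjoin _ _ ⟨i, rfl⟩, ht' i⟩
    | algebraMap c =>
      obtain ⟨b, hb⟩ := hK c.2
      exact ⟨b, IntermediateField.algebraMap_mem _ (⟨b, by
        rw [Subfield.mem_comap, hb]; exact c.2⟩ : 𝓚.comap φ), hb⟩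
    | add x y _ _ hx hy =>
      obtain ⟨a, ha, rfl⟩ := hx
      obtain ⟨b, hb, rfl⟩ := hy
      exact ⟨a + b, add_mem ha hb, map_add _ _ _⟩
    | mul x y _ _ hx hy =>
      obtain ⟨a, ha, rfl⟩ := hx
      obtain ⟨b, hb, rfl⟩ := hy
      exact ⟨a * b, mul_mem ha hb, map_mul _ _ _⟩
    | inv x _ hx =>
      obtain ⟨a, ha, rfl⟩ := hx
      exact ⟨a⁻¹, inv_mem ha, map_inv₀ _ _⟩
  have hring : ∀ a ∈ Subring.closure ((↑(𝓚.toSubring ⊓ O.toSubring) : Set Ω) ∪ Set.range t),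
      ∃ b ∈ Subring.closure ((↑((𝓚.comap φ).toSubring ⊓ (O.comap φ).toSubring) : Set M) ∪ Set.range t'),
        φ b = a := by
    intro a ha
    induction ha using Subring.closure_induction with
    | mem x hx =>
      rcases hx with hx | ⟨i, rfl⟩
      · obtain ⟨b, rfl⟩ := hK hx.1
        exact ⟨b, Subring.subset_closure (Or.inl hx), rfl⟩
      · exact ⟨t' i, Subring.subset_closure (Or.inr ⟨i, rfl⟩), ht' i⟩
    | zero => exact ⟨0, zero_mem _, map_zero _⟩
    | one => exact ⟨1, one_mem _, map_one _⟩
    | add x y _ _ hx hy =>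
      obtain ⟨a, ha, rfl⟩ := hx
      obtain ⟨b, hb, rfl⟩ := hy
      exact ⟨a + b, add_mem ha hb, map_add _ _ _⟩
    | mul x y _ _ hx hy =>
      obtain ⟨a, ha, rfl⟩ := hx
      obtain ⟨b, hb, rfl⟩ := hy
      exact ⟨a * b, mul_mem ha hb, map_mul _ _ _⟩
    | neg x _ hx =>
      obtain ⟨a, ha, rfl⟩ := hx
      exact ⟨-a, neg_mem ha, map_neg _ _⟩
  have hf' : ∀ i, ∃ g : MvPolynomial (Fin n) M, MvPolynomial.map φ g = f i := by
    intro i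
    have : f i ∈ Set.range (MvPolynomial.map φ : MvPolynomial (Fin n) M → _) := by
      rw [MvPolynomial.mem_range_map_iff_coeffs_subset]
      intro c hc
      rw [Finset.mem_coe, MvPolynomial.mem_coeffs_iff] at hc
      obtain ⟨a, -, rfl⟩ := hc
      obtain ⟨b, -, hb⟩ := hring _ (hf1 i a)
      exact ⟨b, hb⟩
    exact this
  choose g hg using hf'
  refine ⟨s, n, t', η', ⟨fun i => ⟨trivial, ?_⟩, fun i => ⟨trivial, ?_⟩, ?_, ?_, ?_, g, ?_, ?_, ?_, ?_⟩, σ, ?_⟩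
  · rw [ValuationSubring.mem_comap, ht']; exact (ht i).2
  · rw [ValuationSubring.mem_comap, hη']; exact (hη i).2
  · refine algInd_mono (B := 𝓚) φ (RingHom.codRestrict (φ.comp (𝓚.comap φ).subtype) 𝓚 fun a => a.2)
      (fun a => rfl) ?_
    rw [htt]; exact hAI
  · intro z _
    refine isAlg_mono φ ?_ (hAlg (φ z) ⟨z, rfl⟩)
    intro a
    obtain ⟨b, hb, hba⟩ := hkey a a.2
    exact ⟨⟨b, hb⟩, hba⟩
  · rw [eq_top_iff]
    intro z _
    have hz : φ z ∈ φ.fieldRange := ⟨z, rfl⟩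
    rw [← hcl] at hz
    have hle : Subfield.closure ((𝓚 : Set Ω) ∪ Set.range t ∪ Set.range η) ≤
        (Subfield.closure ((𝓚.comap φ : Set M) ∪ Set.range t' ∪ Set.range η')).map φ := by
      refine Subfield.closure_le.2 ?_
      rintro w ((hw | ⟨i, rfl⟩) | ⟨i, rfl⟩)
      · obtain ⟨b, rfl⟩ := hK hw
        exact ⟨b, Subfield.subset_closure (Or.inl (Or.inl hw)), rfl⟩
      · exact ⟨t' i, Subfield.subset_closure (Or.inl (Or.inr ⟨i, rfl⟩)), ht' i⟩
      · exact ⟨η' i, Subfield.subset_closure (Or.inr ⟨i, rfl⟩), hη' i⟩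
    obtain ⟨b, hb, hbz⟩ := hle hz
    exact φ.injective hbz ▸ hb
  · intro i a
    have h1 := hf1 i a
    obtain ⟨b, hb, hb2⟩ := hring _ h1
    rw [← hg i, MvPolynomial.coeff_map] at hb2
    exact φ.injective hb2 ▸ hb
  · intro i j hij
    have := hf2 i j hij
    rw [← hg i] at this
    rw [← this, MvPolynomial.degreeOf_eq_sup, MvPolynomial.degreeOf_eq_sup,
      MvPolynomial.support_map_of_injective _ φ.injective]
  · intro i
    apply φ.injective
    rw [map_zero, ← hf3 i, ← hg i, MvPolynomial.eval_map, ← hηη]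
    exact MvPolynomial.eval₂_comp_left φ (RingHom.id M) η' (g i)
  · rw [isVUnit_comap, RingHom.map_det]
    convert hf4 using 2
    ext i j
    simp only [RingHom.mapMatrix_apply, Matrix.map_apply, Matrix.of_apply]
    rw [← hg i, MvPolynomial.pderiv_map, MvPolynomial.eval_map, ← hηη]
    exact MvPolynomial.eval₂_comp_left φ (RingHom.id M) η' _
  · intro k
    apply φ.injective
    rw [hη', hσ]

end

end LU

namespace LU

open LocalUnif Polynomial

section

theorem extend_val {F Ω : Type*} [Field F] [Field Ω] (φ : F →+* Ω) (O : ValuationSubring F) :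
    ∃ O' : ValuationSubring Ω, O'.comap φ = O := by
  obtain ⟨A, h, hl⟩ := IsLocalRing.exists_factor_valuationRing (φ.comp (algebraMap O F))
  refine ⟨A, ?_⟩
  ext z
  rw [ValuationSubring.mem_comap]
  constructor
  · intro hz
    by_contra hzO
    have hz0 : z ≠ 0 := by rintro rfl; exact hzO O.zero_mem
    have hzi : z⁻¹ ∈ O := (O.mem_or_inv_mem z).resolve_left hzO
    have hu : IsUnit (⟨z⁻¹, hzi⟩ : O) := by
      apply hl.1
      refine IsUnit.of_mul_eq_one (⟨φ z, hz⟩ : A.toSubring) (Subtype.ext ?_)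
      change φ z⁻¹ * φ z = 1
      rw [← map_mul, inv_mul_cancel₀ hz0, map_one]
    obtain ⟨w, hw⟩ := hu.exists_right_inv
    have hw' : z⁻¹ * (w : F) = 1 := congrArg Subtype.val hw
    apply hzO
    have : z = w := by
      field_simp at hw'
      exact hw'.symm
    rw [this]; exact w.2
  · intro hz
    exact h ⟨z, hz⟩

theorem trdeg_le_alg {F Ω : Type*} [Field F] [Field Ω] [Algebra F Ω] [Algebra.IsAlgebraic F Ω]
    (K : Subfield F) (Kh : Subfield Ω) (hK : ∀ c ∈ K, algebraMap F Ω c ∈ Kh) {d : ℕ} (t : Fin d → F)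
    (ht : IsTranscendenceBasis K t) : Algebra.trdeg Kh Ω ≤ (d : Cardinal) := by
  have h1 : Algebra.IsAlgebraic (Algebra.adjoin K (Set.range t)) F := ht.isAlgebraic
  have h2 : Algebra.IsAlgebraic (Algebra.adjoin K (Set.range t)) Ω := Algebra.IsAlgebraic.trans _ F _
  set s : Set Ω := Set.range (fun i => algebraMap F Ω (t i))
  have h3 : ∀ z : Algebra.adjoin K (Set.range t), algebraMap F Ω z ∈ Algebra.adjoin Kh s := by
    rintro ⟨z, hz⟩
    change algebraMap F Ω z ∈ _
    induction hz using Algebra.adjoin_induction with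
    | mem x hx => obtain ⟨i, rfl⟩ := hx; exact Algebra.subset_adjoin ⟨i, rfl⟩
    | algebraMap r => exact Subalgebra.algebraMap_mem _ (⟨_, hK r r.2⟩ : Kh)
    | add x y _ _ hx hy => rw [map_add]; exact add_mem hx hy
    | mul x y _ _ hx hy => rw [map_mul]; exact mul_mem hx hy
  let f : Algebra.adjoin K (Set.range t) →+* Algebra.adjoin Kh s :=
    ((algebraMap F Ω).comp (algebraMap (Algebra.adjoin K (Set.range t)) F)).codRestrict
      (Algebra.adjoin Kh s) h3
  have hf : Function.Injective f := by
    intro a b hab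
    exact Subtype.ext ((algebraMap F Ω).injective (congrArg Subtype.val hab))
  have h4 : Algebra.IsAlgebraic (Algebra.adjoin Kh s) Ω := by
    constructor
    intro z
    exact (h2.isAlgebraic z).ringHom_of_comp_eq f (RingHom.id Ω) hf rfl
  refine (Algebra.IsAlgebraic.trdeg_le_cardinalMk Kh s).trans ?_
  have := Cardinal.mk_range_le_lift (f := fun i => algebraMap F Ω (t i))
  simpa using this

theorem resInd_insep {Ω : Type*} [Field Ω] {O : ValuationSubring Ω} {K Kh : Subfield Ω} (q : ℕ) [ExpChar Ω q]
    (hle : K ≤ Kh) (hq : ∀ c ∈ Kh, ∃ n : ℕ, c ^ q ^ n ∈ K) {τ : ℕ} {y : Fin τ → Ω}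
    (hy : ResInd O K y) : ResInd O Kh y := by
  haveI : ExpChar Kh q := (algebraMap Kh Ω).expChar (algebraMap Kh Ω).injective q
  have key : ∀ p : MvPolynomial (Fin τ) Kh, ∃ n0 : ℕ, ∀ n ≥ n0,
      p ^ q ^ n ∈ (MvPolynomial.map (σ := Fin τ) (Subfield.inclusion hle)).range := by
    intro p
    induction p using MvPolynomial.induction_on with
    | C a =>
      obtain ⟨n, hn⟩ := hq a a.2
      refine ⟨n, fun k hk => ?_⟩
      obtain ⟨j, rfl⟩ := Nat.exists_eq_add_of_le hk
      refine ⟨MvPolynomial.C (⟨_, hn⟩ ^ q ^ j), ?_⟩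
      rw [MvPolynomial.map_C, ← map_pow]
      congr 1
      apply Subtype.ext
      change ((a : Ω) ^ q ^ n) ^ q ^ j = (a : Ω) ^ q ^ (n + j)
      rw [← pow_mul, pow_add]
    | add p r hp hr =>
      obtain ⟨a, ha⟩ := hp
      obtain ⟨b, hb⟩ := hr
      refine ⟨max a b, fun n hn => ?_⟩
      rw [add_pow_expChar_pow]
      exact add_mem (ha n (le_trans (le_max_left _ _) hn)) (hb n (le_trans (le_max_right _ _) hn))
    | mul_X p i hp =>
      obtain ⟨a, ha⟩ := hp
      refine ⟨a, fun n hn => ?_⟩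
      rw [mul_pow]
      refine mul_mem (ha n hn) (pow_mem (RingHom.mem_range.2 ⟨MvPolynomial.X i, by simp⟩) _)
  intro p hp
  obtain ⟨n, hn⟩ := key p
  obtain ⟨p', hp'⟩ := hn n le_rfl
  have hp0 : p' ≠ 0 := by
    rintro rfl
    rw [map_zero] at hp'
    exact hp (pow_eq_zero_iff (pow_ne_zero _ (expChar_pos Ω q).ne') |>.1 hp'.symm)
  have h1 := hy p' hp0
  have h2 : MvPolynomial.aeval y p' = (MvPolynomial.aeval y p) ^ q ^ n := by
    rw [← map_pow, ← hp', MvPolynomial.aeval_def, MvPolynomial.aeval_def, MvPolynomial.eval₂_map]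
    rfl
  rw [h2, map_pow] at h1
  exact (pow_eq_one_iff.1 h1).resolve_right (pow_ne_zero _ (expChar_pos Ω q).ne')

theorem resInd_of {F Ω : Type*} [Field F] [Field Ω] (φ : F →+* Ω) (O : ValuationSubring Ω) (K : Subfield F)
    (htriv : TrivialOn (O.comap φ) K) {τ : ℕ} {y : Fin τ → F} (hy : ResIndep (O.comap φ) K y) :
    ResInd O (K.map φ) (fun i => φ (y i)) := by
  intro p hp
  let e : K ≃+* K.map φ := K.equivMapOfInjective φ φ.injective
  let P : MvPolynomial (Fin τ) F := MvPolynomial.map ((algebraMap K F).comp (e.symm : K.map φ →+* K)) p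
  have hinj : Function.Injective ((algebraMap K F).comp (e.symm : K.map φ →+* K)) := RingHom.injective _
  have h1 := hy.2 P (fun m => by
    have : P.coeff m ∈ K := by
      rw [MvPolynomial.coeff_map]; exact Subtype.prop _
    exact ⟨this, (htriv _ this).1⟩) (by
    obtain ⟨m, hm⟩ := MvPolynomial.ne_zero_iff.1 hp
    have : P.coeff m ∈ K := by
      rw [MvPolynomial.coeff_map]; exact Subtype.prop _
    refine ⟨m, ?_, (htriv _ this).1, (htriv _ this).2⟩
    rw [MvPolynomial.coeff_map]
    exact (map_ne_zero_iff _ hinj).2 hm)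
  have h2 : MvPolynomial.aeval (fun i => φ (y i)) p = φ (MvPolynomial.eval y P) := by
    rw [MvPolynomial.eval_map, MvPolynomial.hom_eval₂, MvPolynomial.aeval_def]
    congr 1
    ext c
    exact (congrArg Subtype.val (e.apply_symm_apply c)).symm
  rw [inMax_comap, ← h2, inMax_iff, not_lt] at h1
  refine le_antisymm ?_ h1
  rw [ValuationSubring.valuation_le_one_iff, h2, ← ValuationSubring.mem_comap]
  rw [MvPolynomial.eval_eq]
  refine sum_mem fun m _ => mul_mem ?_ (prod_mem fun i _ => pow_mem (hy.1 i) _)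
  refine (htriv _ ?_).1
  rw [MvPolynomial.coeff_map]; exact Subtype.prop _

end

end LU

namespace LU

open LocalUnif Polynomial

section

theorem fin_adj {M : Type*} [Field M] (K0 𝓚 : Subfield M) (C : Finset M) (hle : K0 ≤ 𝓚)
    (h : 𝓚 = Subfield.closure ((K0 : Set M) ∪ C)) (hC : ∀ c ∈ C, IsAlgebraic K0 c) :
    letI : Algebra ↥K0 ↥𝓚 := (Subfield.inclusion hle).toAlgebra
    FiniteDimensional ↥K0 ↥𝓚 := by
  letI : Algebra ↥K0 ↥𝓚 := (Subfield.inclusion hle).toAlgebra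
  haveI : FiniteDimensional K0 (IntermediateField.adjoin K0 (C : Set M)) :=
    IntermediateField.finiteDimensional_adjoin (fun c hc => (hC c hc).isIntegral)
  have hmem : ∀ z, z ∈ IntermediateField.adjoin K0 (C : Set M) ↔ z ∈ 𝓚 := by
    intro z
    have hr : Set.range (algebraMap K0 M) = (K0 : Set M) := Subtype.range_coe
    rw [h, ← hr]
    rfl
  let f : IntermediateField.adjoin K0 (C : Set M) →ₗ[K0] 𝓚 :=
    { toFun := fun z => ⟨z, (hmem z).1 z.2⟩
      map_add' := fun a b => rfl
      map_smul' := fun c a => by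
        rw [Algebra.smul_def, Algebra.smul_def]; rfl }
  exact Module.Finite.of_surjective f (fun z => ⟨⟨z, (hmem z).2 z.2⟩, rfl⟩)

theorem fin_top {M : Type*} [Field M] (S : Subfield M) (h : S = ⊤) : FiniteDimensional S M := by
  refine Module.Finite.of_surjective (Algebra.linearMap S M) (fun z => ⟨⟨z, ?_⟩, rfl⟩)
  rw [h]; trivial

set_option maxHeartbeats 1000000 in
theorem main_core {F Ω : Type*} [Field F] [Field Ω] [Algebra F Ω] [Algebra.IsAlgebraic F Ω] [IsAlgClosed Ω]
    (K : Subfield F) (O : ValuationSubring F)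
    (hff : IsFunctionField K) (htriv : TrivialOn O K)
    (habh : IsAbhyankar O K)
    (m : ℕ) (ζ : Fin m → F) (hζ : ∀ k, ζ k ∈ O) :
    ∃ (O' : ValuationSubring Ω) (C : Finset Ω), O'.comap (algebraMap F Ω) = O ∧
      (∀ c ∈ Subfield.closure ((K.map (algebraMap F Ω) : Set Ω) ∪ C),
        ∃ n : ℕ, c ^ ringExpChar F ^ n ∈ K.map (algebraMap F Ω)) ∧
      UnifWrt (Subfield.closure (((algebraMap F Ω).fieldRange : Set Ω) ∪ C))
        (Subfield.closure ((K.map (algebraMap F Ω) : Set Ω) ∪ C)) O' (fun k => algebraMap F Ω (ζ k)) := by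
  classical
  obtain ⟨O', hO'⟩ := extend_val (algebraMap F Ω) O
  obtain ⟨⟨S, hS⟩, -⟩ := hff
  obtain ⟨d, ρ, τ, rfl, ⟨t, ht⟩, ⟨⟨x, hx0, hx⟩, -⟩, ⟨⟨y, hy⟩, -⟩⟩ := habh
  set φ := algebraMap F Ω with hφ
  set K' := K.map φ with hK'
  set q := ringExpChar F with hq
  haveI : ExpChar F q := ringExpChar.of_eq rfl
  haveI : ExpChar Ω q := expChar_of_injective_ringHom φ.injective q
  haveI : ExpChar K' q := (algebraMap K' Ω).expChar (algebraMap K' Ω).injective q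
  let Kh : Subfield Ω := (perfectClosure K' Ω).toSubfield
  haveI : PerfectField Kh := perfectClosure.perfectField K' Ω
  have hKK : K' ≤ Kh := fun c hc => (perfectClosure K' Ω).algebraMap_mem ⟨c, hc⟩
  have hKq : ∀ c ∈ Kh, ∃ n : ℕ, c ^ q ^ n ∈ K' := by
    intro c hc
    obtain ⟨n, ⟨b, hb⟩⟩ := (mem_perfectClosure_iff_pow_mem q).1 (show c ∈ perfectClosure K' Ω from hc)
    exact ⟨n, hb ▸ b.2⟩
  have hqn : ∀ n, q ^ n ≠ 0 := fun n => pow_ne_zero _ (expChar_pos Ω q).ne'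
  have hKalg : ∀ c ∈ Kh, IsAlgebraic K' c := by
    intro c hc
    obtain ⟨n, hn⟩ := hKq c hc
    exact IsAlgebraic.of_pow (Nat.pos_of_ne_zero (hqn n)) (isAlgebraic_algebraMap (⟨_, hn⟩ : K'))
  have hK'O : ∀ c ∈ K', c ∈ O' := by
    rintro _ ⟨c, hc, rfl⟩
    rw [← ValuationSubring.mem_comap, hO']
    exact (htriv c hc).1
  have hO : ∀ c ∈ Kh, c ∈ O' := by
    intro c hc
    obtain ⟨n, hn⟩ := hKq c hc
    have := hK'O _ hn
    rw [← ValuationSubring.valuation_le_one_iff, map_pow] at this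
    rw [← ValuationSubring.valuation_le_one_iff]
    exact (pow_le_one_iff (hqn n)).1 this
  have hSF : φ.fieldRange = Subfield.closure ((K' : Set Ω) ∪ (S.image φ : Finset Ω)) := by
    have h1 : (⊤ : Subfield F) = Subfield.closure ((K : Set F) ∪ S) := by
      have hr : Set.range (algebraMap K F) = (K : Set F) := Subtype.range_coe
      rw [← hr]
      exact (congrArg IntermediateField.toSubfield hS).symm
    rw [RingHom.fieldRange_eq_map, h1, RingHom.map_field_closure, Set.image_union, Finset.coe_image]
    rfl
  let F₀ : IntermediateField Kh Ω := IntermediateField.adjoin Kh ((S.image φ : Finset Ω) : Set Ω)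
  have hF₀ : F₀.toSubfield = Subfield.closure ((φ.fieldRange : Set Ω) ∪ Kh) := by
    have hr : Set.range (algebraMap Kh Ω) = (Kh : Set Ω) := Subtype.range_coe
    have h1 : F₀.toSubfield = Subfield.closure ((Kh : Set Ω) ∪ (S.image φ : Finset Ω)) := by
      rw [← hr]; rfl
    rw [h1]
    apply le_antisymm
    · rw [Subfield.closure_le]
      rintro z (hz | hz)
      · exact Subfield.subset_closure (Or.inr hz)
      · refine Subfield.subset_closure (Or.inl ?_)
        rw [hSF]; exact Subfield.subset_closure (Or.inr hz)
    · rw [Subfield.closure_le]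
      rintro z (hz | hz)
      · rw [hSF] at hz
        exact Subfield.closure_mono (Set.union_subset_union_left _ hKK) hz
      · exact Subfield.subset_closure (Or.inl hz)
  have hFF : ∀ z : F, φ z ∈ F₀ := by
    intro z
    change φ z ∈ F₀.toSubfield
    rw [hF₀]
    exact Subfield.subset_closure (Or.inl ⟨z, rfl⟩)
  have hOO : ∀ z ∈ O, φ z ∈ O' := fun z hz => by rwa [← ValuationSubring.mem_comap, hO']
  subst hO'
  have hyR : ResInd O' Kh (fun i => φ (y i)) := resInd_insep q hKK hKq (resInd_of φ O' K htriv hy)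
  have htr : Algebra.trdeg Kh F₀ ≤ ((ρ + τ : ℕ) : Cardinal) :=
    (trdeg_le_of_injective F₀.val F₀.val.injective).trans
      (trdeg_le_alg K Kh (fun c hc => hKK ⟨c, hc, rfl⟩) t ht)
  have hU : UnifWrt F₀.toSubfield Kh O' (fun k => φ (ζ k)) := by
    refine unif_perfect (x := fun i => φ (x i)) (y := fun i => φ (y i)) hO
      (fun i => (map_ne_zero φ).2 (hx0 i)) ?_ hyR F₀ (fun i => hFF _) (fun i => hFF _)
      (fun i => hOO _ (hy.1 i)) ?_ htr _ (fun k => hFF _) (fun k => hOO _ (hζ k))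
    · intro e he
      refine hx e ⟨1, K.one_mem, one_ne_zero, ?_⟩
      rw [div_one, isVUnit_comap, isVUnit_iff, ← he]
      simp [mon]
    · exact ⟨S.image φ, rfl⟩
  rw [hF₀] at hU
  obtain ⟨C, hC, hU⟩ := descend hKalg hKK _ hSF hO hU
  refine ⟨O', C, rfl, ?_, hU⟩
  intro c hc
  apply hKq
  have : Subfield.closure ((K' : Set Ω) ∪ C) ≤ Kh := Subfield.closure_le.2 (Set.union_subset hKK hC)
  exact this hc

end

end LU

namespace LU

open LocalUnif

set_option synthInstance.maxHeartbeats 400000 in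
set_option maxHeartbeats 1000000 in
theorem final {F Ω : Type*} [Field F] [Field Ω] [Algebra F Ω] (K : Subfield F) (O : ValuationSubring F)
    (C : Finset Ω) (O' : ValuationSubring Ω) (hO' : O'.comap (algebraMap F Ω) = O)
    (hq : ∀ c ∈ Subfield.closure ((K.map (algebraMap F Ω) : Set Ω) ∪ C),
        ∃ n : ℕ, c ^ ringExpChar F ^ n ∈ K.map (algebraMap F Ω))
    {m : ℕ} {ζ : Fin m → F}
    (hU : UnifWrt (Subfield.closure (((algebraMap F Ω).fieldRange : Set Ω) ∪ C))
        (Subfield.closure ((K.map (algebraMap F Ω) : Set Ω) ∪ C)) O' (fun k => algebraMap F Ω (ζ k)))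
    (𝓕 : IntermediateField F Ω) (h𝓕 : 𝓕 = IntermediateField.adjoin F (C : Set Ω)) {r : ℕ} (hr : 1 < r) :
    ∃ (Q : ValuationSubring ↥𝓕)
      (𝓚 : Subfield ↥𝓕),
      Q.comap (algebraMap F ↥𝓕) = O ∧
      (∃ hle : K.map (algebraMap F ↥𝓕) ≤ 𝓚,
        (letI : Algebra ↥(K.map (algebraMap F ↥𝓕)) ↥𝓚 := (Subfield.inclusion hle).toAlgebra
         FiniteDimensional ↥(K.map (algebraMap F ↥𝓕)) ↥𝓚) ∧
        ∀ x ∈ 𝓚, ∃ nn : ℕ, x ^ ringExpChar F ^ nn ∈ K.map (algebraMap F ↥𝓕)) ∧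
      FiniteDimensional ↥((algebraMap F ↥𝓕).fieldRange ⊔ 𝓚) ↥𝓕 ∧
      (∃ k : ℕ,
        (ResidueAlgebraic O K → k + 1 ≤ r) ∧ k ≤ r ∧
        ∃ Ls : Fin (k + 1) → Subfield ↥𝓕,
          Ls 0 = (algebraMap F ↥𝓕).fieldRange ⊔ 𝓚 ∧
          Ls (Fin.last k) = ⊤ ∧
          ∀ i : Fin k, ∃ hst : Ls i.castSucc ≤ Ls i.succ,
            letI : Algebra ↥(Ls i.castSucc) ↥(Ls i.succ) :=
              (Subfield.inclusion hst).toAlgebra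
            IsGalois ↥(Ls i.castSucc) ↥(Ls i.succ)) ∧
      UnifWrt (F := ↥𝓕) ⊤ 𝓚 Q (fun k => algebraMap F ↥𝓕 (ζ k)) := by
  classical
  set ψ : 𝓕 →+* Ω := algebraMap 𝓕 Ω with hψ
  have hinj : Function.Injective ψ := ψ.injective
  have hcomp : ∀ z, ψ (algebraMap F 𝓕 z) = algebraMap F Ω z := fun z => rfl
  have hCF : ∀ c ∈ C, c ∈ 𝓕 := fun c hc => by rw [h𝓕]; exact IntermediateField.subset_adjoin F _ hc
  have hmemF : ∀ z, z ∈ 𝓕 ↔ z ∈ Subfield.closure (((algebraMap F Ω).fieldRange : Set Ω) ∪ C) := by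
    intro z
    rw [h𝓕, RingHom.coe_fieldRange]
    rfl
  have hrange : ψ.fieldRange = Subfield.closure (((algebraMap F Ω).fieldRange : Set Ω) ∪ C) := by
    ext z
    rw [← hmemF]
    exact ⟨by rintro ⟨a, rfl⟩; exact a.2, fun h => ⟨⟨z, h⟩, rfl⟩⟩
  let C0 : Finset 𝓕 := C.attach.image (fun c => ⟨c.1, hCF c.1 c.2⟩)
  have hC0 : ψ '' (C0 : Set 𝓕) = C := by
    ext z
    constructor
    · rintro ⟨a, ha, rfl⟩
      obtain ⟨c, -, rfl⟩ := Finset.mem_image.1 ha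
      exact c.2
    · intro hz
      exact ⟨⟨z, hCF z hz⟩, Finset.mem_image.2 ⟨⟨z, hz⟩, Finset.mem_attach _ _, rfl⟩, rfl⟩
  set K0 := K.map (algebraMap F 𝓕) with hK0
  have hK0m : ψ '' (K0 : Set 𝓕) = K.map (algebraMap F Ω) := by
    ext z
    constructor
    · rintro ⟨_, ⟨c, hc, rfl⟩, rfl⟩; exact ⟨c, hc, rfl⟩
    · rintro ⟨c, hc, rfl⟩; exact ⟨_, ⟨c, hc, rfl⟩, rfl⟩
  let 𝓚 : Subfield 𝓕 := Subfield.closure ((K0 : Set 𝓕) ∪ C0)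
  have h𝓚map : 𝓚.map ψ = Subfield.closure ((K.map (algebraMap F Ω) : Set Ω) ∪ C) := by
    rw [RingHom.map_field_closure, Set.image_union, hC0, hK0m]
  have h𝓚 : (Subfield.closure ((K.map (algebraMap F Ω) : Set Ω) ∪ C)).comap ψ = 𝓚 := by
    rw [← h𝓚map]
    exact Subfield.comap_map _ _
  have hle : K0 ≤ 𝓚 := fun z hz => Subfield.subset_closure (Or.inl hz)
  have hins : ∀ x ∈ 𝓚, ∃ nn : ℕ, x ^ ringExpChar F ^ nn ∈ K0 := by
    intro x hx
    obtain ⟨n, hn⟩ := hq (ψ x) (by rw [← h𝓚map]; exact ⟨x, hx, rfl⟩)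
    refine ⟨n, ?_⟩
    rw [← map_pow] at hn
    obtain ⟨c, hc, hcx⟩ := hn
    exact ⟨c, hc, hinj hcx⟩
  have htop : (algebraMap F 𝓕).fieldRange ⊔ 𝓚 = ⊤ := by
    rw [eq_top_iff]
    intro z _
    have h1 : Subfield.closure (((algebraMap F Ω).fieldRange : Set Ω) ∪ C) ≤
        ((algebraMap F 𝓕).fieldRange ⊔ 𝓚).map ψ := by
      rw [Subfield.closure_le]
      rintro w (⟨a, rfl⟩ | hw)
      · exact ⟨algebraMap F 𝓕 a, (le_sup_left : _ ≤ (algebraMap F 𝓕).fieldRange ⊔ 𝓚) ⟨a, rfl⟩, rfl⟩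
      · rw [← hC0] at hw
        obtain ⟨b, hb, rfl⟩ := hw
        exact ⟨b, (le_sup_right : _ ≤ (algebraMap F 𝓕).fieldRange ⊔ 𝓚) (Subfield.subset_closure (Or.inr hb)), rfl⟩
    obtain ⟨b, hb, hbz⟩ := h1 ((hmemF _).1 z.2)
    exact hinj hbz ▸ hb
  refine ⟨O'.comap ψ, 𝓚, ?_, ⟨hle, ?_, hins⟩, fin_top _ htop, ⟨0, fun _ => hr.le, Nat.zero_le _,
    fun _ => (algebraMap F 𝓕).fieldRange ⊔ 𝓚, rfl, htop, fun i => i.elim0⟩, ?_⟩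
  · rw [← hO']; rfl
  · refine fin_adj K0 𝓚 C0 hle rfl (fun c hc => ?_)
    obtain ⟨n, hn⟩ := hins c (Subfield.subset_closure (Or.inr hc))
    haveI : ExpChar F (ringExpChar F) := ringExpChar.of_eq rfl
    exact IsAlgebraic.of_pow (pow_pos (expChar_pos F (ringExpChar F)) n)
      (isAlgebraic_algebraMap (⟨_, hn⟩ : K0))
  · rw [← h𝓚]
    apply unif_pull ψ
    · rw [hrange]
      refine Subfield.closure_mono (Set.union_subset_union_left _ ?_)
      rintro _ ⟨c, -, rfl⟩
      exact ⟨c, rfl⟩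
    · rw [hrange]
      exact hU

end LU

set_option synthInstance.maxHeartbeats 400000 in
set_option maxHeartbeats 1000000 in
open LocalUnif in
/-- Theorem 1.11 of the paper. Let `P` be an Abhyankar place of
rank `r > 1` of the function field `F|K` and `ζ₁,…,ζ_m ∈ 𝓞_F`. Then there exist a
finite purely inseparable extension `𝓚` of `K` and a finite extension `𝓕` of the
compositum `F.𝓚` (all inside a fixed algebraic closure of `F`), with an extension
of the valuation, such that `(𝓕|𝓚, P)` is uniformizable with respect to the `ζ`'s
and `𝓕` is obtained from `F.𝓚` by a tower of at most `r - 1` successive Galois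
extensions if `P` is zero-dimensional, and at most `r` Galois extensions
otherwise. -/
theorem statement_19
    (F : Type*) [Field F] (K : Subfield F) (O : ValuationSubring F)
    (hff : IsFunctionField K) (htriv : TrivialOn O K)
    (habh : IsAbhyankar O K)
    (r : ℕ) (hr : 1 < r) (hrank : RankEq O r)
    (m : ℕ) (ζ : Fin m → F) (hζ : ∀ k, ζ k ∈ O) :
    ∃ (𝓕 : IntermediateField F (AlgebraicClosure F)) (Q : ValuationSubring ↥𝓕)
      (𝓚 : Subfield ↥𝓕),
      Q.comap (algebraMap F ↥𝓕) = O ∧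
      -- `𝓚` is a finite purely inseparable extension of (the image of) `K`
      (∃ hle : K.map (algebraMap F ↥𝓕) ≤ 𝓚,
        (letI : Algebra ↥(K.map (algebraMap F ↥𝓕)) ↥𝓚 := (Subfield.inclusion hle).toAlgebra
         FiniteDimensional ↥(K.map (algebraMap F ↥𝓕)) ↥𝓚) ∧
        ∀ x ∈ 𝓚, ∃ nn : ℕ, x ^ ringExpChar F ^ nn ∈ K.map (algebraMap F ↥𝓕)) ∧
      -- `𝓕` is a finite extension of the compositum `F.𝓚`
      FiniteDimensional ↥((algebraMap F ↥𝓕).fieldRange ⊔ 𝓚) ↥𝓕 ∧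
      -- tower of at most `r - 1` (resp. `r`) Galois extensions from `F.𝓚` up to `𝓕`
      (∃ k : ℕ,
        (ResidueAlgebraic O K → k + 1 ≤ r) ∧ k ≤ r ∧
        ∃ Ls : Fin (k + 1) → Subfield ↥𝓕,
          Ls 0 = (algebraMap F ↥𝓕).fieldRange ⊔ 𝓚 ∧
          Ls (Fin.last k) = ⊤ ∧
          ∀ i : Fin k, ∃ hst : Ls i.castSucc ≤ Ls i.succ,
            letI : Algebra ↥(Ls i.castSucc) ↥(Ls i.succ) :=
              (Subfield.inclusion hst).toAlgebra
            IsGalois ↥(Ls i.castSucc) ↥(Ls i.succ)) ∧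
      UnifWrt (F := ↥𝓕) ⊤ 𝓚 Q (fun k => algebraMap F ↥𝓕 (ζ k)) := by
  classical
  obtain ⟨O', C, hO', hq, hU⟩ :=
    LU.main_core (Ω := AlgebraicClosure F) K O hff htriv habh m ζ hζ
  let 𝓕 : IntermediateField F (AlgebraicClosure F) := IntermediateField.adjoin F (C : Set (AlgebraicClosure F))
  exact ⟨𝓕, LU.final K O C O' hO' hq hU 𝓕 rfl hr⟩
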